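/- For every constant M and every ε > 0 there exists a constant A = A(M,ε) > 0 such that the following holds. Let L be a set of n lines and S a set of k spheres in ℝ³ such that there are no 4 spheres of S and M lines of L with every one of these lines tangent to every one of these spheres (i.e., the line-sphere tangency graph contains no K_{4,M} with 4 spheres and M lines). Then the number T(L,S) of tangent pairs satisfies T(L,S) ≤ A · ( n^{4/5 + ε} k^{4/5} + n + k ). -/

import Mathlib

noncomputable section

abbrev Pt3 := EuclideanSpace ℝ (Fin 3)

/-- The line through `a` with direction `v` (assumed nonzero where relevant). -/
def lineThrough3 (a v : Pt3) : Set Pt3 := {x : Pt3 | ∃ t : ℝ, x = a + t • v}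

/-- A line in space. -/
def IsLine3 (l : Set Pt3) : Prop := ∃ a v : Pt3, v ≠ 0 ∧ l = lineThrough3 a v

/-- A sphere in space: a metric sphere with positive radius. -/
def IsSphere3 (s : Set Pt3) : Prop :=
  ∃ c : Pt3, ∃ r : ℝ, 0 < r ∧ s = Metric.sphere c r

/-- Two subsets of space are tangent if they intersect in exactly one point. -/
def Tangent3 (a b : Set Pt3) : Prop := ∃ p : Pt3, a ∩ b = {p}


namespace LST

open Polynomial Set Filter Topology

/-- piecewise linear order isomorphism -/
theorem exists_stretch (c l : ℝ) (hl : 0 < l) :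
    ∃ τ : ℝ ≃o ℝ, (∀ x ≤ c, τ x = x) ∧ ∀ x, c ≤ x → τ x = c + l * (x - c) := by
  let g : ℝ → ℝ := fun x => if x ≤ c then x else c + l * (x - c)
  have hm : StrictMono g := by
    intro x y hxy
    simp only [g]
    split_ifs with h1 h2 h2
    · exact hxy
    · push Not at h2
      nlinarith [mul_pos hl (sub_pos.2 h2)]
    · linarith
    · nlinarith
  have hs : Function.Surjective g := by
    intro y
    by_cases h : y ≤ c
    · exact ⟨y, by simp [g, h]⟩
    · push Not at h
      refine ⟨c + (y - c) / l, ?_⟩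
      have : 0 < (y - c) / l := div_pos (sub_pos.2 h) hl
      have h2 : ¬ (c + (y - c) / l ≤ c) := by linarith
      simp only [g, if_neg h2]
      field_simp
      ring
  refine ⟨hm.orderIsoOfSurjective g hs, ?_, ?_⟩
  · intro x hx
    simp [g, hx]
  · intro x hx
    simp only [StrictMono.coe_orderIsoOfSurjective, g]
    split_ifs with h
    · have : x = c := le_antisymm h hx
      simp [this]
    · rfl

theorem exists_extend (P : Finset ℝ) (e : ℝ → ℝ) (he : ∀ x ∈ P, ∀ y ∈ P, x < y → e x < e y) :
    ∃ χ : ℝ ≃o ℝ, ∀ x ∈ P, χ x = e x := by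
  induction P using Finset.induction_on_max with
  | empty => exact ⟨OrderIso.refl ℝ, by simp⟩
  | insert m s hm ih =>
    obtain ⟨χ, hχ⟩ := ih (fun x hx y hy => he x (Finset.mem_insert_of_mem hx) y
      (Finset.mem_insert_of_mem hy))
    rcases s.eq_empty_or_nonempty with rfl | hs
    · refine ⟨OrderIso.addRight (e m - m), ?_⟩
      simp
    · set q := s.max' hs with hq
      have hqs : q ∈ s := s.max'_mem hs
      have hqm := hm q hqs
      have h1 : 0 < e m - e q := sub_pos.2 (he q (by simp [hqs]) m (by simp) hqm)
      have h2 : 0 < χ m - χ q := sub_pos.2 (χ.strictMono hqm)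
      obtain ⟨τ, hτ1, hτ2⟩ := exists_stretch (χ q) ((e m - e q) / (χ m - χ q)) (div_pos h1 h2)
      refine ⟨χ.trans τ, ?_⟩
      intro x hx
      rcases Finset.mem_insert.1 hx with rfl | hx
      · rw [OrderIso.trans_apply, hτ2 _ (by linarith), div_mul_cancel₀ _ h2.ne', hχ q hqs]
        ring
      · rw [OrderIso.trans_apply, hτ1 _ (χ.monotone (s.le_max' x hx)), hχ x hx]

theorem sign_mono_aux (f k : ℝ → ℝ) (hf : Continuous f)
    (a b t s : ℝ) (ha : a < t) (hb : t < b) (ha' : a < s) (hb' : s < b) (χ : ℝ ≃o ℝ) (hs : χ t = s)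
    (hfm : StrictMonoOn f (Icc a b)) (hkm : StrictMonoOn k (Icc a b))
    (hfa : SignType.sign (f a) = SignType.sign (k a))
    (hfb : SignType.sign (f b) = SignType.sign (k b))
    (hz : ∀ z, a < z → z < b → f z = 0 → k (χ z) = 0 ∧ a < χ z ∧ χ z < b) :
    SignType.sign (f t) = SignType.sign (k s) := by
  have hab : a < b := ha.trans hb
  have hat := hfm (left_mem_Icc.2 hab.le) ⟨ha.le, hb.le⟩ ha
  have htb := hfm ⟨ha.le, hb.le⟩ (right_mem_Icc.2 hab.le) hb
  have has := hkm (left_mem_Icc.2 hab.le) ⟨ha'.le, hb'.le⟩ ha'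
  have hsb := hkm ⟨ha'.le, hb'.le⟩ (right_mem_Icc.2 hab.le) hb'
  rcases lt_trichotomy (f t) 0 with h | h | h
  · rw [sign_neg h, sign_neg]
    by_cases h2 : f b ≤ 0
    · have : k b ≤ 0 := by
        rcases h2.lt_or_eq with h3 | h3
        · rw [sign_neg h3] at hfb
          exact (sign_eq_neg_one_iff.1 hfb.symm).le
        · rw [h3, sign_zero] at hfb
          exact (sign_eq_zero_iff.1 hfb.symm).le
      linarith
    · push Not at h2
      obtain ⟨z, hz1, hz2⟩ := intermediate_value_Ioo hb.le hf.continuousOn (show (0:ℝ) ∈ Ioo (f t) (f b) from ⟨h, h2⟩)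
      obtain ⟨h3, h4, h5⟩ := hz z (ha.trans hz1.1) hz1.2 hz2
      rw [← h3]
      refine hkm ⟨ha'.le, hb'.le⟩ ⟨h4.le, h5.le⟩ ?_
      rw [← hs]; exact χ.strictMono hz1.1
  · rw [h, ← hs, (hz t ha hb h).1]
  · rw [sign_pos h, sign_pos]
    by_cases h2 : 0 ≤ f a
    · have : 0 ≤ k a := by
        rcases h2.lt_or_eq with h3 | h3
        · rw [sign_pos h3] at hfa
          exact (sign_eq_one_iff.1 hfa.symm).le
        · rw [← h3, sign_zero] at hfa
          exact (sign_eq_zero_iff.1 hfa.symm).ge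
      linarith
    · push Not at h2
      obtain ⟨z, hz1, hz2⟩ := intermediate_value_Ioo ha.le hf.continuousOn (show (0:ℝ) ∈ Ioo (f a) (f t) from ⟨h2, h⟩)
      obtain ⟨h3, h4, h5⟩ := hz z hz1.1 (hz1.2.trans hb) hz2
      rw [← h3]
      refine hkm ⟨h4.le, h5.le⟩ ⟨ha'.le, hb'.le⟩ ?_
      rw [← hs]; exact χ.strictMono hz1.2

/-- Real-analysis core. -/
theorem rl_core (f k : ℝ → ℝ) (hf : Continuous f) (hk : Continuous k) (Z : Finset ℝ)
    (hzf : {t | f t = 0}.Finite)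
    (l r : ℝ) (hl : l ∈ Z) (hr : r ∈ Z)
    (hlo : ∀ s ≤ l, ∀ t ≤ l, SignType.sign (f s) = SignType.sign (k t))
    (hhi : ∀ s, r ≤ s → ∀ t, r ≤ t → SignType.sign (f s) = SignType.sign (k t))
    (hlo0 : ∀ s ≤ l, f s ≠ 0) (hhi0 : ∀ s, r ≤ s → f s ≠ 0)
    (hZ : ∀ z ∈ Z, SignType.sign (f z) = SignType.sign (k z))
    (hm : ∀ x y, x < y → (∀ z ∈ Z, z ≤ x ∨ y ≤ z) →
      (StrictMonoOn f (Icc x y) ∧ StrictMonoOn k (Icc x y)) ∨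
      (StrictAntiOn f (Icc x y) ∧ StrictAntiOn k (Icc x y))) :
    ∃ χ : ℝ ≃o ℝ, (∀ z ∈ Z, χ z = z) ∧ ∀ t, SignType.sign (f t) = SignType.sign (k (χ t)) := by
  -- neighbours
  have hnb : ∀ t, t ∉ Z → l ≤ t → t ≤ r → ∃ a ∈ Z, ∃ b ∈ Z, a < t ∧ t < b ∧
      ∀ z ∈ Z, z ≤ a ∨ b ≤ z := by
    intro t ht h1 h2
    have h1' : l < t := lt_of_le_of_ne h1 (fun h => ht (h ▸ hl))
    have h2' : t < r := lt_of_le_of_ne h2 (fun h => ht (h ▸ hr))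
    have n1 : (Z.filter (· < t)).Nonempty := ⟨l, by simp [hl, h1']⟩
    have n2 : (Z.filter (t < ·)).Nonempty := ⟨r, by simp [hr, h2']⟩
    have m1 := Finset.max'_mem _ n1
    have m2 := Finset.min'_mem _ n2
    rw [Finset.mem_filter] at m1 m2
    refine ⟨_, m1.1, _, m2.1, m1.2, m2.2, ?_⟩
    intro z hz
    rcases lt_trichotomy z t with h | h | h
    · left; exact Finset.le_max' _ _ (by simp [hz, h])
    · exact absurd (h ▸ hz) ht
    · right; exact Finset.min'_le _ _ (by simp [hz, h])
  have hcase : ∀ z0, f z0 = 0 → l ≤ z0 ∧ z0 ≤ r := by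
    intro z0 h0
    constructor
    · by_contra h; push Not at h; exact hlo0 _ h.le h0
    · by_contra h; push Not at h; exact hhi0 _ h.le h0
  have hz1 : ∀ z0, ∃ z1, (z0 ∈ Z → z1 = z0) ∧ (z0 ∉ Z → f z0 = 0 → k z1 = 0 ∧
      ∃ a ∈ Z, ∃ b ∈ Z, a < z0 ∧ z0 < b ∧ a < z1 ∧ z1 < b ∧ (∀ z ∈ Z, z ≤ a ∨ b ≤ z)) := by
    intro z0
    by_cases hz0 : z0 ∈ Z
    · exact ⟨z0, fun _ => rfl, fun h => absurd hz0 h⟩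
    by_cases h0 : f z0 = 0
    swap
    · exact ⟨z0, fun _ => rfl, fun _ h => absurd h h0⟩
    obtain ⟨a, haZ, b, hbZ, ha, hb, hab⟩ := hnb z0 hz0 (hcase z0 h0).1 (hcase z0 h0).2
    have hab' := ha.trans hb
    have hfa := hZ a haZ
    have hfb := hZ b hbZ
    rcases hm a b hab' hab with ⟨h1, h2⟩ | ⟨h1, h2⟩
    · have e1 : f a < 0 := h0 ▸ h1 (left_mem_Icc.2 hab'.le) ⟨ha.le, hb.le⟩ ha
      have e2 : 0 < f b := h0 ▸ h1 ⟨ha.le, hb.le⟩ (right_mem_Icc.2 hab'.le) hb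
      rw [sign_neg e1] at hfa
      rw [sign_pos e2] at hfb
      obtain ⟨z, hz, hz2⟩ := intermediate_value_Ioo hab'.le hk.continuousOn
        (show (0:ℝ) ∈ Ioo (k a) (k b) from ⟨sign_eq_neg_one_iff.1 hfa.symm, sign_eq_one_iff.1 hfb.symm⟩)
      exact ⟨z, fun h => absurd h hz0, fun _ _ => ⟨hz2, a, haZ, b, hbZ, ha, hb, hz.1, hz.2, hab⟩⟩
    · have e1 : 0 < f a := h0 ▸ h1 (left_mem_Icc.2 hab'.le) ⟨ha.le, hb.le⟩ ha
      have e2 : f b < 0 := h0 ▸ h1 ⟨ha.le, hb.le⟩ (right_mem_Icc.2 hab'.le) hb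
      rw [sign_pos e1] at hfa
      rw [sign_neg e2] at hfb
      obtain ⟨z, hz, hz2⟩ := intermediate_value_Ioo' hab'.le hk.continuousOn
        (show (0:ℝ) ∈ Ioo (k b) (k a) from ⟨sign_eq_neg_one_iff.1 hfb.symm, sign_eq_one_iff.1 hfa.symm⟩)
      exact ⟨z, fun h => absurd h hz0, fun _ _ => ⟨hz2, a, haZ, b, hbZ, ha, hb, hz.1, hz.2, hab⟩⟩
  choose e he1 he2 using hz1
  obtain ⟨χ, hχ⟩ := exists_extend (Z ∪ hzf.toFinset) e (by
    intro x hx y hy hxy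
    by_cases hxZ : x ∈ Z
    · rw [he1 x hxZ]
      by_cases hyZ : y ∈ Z
      · rwa [he1 y hyZ]
      · have hy0 : f y = 0 := by simpa [hyZ] using hy
        obtain ⟨-, a, ha, b, hb, h1, h2, h3, h4, h5⟩ := he2 y hyZ hy0
        rcases h5 x hxZ with h | h
        · linarith
        · linarith
    · have hx0 : f x = 0 := by simpa [hxZ] using hx
      obtain ⟨-, a, ha, b, hb, h1, h2, h3, h4, h5⟩ := he2 x hxZ hx0
      by_cases hyZ : y ∈ Z
      · rw [he1 y hyZ]
        rcases h5 y hyZ with h | h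
        · linarith
        · linarith
      · have hy0 : f y = 0 := by simpa [hyZ] using hy
        obtain ⟨-, a', ha', b', hb', h1', h2', h3', h4', h5'⟩ := he2 y hyZ hy0
        rcases h5' b hb with h | h
        · linarith
        · exfalso
          have hyb : y < b := by linarith
          rcases hm a b (h1.trans h2) h5 with ⟨q1, q2⟩ | ⟨q1, q2⟩
          · have := q1 ⟨h1.le, h2.le⟩ ⟨(h1.trans hxy).le, hyb.le⟩ hxy
            linarith
          · have := q1 ⟨h1.le, h2.le⟩ ⟨(h1.trans hxy).le, hyb.le⟩ hxy
            linarith)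
  have hχZ : ∀ z ∈ Z, χ z = z := fun z hz => by
    rw [hχ z (by simp [hz]), he1 z hz]
  refine ⟨χ, hχZ, ?_⟩
  intro t
  by_cases htZ : t ∈ Z
  · rw [hχZ t htZ]; exact hZ t htZ
  by_cases h1 : t < l
  · exact hlo t h1.le _ (by rw [← hχZ l hl]; exact χ.monotone h1.le)
  by_cases h2 : r < t
  · exact hhi t h2.le _ (by rw [← hχZ r hr]; exact χ.monotone h2.le)
  push Not at h1 h2
  obtain ⟨a, haZ, b, hbZ, ha, hb, hab⟩ := hnb t htZ h1 h2
  have e1 : a < χ t := by rw [← hχZ a haZ]; exact χ.strictMono ha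
  have e2 : χ t < b := by rw [← hχZ b hbZ]; exact χ.strictMono hb
  have hzz : ∀ z, a < z → z < b → f z = 0 → k (χ z) = 0 ∧ a < χ z ∧ χ z < b := by
    intro z h3 h4 h5
    have hzZ : z ∉ Z := by
      intro h
      rcases hab z h with h | h
      · linarith
      · linarith
    refine ⟨?_, ?_, ?_⟩
    · rw [hχ z (by simp [h5])]; exact (he2 z hzZ h5).1
    · rw [← hχZ a haZ]; exact χ.strictMono h3
    · rw [← hχZ b hbZ]; exact χ.strictMono h4
  rcases hm a b (ha.trans hb) hab with ⟨q1, q2⟩ | ⟨q1, q2⟩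
  · exact sign_mono_aux f k hf a b t (χ t) ha hb e1 e2 χ rfl q1 q2 (hZ a haZ) (hZ b hbZ) hzz
  · have := sign_mono_aux (fun x => - f x) (fun x => - k x) hf.neg a b t (χ t) ha hb e1 e2 χ rfl
      q1.neg q2.neg (by simp only [Left.sign_neg, hZ a haZ]) (by simp only [Left.sign_neg, hZ b hbZ])
      (by simpa using hzz)
    simpa only [Left.sign_neg, neg_inj] using this

end LST


namespace LST

open Polynomial Set Filter Topology

theorem sign_const {g : ℝ → ℝ} (hg : Continuous g) {s t : ℝ} (h : ∀ z ∈ uIcc s t, g z ≠ 0) :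
    SignType.sign (g s) = SignType.sign (g t) := by
  have hs := h s left_mem_uIcc
  have ht := h t right_mem_uIcc
  have key : ¬ ((0:ℝ) ∈ uIcc (g s) (g t)) := by
    intro h0
    obtain ⟨z, hz, hz0⟩ := intermediate_value_uIcc hg.continuousOn h0
    exact h z hz hz0
  rw [mem_uIcc] at key
  push Not at key
  rcases lt_or_gt_of_ne hs with h1 | h1 <;> rcases lt_or_gt_of_ne ht with h2 | h2
  · rw [sign_neg h1, sign_neg h2]
  · exact absurd (key.1 h1.le) (by linarith)
  · exact absurd (key.2 h2.le) (by linarith)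
  · rw [sign_pos h1, sign_pos h2]

theorem sign_equiv {l : Filter ℝ} {f g : ℝ → ℝ} (h : Asymptotics.IsEquivalent l f g) :
    ∀ᶠ t in l, SignType.sign (f t) = SignType.sign (g t) := by
  obtain ⟨u, hu, hfu⟩ := h.exists_eq_mul
  have h1 : ∀ᶠ t in l, 0 < u t := hu.eventually (lt_mem_nhds one_pos)
  filter_upwards [h1, hfu] with t ht h2
  rw [h2, Pi.mul_apply, sign_mul, sign_pos ht, one_mul]

theorem sign_atTop (p : ℝ[X]) :
    ∀ᶠ t in atTop, SignType.sign (p.eval t) = SignType.sign (p.leadingCoeff) := by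
  filter_upwards [sign_equiv p.isEquivalent_atTop_lead, eventually_gt_atTop 0] with t h1 h2
  rw [h1, sign_mul, sign_pos (pow_pos h2 _), mul_one]

theorem sign_atBot (p : ℝ[X]) :
    ∀ᶠ t in atBot, SignType.sign (p.eval t) = SignType.sign (p.leadingCoeff) * (-1) ^ p.natDegree := by
  filter_upwards [sign_equiv p.isEquivalent_atBot_lead, eventually_lt_atBot 0] with t h1 h2
  rw [h1, sign_mul, sign_pow, sign_neg h2]

theorem rl_poly (p q : ℝ[X]) (hpq : p.natDegree = q.natDegree)
    (hp0 : p ≠ 0)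
    (hlead : SignType.sign p.leadingCoeff = SignType.sign q.leadingCoeff)
    (φ : ℝ ≃o ℝ) (Z : Finset ℝ) (hZ' : ∀ t, p.derivative.eval t = 0 → t ∈ Z)
    (hd : ∀ t, SignType.sign (p.derivative.eval t) = SignType.sign (q.derivative.eval (φ t)))
    (hZ : ∀ z ∈ Z, SignType.sign (p.eval z) = SignType.sign (q.eval (φ z))) :
    ∃ χ : ℝ ≃o ℝ, (∀ z ∈ Z, χ z = z) ∧
      ∀ t, SignType.sign (p.eval t) = SignType.sign (q.eval (φ (χ t))) := by
  have t1 : Tendsto φ atTop atTop := φ.tendsto_atTop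
  have t2 : Tendsto φ atBot atBot := φ.tendsto_atBot
  obtain ⟨r, hr⟩ := eventually_atTop.1 ((sign_atTop p).and (t1.eventually (sign_atTop q)))
  obtain ⟨l, hl⟩ := eventually_atBot.1 ((sign_atBot p).and (t2.eventually (sign_atBot q)))
  have hlc : SignType.sign p.leadingCoeff ≠ 0 := by
    rw [ne_eq, sign_eq_zero_iff, leadingCoeff_eq_zero]; exact hp0
  have hlo : ∀ s ≤ l, ∀ t ≤ l, SignType.sign (p.eval s) = SignType.sign (q.eval (φ t)) := by
    intro s hs t ht
    rw [(hl s hs).1, (hl t ht).2, hlead, hpq]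
  have hhi : ∀ s, r ≤ s → ∀ t, r ≤ t → SignType.sign (p.eval s) = SignType.sign (q.eval (φ t)) := by
    intro s hs t ht
    rw [(hr s hs).1, (hr t ht).2, hlead]
  obtain ⟨χ, h1, h2⟩ := rl_core (fun t => p.eval t) (fun t => q.eval (φ t)) p.continuous
    (q.continuous.comp φ.continuous) (insert l (insert r Z))
    ((p.roots.toFinset.finite_toSet).subset (by intro t ht; simp [hp0]; exact ht)) l r (by simp) (by simp)
    hlo hhi
    (by
      intro s hs h0
      have := (hl s hs).1
      rw [h0, sign_zero] at this
      rcases neg_one_pow_eq_or SignType p.natDegree with h | h <;> rw [h] at this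
      · rw [mul_one] at this; exact hlc this.symm
      · revert this hlc; generalize SignType.sign p.leadingCoeff = x; revert x; decide)
    (by
      intro s hs h0
      have := (hr s hs).1
      rw [h0, sign_zero] at this
      exact hlc this.symm)
    (by
      intro z hz
      rcases Finset.mem_insert.1 hz with rfl | hz
      · exact hlo _ le_rfl _ le_rfl
      rcases Finset.mem_insert.1 hz with rfl | hz
      · exact hhi _ le_rfl _ le_rfl
      · exact hZ z hz)
    (by
      intro x y hxy hxyZ
      have hne : ∀ t, x < t → t < y → p.derivative.eval t ≠ 0 := by
        intro t h1 h2 h3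
        rcases hxyZ t (by simp [hZ' t h3]) with h | h <;> linarith
      set m := (x + y) / 2 with hm
      have hxm : x < m := by rw [hm]; linarith
      have hmy : m < y := by rw [hm]; linarith
      have hs : ∀ t, x < t → t < y → SignType.sign (p.derivative.eval t) =
          SignType.sign (p.derivative.eval m) := by
        intro t h1 h2
        refine sign_const (g := fun t => p.derivative.eval t) p.derivative.continuous ?_
        intro z hz
        rw [mem_uIcc] at hz
        rcases hz with hz | hz
        · exact hne z (by linarith) (by linarith)
        · exact hne z (by linarith) (by linarith)
      have hsq : ∀ u ∈ interior (Icc (φ x) (φ y)), SignType.sign (deriv (fun t => q.eval t) u) =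
          SignType.sign (p.derivative.eval m) := by
        intro u hu
        rw [interior_Icc] at hu
        rw [Polynomial.deriv]
        obtain ⟨t, rfl⟩ := φ.surjective u
        rw [← hd, hs t (φ.lt_iff_lt.1 hu.1) (φ.lt_iff_lt.1 hu.2)]
      have hsp : ∀ u ∈ interior (Icc x y), SignType.sign (deriv (fun t => p.eval t) u) =
          SignType.sign (p.derivative.eval m) := by
        intro u hu
        rw [interior_Icc] at hu
        rw [Polynomial.deriv]
        exact hs u hu.1 hu.2
      have maps : MapsTo φ (Icc x y) (Icc (φ x) (φ y)) := fun t ht =>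
        ⟨φ.monotone ht.1, φ.monotone ht.2⟩
      rcases lt_or_gt_of_ne (hne m hxm hmy) with h | h
      · right
        rw [sign_neg h] at hsq hsp
        refine ⟨strictAntiOn_of_deriv_neg (convex_Icc x y) p.continuousOn
          (fun u hu => sign_eq_neg_one_iff.1 (hsp u hu)), ?_⟩
        have := strictAntiOn_of_deriv_neg (convex_Icc (φ x) (φ y)) q.continuousOn
          (fun u hu => sign_eq_neg_one_iff.1 (hsq u hu))
        exact this.comp_strictMonoOn (φ.strictMono.strictMonoOn _) maps
      · left
        rw [sign_pos h] at hsq hsp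
        refine ⟨strictMonoOn_of_deriv_pos (convex_Icc x y) p.continuousOn
          (fun u hu => sign_eq_one_iff.1 (hsp u hu)), ?_⟩
        have := strictMonoOn_of_deriv_pos (convex_Icc (φ x) (φ y)) q.continuousOn
          (fun u hu => sign_eq_one_iff.1 (hsq u hu))
        exact this.comp (φ.strictMono.strictMonoOn _) maps)
  exact ⟨χ, fun z hz => h1 z (by simp [hz]), h2⟩

/-- pseudo division -/
theorem pseudo_div {A : Type*} [CommRing A] (g : A[X]) (hg : 0 < g.natDegree) (f : A[X]) :
    ∃ (m : ℕ) (q r : A[X]), C g.leadingCoeff ^ m * f = q * g + r ∧ r.natDegree < g.natDegree := by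
  induction hN : f.natDegree using Nat.strong_induction_on generalizing f with
  | _ N ih =>
    by_cases h : f.natDegree < g.natDegree
    · exact ⟨0, 0, f, by simp, h⟩
    · push Not at h
      set f1 := C g.leadingCoeff * f - C f.leadingCoeff * X ^ (f.natDegree - g.natDegree) * g with hf1
      have hlt : f1.natDegree < f.natDegree := by
        have hle : f1.natDegree ≤ f.natDegree := by
          refine (natDegree_sub_le _ _).trans (max_le (natDegree_C_mul_le _ _) ?_)
          refine natDegree_mul_le.trans ?_
          have := natDegree_C_mul_X_pow_le f.leadingCoeff (f.natDegree - g.natDegree)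
          omega
        refine lt_of_le_of_ne hle ?_
        intro heq
        have hc : f1.coeff f.natDegree = 0 := by
          rw [hf1, coeff_sub, coeff_C_mul, mul_assoc, coeff_C_mul]
          conv_lhs => arg 2; arg 2; arg 2; rw [← Nat.sub_add_cancel h]
          rw [Nat.add_comm, coeff_X_pow_mul]
          simp only [leadingCoeff]; ring
        rw [← heq, ← leadingCoeff, leadingCoeff_eq_zero] at hc
        rw [hc, natDegree_zero] at heq
        omega
      obtain ⟨m, q, r, h1, h2⟩ := ih _ (hN ▸ hlt) f1 rfl
      refine ⟨m + 1, q + C g.leadingCoeff ^ m * (C f.leadingCoeff * X ^ (f.natDegree - g.natDegree)), r, ?_, h2⟩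
      rw [hf1] at h1
      linear_combination h1

theorem OI {A : Type*} [CommRing A] (F : Multiset A[X]) :
    ∃ H : Set A, H.Finite ∧ ∀ α β : A →+* ℝ,
      (∀ h ∈ H, SignType.sign (α h) = SignType.sign (β h)) →
      ∃ φ : ℝ ≃o ℝ, ∀ f ∈ F, ∀ t,
        SignType.sign (f.eval₂ α t) = SignType.sign (f.eval₂ β (φ t)) := by
  classical
  generalize hS : F.map natDegree = S
  revert F
  refine Multiset.wellFounded_isDershowitzMannaLT.induction
    (C := fun S : Multiset ℕ => ∀ F : Multiset A[X], F.map natDegree = S → ∃ H : Set A, H.Finite ∧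
      ∀ α β : A →+* ℝ, (∀ h ∈ H, SignType.sign (α h) = SignType.sign (β h)) →
      ∃ φ : ℝ ≃o ℝ, ∀ f ∈ F, ∀ t,
        SignType.sign (f.eval₂ α t) = SignType.sign (f.eval₂ β (φ t))) S ?_
  intro S ih F hS
  subst hS
  by_cases hall : ∀ f ∈ F, f.natDegree = 0
  · refine ⟨(fun f : A[X] => f.coeff 0) '' {f | f ∈ F}, (F.toFinset.finite_toSet.subset
      (by intro f hf; simpa using hf)).image _, ?_⟩
    intro α β h
    refine ⟨OrderIso.refl ℝ, ?_⟩
    intro f hf t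
    rw [eq_C_of_natDegree_eq_zero (hall f hf)]
    simp only [eval₂_C]
    exact h _ ⟨f, hf, rfl⟩
  push Not at hall
  -- eraseLead sets
  have hE : ∀ f, f ∈ F → 0 < f.natDegree → ∃ H : Set A, H.Finite ∧ ∀ α β : A →+* ℝ,
      (∀ h ∈ H, SignType.sign (α h) = SignType.sign (β h)) →
      ∃ φ : ℝ ≃o ℝ, ∀ g ∈ f.eraseLead ::ₘ F.erase f, ∀ t,
        SignType.sign (g.eval₂ α t) = SignType.sign (g.eval₂ β (φ t)) := by
    intro f hf hfd
    refine ih _ ?_ (f.eraseLead ::ₘ F.erase f) rfl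
    refine ⟨(F.erase f).map natDegree, {f.eraseLead.natDegree}, {f.natDegree}, by simp, ?_, ?_, ?_⟩
    · rw [Multiset.map_cons, ← Multiset.singleton_add, add_comm]
    · conv_lhs => rw [← Multiset.cons_erase hf]
      rw [Multiset.map_cons, ← Multiset.singleton_add, add_comm]
    · have := f.eraseLead_natDegree_le
      simp; omega
  -- f of max degree
  obtain ⟨f0, hf0, hf0d⟩ := hall
  obtain ⟨f, hfF, hmax⟩ := Finset.exists_max_image F.toFinset natDegree ⟨f0, by simpa using hf0⟩
  rw [Multiset.mem_toFinset] at hfF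
  have hmax' : ∀ g ∈ F, g.natDegree ≤ f.natDegree := fun g hg => hmax g (by simpa using hg)
  have hfd : 0 < f.natDegree := by have := hmax' f0 hf0; omega
  set G : Multiset A[X] := derivative f ::ₘ F.erase f with hG
  have hpd : ∀ g : A[X], ∃ (m : ℕ) (q r : A[X]), 0 < g.natDegree →
      (C g.leadingCoeff ^ m * f = q * g + r ∧ r.natDegree < g.natDegree) := by
    intro g
    by_cases hg : 0 < g.natDegree
    · obtain ⟨m, q, r, h⟩ := pseudo_div g hg f
      exact ⟨m, q, r, fun _ => h⟩
    · exact ⟨0, 0, 0, fun h => absurd h hg⟩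
  choose mm qq rr hrr using hpd
  set G1 := G.filter (fun g => 0 < g.natDegree) with hG1
  have hGd : ∀ g ∈ G, g.natDegree ≤ f.natDegree := by
    intro g hg
    rw [hG, Multiset.mem_cons] at hg
    rcases hg with rfl | hg
    · have := natDegree_derivative_le f; omega
    · exact hmax' g (Multiset.mem_of_mem_erase hg)
  obtain ⟨H2, hH2f, hH2⟩ := ih _ (by
    refine ⟨(F.erase f).map natDegree, (derivative f ::ₘ G1.map rr).map natDegree, {f.natDegree},
      by simp, rfl, ?_, ?_⟩
    · conv_lhs => rw [← Multiset.cons_erase hfF]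
      rw [Multiset.map_cons, ← Multiset.singleton_add, add_comm]
    · intro y hy
      refine ⟨f.natDegree, by simp, ?_⟩
      rw [Multiset.mem_map] at hy
      obtain ⟨g, hg, rfl⟩ := hy
      rw [Multiset.mem_cons] at hg
      rcases hg with rfl | hg
      · have := natDegree_derivative_le f; omega
      · rw [Multiset.mem_map] at hg
        obtain ⟨g, hg, rfl⟩ := hg
        rw [hG1, Multiset.mem_filter] at hg
        exact lt_of_lt_of_le (hrr g hg.2).2 (hGd g hg.1)) (F.erase f + (derivative f ::ₘ G1.map rr))
      (by rw [Multiset.map_add])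
  choose! HE hHEf hHE using hE
  have hfin : {g | g ∈ F ∧ 0 < g.natDegree}.Finite := F.toFinset.finite_toSet.subset
      (by intro f hf; simpa using hf.1)
  refine ⟨(fun g : A[X] => g.leadingCoeff) '' {g | g ∈ derivative f ::ₘ F} ∪ (⋃ g ∈ {g | g ∈ F ∧ 0 < g.natDegree}, HE g) ∪ H2,
    ((((derivative f ::ₘ F).toFinset.finite_toSet.subset (by intro g hg; simpa using hg)).image _).union
      (hfin.biUnion (fun g hg => hHEf g hg.1 hg.2))).union hH2f, ?_⟩
  intro α β hαβ
  have hlead : ∀ g ∈ derivative f ::ₘ F, SignType.sign (α g.leadingCoeff) = SignType.sign (β g.leadingCoeff) :=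
    fun g hg => hαβ _ (Or.inl (Or.inl ⟨g, hg, rfl⟩))
  have hzz : ∀ g ∈ derivative f ::ₘ F, α g.leadingCoeff = 0 → β g.leadingCoeff = 0 := by
    intro g hg h
    have := hlead g hg
    rw [h, sign_zero] at this
    exact sign_eq_zero_iff.1 this.symm
  by_cases hvan : ∃ g ∈ F, 0 < g.natDegree ∧ α g.leadingCoeff = 0
  · obtain ⟨g, hg, hgd, hg0⟩ := hvan
    obtain ⟨φ, hφ⟩ := hHE g hg hgd α β (fun h hh => hαβ h (Or.inl (Or.inr (by
      simp only [mem_iUnion]; exact ⟨g, ⟨hg, hgd⟩, hh⟩))))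
    refine ⟨φ, ?_⟩
    intro p hp t
    by_cases hpg : p = g
    · subst hpg
      have e := p.eraseLead_add_C_mul_X_pow
      have hb0 := hzz p (Multiset.mem_cons_of_mem hg) hg0
      have ea : p.eval₂ α t = p.eraseLead.eval₂ α t := by
        have := congrArg (eval₂ α t) e
        rw [eval₂_add, eval₂_mul, eval₂_C, hg0, zero_mul, add_zero] at this
        exact this.symm
      have eb : p.eval₂ β (φ t) = p.eraseLead.eval₂ β (φ t) := by
        have := congrArg (eval₂ β (φ t)) e
        rw [eval₂_add, eval₂_mul, eval₂_C, hb0, zero_mul, add_zero] at this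
        exact this.symm
      rw [ea, eb]
      exact hφ _ (Multiset.mem_cons_self _ _) t
    · exact hφ p (Multiset.mem_cons_of_mem ((Multiset.mem_erase_of_ne hpg).2 hp)) t
  push Not at hvan
  obtain ⟨φ, hφ⟩ := hH2 α β (fun h hh => hαβ h (Or.inr hh))
  have hφG : ∀ g ∈ G, ∀ t, SignType.sign (g.eval₂ α t) = SignType.sign (g.eval₂ β (φ t)) := by
    intro g hg t
    refine hφ g ?_ t
    rw [hG, Multiset.mem_cons] at hg
    rw [Multiset.mem_add, Multiset.mem_cons]
    tauto
  -- leads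
  have hnα : ∀ g ∈ F, 0 < g.natDegree → α g.leadingCoeff ≠ 0 := hvan
  have hnβ : ∀ g ∈ F, 0 < g.natDegree → β g.leadingCoeff ≠ 0 := by
    intro g hg hgd h
    have := hlead g (Multiset.mem_cons_of_mem hg)
    rw [h, sign_zero, sign_eq_zero_iff] at this
    exact hnα g hg hgd this
  -- the derivative does have nonvanishing coefficient
  set p := f.map α with hp
  set q := f.map β with hq
  have hpl : p.leadingCoeff = α f.leadingCoeff := leadingCoeff_map_of_leadingCoeff_ne_zero _ (hnα f hfF hfd)
  have hql : q.leadingCoeff = β f.leadingCoeff := leadingCoeff_map_of_leadingCoeff_ne_zero _ (hnβ f hfF hfd)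
  have hpn : p.natDegree = f.natDegree := natDegree_map_of_leadingCoeff_ne_zero _ (hnα f hfF hfd)
  have hqn : q.natDegree = f.natDegree := natDegree_map_of_leadingCoeff_ne_zero _ (hnβ f hfF hfd)
  have hp0 : p ≠ 0 := by
    intro h; rw [h, natDegree_zero] at hpn; omega
  have hd0 : (derivative f).map α ≠ 0 := by
    rw [← derivative_map, ← hp]
    intro h
    have := derivative_eq_zero.1 h
    omega
  -- lead of derivative
  have hdl : (derivative f).leadingCoeff = f.natDegree * f.leadingCoeff ∧
      (derivative f).natDegree = f.natDegree - 1 := by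
    have hc : (derivative f).coeff (f.natDegree - 1) = f.natDegree * f.leadingCoeff := by
      rw [coeff_derivative, Nat.sub_add_cancel hfd, leadingCoeff]
      have : ((f.natDegree - 1 : ℕ) : A) + 1 = f.natDegree := by
        rw [← Nat.cast_succ, Nat.succ_eq_add_one, Nat.sub_add_cancel hfd]
      rw [this]; ring
    have hne : (derivative f).coeff (f.natDegree - 1) ≠ 0 := by
      intro h0
      rw [h0] at hc
      have := congrArg α hc
      rw [map_zero, map_mul, map_natCast] at this
      rcases mul_eq_zero.1 this.symm with h | h
      · have : f.natDegree = 0 := by exact_mod_cast h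
        omega
      · exact hnα f hfF hfd h
    have hnd : (derivative f).natDegree = f.natDegree - 1 :=
      le_antisymm (natDegree_derivative_le f) (le_natDegree_of_ne_zero hne)
    exact ⟨by rw [leadingCoeff, hnd, hc], hnd⟩
  have hdlα : α (derivative f).leadingCoeff ≠ 0 := by
    rw [hdl.1, map_mul, map_natCast]
    exact mul_ne_zero (by exact_mod_cast hfd.ne') (hnα f hfF hfd)
  have hGα : ∀ g ∈ G, 0 < g.natDegree → α g.leadingCoeff ≠ 0 := by
    intro g hg hgd
    rw [hG, Multiset.mem_cons] at hg
    rcases hg with rfl | hg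
    · exact hdlα
    · exact hnα g (Multiset.mem_of_mem_erase hg) hgd
  have hGl : ∀ g ∈ G, SignType.sign (α g.leadingCoeff) = SignType.sign (β g.leadingCoeff) := by
    intro g hg
    refine hlead g ?_
    rw [hG, Multiset.mem_cons] at hg
    rw [Multiset.mem_cons]
    rcases hg with rfl | hg
    · left; rfl
    · right; exact Multiset.mem_of_mem_erase hg
  -- roots
  set Z : Finset ℝ := G1.toFinset.biUnion (fun g => (g.map α).roots.toFinset) with hZ
  have hZmem : ∀ g ∈ G, 0 < g.natDegree → ∀ t, g.eval₂ α t = 0 → t ∈ Z := by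
    intro g hg hgd t ht
    rw [hZ, Finset.mem_biUnion]
    refine ⟨g, by rw [Multiset.mem_toFinset, hG1, Multiset.mem_filter]; exact ⟨hg, hgd⟩, ?_⟩
    rw [Multiset.mem_toFinset, mem_roots', IsRoot.def, eval_map]
    refine ⟨?_, ht⟩
    intro h
    have := leadingCoeff_map_of_leadingCoeff_ne_zero _ (hGα g hg hgd)
    rw [h, leadingCoeff_zero] at this
    exact hGα g hg hgd this.symm
  have hZsign : ∀ z ∈ Z, SignType.sign (p.eval z) = SignType.sign (q.eval (φ z)) := by
    intro z hz
    rw [hZ, Finset.mem_biUnion] at hz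
    obtain ⟨g, hg, hz⟩ := hz
    rw [Multiset.mem_toFinset] at hg
    have hg' := hg
    rw [hG1, Multiset.mem_filter] at hg'
    obtain ⟨hgG, hgd⟩ := hg'
    rw [Multiset.mem_toFinset, mem_roots', IsRoot.def, eval_map] at hz
    have hzα := hz.2
    have hzβ : g.eval₂ β (φ z) = 0 := by
      have := hφG g hgG z
      rw [hzα, sign_zero] at this
      exact sign_eq_zero_iff.1 this.symm
    have hr := hφ (rr g) (by
      rw [Multiset.mem_add, Multiset.mem_cons]
      exact Or.inr (Or.inr (Multiset.mem_map_of_mem _ hg))) z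
    have hα := congrArg (eval₂ α z) (hrr g hgd).1
    have hβ := congrArg (eval₂ β (φ z)) (hrr g hgd).1
    rw [eval₂_mul, eval₂_pow, eval₂_C, eval₂_add, eval₂_mul, hzα, mul_zero, zero_add] at hα
    rw [eval₂_mul, eval₂_pow, eval₂_C, eval₂_add, eval₂_mul, hzβ, mul_zero, zero_add] at hβ
    rw [← hα, ← hβ, sign_mul, sign_mul, sign_pow, sign_pow, ← hGl g hgG] at hr
    rw [hp, hq, eval_map, eval_map]
    have hs : SignType.sign (α g.leadingCoeff) ^ mm g ≠ 0 := by
      apply pow_ne_zero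
      rw [ne_eq, sign_eq_zero_iff]
      exact hGα g hgG hgd
    revert hs hr
    generalize SignType.sign (α g.leadingCoeff) ^ mm g = x
    generalize SignType.sign (eval₂ α z f) = y
    generalize SignType.sign (eval₂ β (φ z) f) = w
    revert x y w
    decide
  obtain ⟨χ, hχZ, hχ⟩ := rl_poly p q (hpn.trans hqn.symm) hp0
    (by rw [hpl, hql]; exact hlead f (Multiset.mem_cons_of_mem hfF)) φ Z
    (by
      intro t ht
      rw [hp, derivative_map, eval_map] at ht
      by_cases h : 0 < (derivative f).natDegree
      · exact hZmem _ (Multiset.mem_cons_self _ _) h t ht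
      · exfalso
        have h0 : (derivative f).natDegree = 0 := by omega
        rw [eq_C_of_natDegree_eq_zero h0, eval₂_C, ← h0] at ht
        exact hdlα ht)
    (by
      intro t
      rw [hp, hq, derivative_map, derivative_map, eval_map, eval_map]
      exact hφG _ (Multiset.mem_cons_self _ _) t) hZsign
  refine ⟨χ.trans φ, ?_⟩
  intro g hgF t
  by_cases hgf : g = f
  · subst hgf
    have := hχ t
    rw [hp, hq, eval_map, eval_map] at this
    exact this
  have hgG : g ∈ G := Multiset.mem_cons_of_mem ((Multiset.mem_erase_of_ne hgf).2 hgF)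
  rw [OrderIso.trans_apply, ← hφG g hgG]
  by_cases hgd : 0 < g.natDegree
  swap
  · have h0 : g.natDegree = 0 := by omega
    rw [eq_C_of_natDegree_eq_zero h0, eval₂_C, eval₂_C]
  by_cases htZ : t ∈ Z
  · rw [hχZ t htZ]
  have hc : Continuous (fun t => g.eval₂ α t) := by
    simp_rw [← eval_map]
    exact (g.map α).continuous
  refine sign_const (g := fun t => g.eval₂ α t) hc ?_
  intro z hz h0
  have hzZ := hZmem g hgG hgd z h0
  have hzχ := hχZ z hzZ
  rw [mem_uIcc] at hz
  have : z = t := by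
    rcases hz with hz | hz
    · have h2 := χ.monotone hz.1
      rw [hzχ] at h2
      have h3 : χ z = χ t := by rw [hzχ]; exact le_antisymm hz.2 h2
      exact χ.injective h3
    · have h2 := χ.monotone hz.2
      rw [hzχ] at h2
      have h3 : χ z = χ t := by rw [hzχ]; exact le_antisymm h2 hz.1
      exact χ.injective h3
  exact htZ (this ▸ hzZ)

end LST


namespace LST

open Polynomial Set Filter Topology

/-- set of roots of a finite family -/
def rt {I : Type} [Fintype I] (P : I → ℝ[X]) : Finset ℝ :=
  Finset.univ.biUnion (fun g => (P g).roots.toFinset)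

theorem mem_rt {I : Type} [Fintype I] {P : I → ℝ[X]} {t : ℝ} :
    t ∈ rt P ↔ ∃ g, P g ≠ 0 ∧ (P g).eval t = 0 := by
  simp [rt, mem_roots', IsRoot.def]

def clt (T : Finset ℝ) (v : ℝ) : ℕ := (T.filter (· < v)).card
def cle (T : Finset ℝ) (v : ℝ) : ℕ := (T.filter (· ≤ v)).card

theorem clt_le (T : Finset ℝ) (v : ℝ) : clt T v ≤ T.card := Finset.card_filter_le _ _
theorem cle_le (T : Finset ℝ) (v : ℝ) : cle T v ≤ T.card := Finset.card_filter_le _ _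

theorem clt_eq {T : Finset ℝ} {x y : ℝ} (h : clt T x = clt T y) (r : ℝ) (hr : r ∈ T) :
    r < x ↔ r < y := by
  have key : ∀ x y : ℝ, x ≤ y → clt T x = clt T y → ∀ r ∈ T, (r < x ↔ r < y) := by
    intro x y hxy h r hr
    have hsub : T.filter (· < x) ⊆ T.filter (· < y) := by
      intro r hr
      rw [Finset.mem_filter] at hr ⊢
      exact ⟨hr.1, hr.2.trans_le hxy⟩
    have := Finset.eq_of_subset_of_card_le hsub h.ge
    have h2 : r ∈ T.filter (· < x) ↔ r ∈ T.filter (· < y) := by rw [this]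
    simpa [hr] using h2
  rcases le_total x y with hxy | hxy
  · exact key x y hxy h r hr
  · exact (key y x hxy h.symm r hr).symm

theorem cle_eq {T : Finset ℝ} {x y : ℝ} (h : cle T x = cle T y) (r : ℝ) (hr : r ∈ T) :
    r ≤ x ↔ r ≤ y := by
  have key : ∀ x y : ℝ, x ≤ y → cle T x = cle T y → ∀ r ∈ T, (r ≤ x ↔ r ≤ y) := by
    intro x y hxy h r hr
    have hsub : T.filter (· ≤ x) ⊆ T.filter (· ≤ y) := by
      intro r hr
      rw [Finset.mem_filter] at hr ⊢
      exact ⟨hr.1, hr.2.trans hxy⟩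
    have := Finset.eq_of_subset_of_card_le hsub h.ge
    have h2 : r ∈ T.filter (· ≤ x) ↔ r ∈ T.filter (· ≤ y) := by rw [this]
    simpa [hr] using h2
  rcases le_total x y with hxy | hxy
  · exact key x y hxy h r hr
  · exact (key y x hxy h.symm r hr).symm

theorem clt_lt_cle {T : Finset ℝ} {v : ℝ} : clt T v ≠ cle T v ↔ v ∈ T := by
  constructor
  · intro h
    by_contra hv
    apply h
    unfold clt cle
    congr 1
    apply Finset.filter_congr
    intro x hx
    constructor
    · exact le_of_lt
    · intro h; exact lt_of_le_of_ne h (fun h => hv (h ▸ hx))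
  · intro hv h
    have hsub : T.filter (· < v) ⊆ T.filter (· ≤ v) := by
      intro r hr
      rw [Finset.mem_filter] at hr ⊢
      exact ⟨hr.1, hr.2.le⟩
    have := Finset.eq_of_subset_of_card_le hsub (by unfold clt cle at h; exact h.ge)
    have h2 : v ∈ T.filter (· ≤ v) := by simp [hv]
    rw [← this] at h2
    simp at h2

/-- sign preserving order iso -/
def SP {I : Type} (φ : ℝ ≃o ℝ) (P Q : I → ℝ[X]) : Prop :=
  ∀ g t, SignType.sign ((P g).eval t) = SignType.sign ((Q g).eval (φ t))

theorem SP.eq_zero {I : Type} {φ : ℝ ≃o ℝ} {P Q : I → ℝ[X]} (h : SP φ P Q) (g : I) :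
    P g = 0 ↔ Q g = 0 := by
  constructor
  · intro h0
    apply Polynomial.funext
    intro t
    obtain ⟨t, rfl⟩ := φ.surjective t
    have := h g t
    rw [h0, eval_zero, sign_zero] at this
    rw [sign_eq_zero_iff.1 this.symm, eval_zero]
  · intro h0
    apply Polynomial.funext
    intro t
    have := h g t
    rw [h0, eval_zero, sign_zero] at this
    rw [sign_eq_zero_iff.1 this, eval_zero]

theorem SP.mem {I : Type} [Fintype I] {φ : ℝ ≃o ℝ} {P Q : I → ℝ[X]} (h : SP φ P Q) (t : ℝ) :
    φ t ∈ rt Q ↔ t ∈ rt P := by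
  rw [mem_rt, mem_rt]
  apply exists_congr
  intro g
  rw [ne_eq, ne_eq, h.eq_zero g, ← sign_eq_zero_iff (a := eval t (P g)),
    ← sign_eq_zero_iff (a := eval (φ t) (Q g)), ← h g t]

theorem SP.rt_eq {I : Type} [Fintype I] {φ : ℝ ≃o ℝ} {P Q : I → ℝ[X]} (h : SP φ P Q) :
    rt Q = (rt P).map φ.toEquiv.toEmbedding := by
  ext t
  obtain ⟨t, rfl⟩ := φ.surjective t
  rw [h.mem]
  simp

theorem SP.clt {I : Type} [Fintype I] {φ : ℝ ≃o ℝ} {P Q : I → ℝ[X]} (h : SP φ P Q)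
    (v w : ℝ) (hw : ∀ r ∈ rt P, r < v ↔ φ r < w) :
    clt (rt Q) w = clt (rt P) v := by
  unfold LST.clt
  rw [h.rt_eq, Finset.filter_map, Finset.card_map]
  congr 1
  apply Finset.filter_congr
  intro x hx
  simp [hw x hx]

theorem SP.cle {I : Type} [Fintype I] {φ : ℝ ≃o ℝ} {P Q : I → ℝ[X]} (h : SP φ P Q)
    (v w : ℝ) (hw : ∀ r ∈ rt P, r ≤ v ↔ φ r ≤ w) :
    cle (rt Q) w = cle (rt P) v := by
  unfold LST.cle
  rw [h.rt_eq, Finset.filter_map, Finset.card_map]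
  congr 1
  apply Finset.filter_congr
  intro x hx
  simp [hw x hx]

theorem SP.unique {I : Type} [Fintype I] {φ ψ : ℝ ≃o ℝ} {P Q : I → ℝ[X]} (h : SP φ P Q)
    (h' : SP ψ P Q) (r : ℝ) (hr : r ∈ rt P) : φ r = ψ r := by
  have h1 := h.clt r (φ r) (by simp)
  have h2 := h'.clt r (ψ r) (by simp)
  have h3 := clt_eq (h1.trans h2.symm)
  have a1 := h3 (φ r) ((h.mem r).2 hr)
  have a2 := h3 (ψ r) ((h'.mem r).2 hr)
  simp at a1 a2
  exact le_antisymm a2 a1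

/-- position of a point with respect to a family -/
def Pos {ι I : Type} [Fintype I] (P : ι → I → ℝ[X]) (v : ℝ) (i i' : ι) : Prop :=
  (v ∈ rt (P i) ∧ i' = i) ∨ ((∀ z, v ∉ rt (P z)) ∧
    (∀ z, ∀ r ∈ rt (P z), r < v → ∃ r' ∈ rt (P i), r ≤ r' ∧ r' < v) ∧
    (∀ z, ∀ r ∈ rt (P z), v < r → ∃ r' ∈ rt (P i'), v < r' ∧ r' ≤ r))

theorem exists_pos {s : ℕ} (hs : 0 < s) {I : Type} [Fintype I] (P : Fin s → I → ℝ[X]) (v : ℝ) :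
    ∃ i i', Pos P v i i' := by
  by_cases h : ∃ i, v ∈ rt (P i)
  · obtain ⟨i, hi⟩ := h
    exact ⟨i, i, Or.inl ⟨hi, rfl⟩⟩
  push Not at h
  have h1 : ∃ i, ∀ z, ∀ r ∈ rt (P z), r < v → ∃ r' ∈ rt (P i), r ≤ r' ∧ r' < v := by
    by_cases hn : (Finset.univ.biUnion (fun z => (rt (P z)).filter (· < v))).Nonempty
    · have hm := Finset.max'_mem _ hn
      simp only [Finset.mem_biUnion, Finset.mem_univ, true_and, Finset.mem_filter] at hm
      obtain ⟨i, hi1, hi2⟩ := hm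
      refine ⟨i, fun z r hr hrv => ⟨_, hi1, ?_, hi2⟩⟩
      apply Finset.le_max'
      simp only [Finset.mem_biUnion, Finset.mem_univ, true_and, Finset.mem_filter]
      exact ⟨z, hr, hrv⟩
    · refine ⟨⟨0, hs⟩, fun z r hr hrv => (hn ⟨r, ?_⟩).elim⟩
      simp only [Finset.mem_biUnion, Finset.mem_univ, true_and, Finset.mem_filter]
      exact ⟨z, hr, hrv⟩
  have h2 : ∃ i, ∀ z, ∀ r ∈ rt (P z), v < r → ∃ r' ∈ rt (P i), v < r' ∧ r' ≤ r := by
    by_cases hn : (Finset.univ.biUnion (fun z => (rt (P z)).filter (v < ·))).Nonempty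
    · have hm := Finset.min'_mem _ hn
      simp only [Finset.mem_biUnion, Finset.mem_univ, true_and, Finset.mem_filter] at hm
      obtain ⟨i, hi1, hi2⟩ := hm
      refine ⟨i, fun z r hr hrv => ⟨_, hi1, hi2, ?_⟩⟩
      apply Finset.min'_le
      simp only [Finset.mem_biUnion, Finset.mem_univ, true_and, Finset.mem_filter]
      exact ⟨z, hr, hrv⟩
    · refine ⟨⟨0, hs⟩, fun z r hr hrv => (hn ⟨r, ?_⟩).elim⟩
      simp only [Finset.mem_biUnion, Finset.mem_univ, true_and, Finset.mem_filter]
      exact ⟨z, hr, hrv⟩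
  obtain ⟨i, hi⟩ := h1
  obtain ⟨i', hi'⟩ := h2
  exact ⟨i, i', Or.inr ⟨h, hi, hi'⟩⟩

/-- Fiber lemma. -/
theorem fiber {ι I : Type} [Fintype I] (P Q : ι → I → ℝ[X]) (v w : ℝ) (i i' : ι)
    (hpos : Pos P v i i')
    (h1 : ∀ z, ∃ φ, SP φ (P i) (Q i) ∧ SP φ (P z) (Q z))
    (h2 : ∀ z, ∃ φ, SP φ (P i') (Q i') ∧ SP φ (P z) (Q z))
    (c1 : clt (rt (P i)) v = clt (rt (Q i)) w) (c2 : cle (rt (P i)) v = cle (rt (Q i)) w)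
    (c1' : clt (rt (P i')) v = clt (rt (Q i')) w) (c2' : cle (rt (P i')) v = cle (rt (Q i')) w) :
    Pos Q w i i' ∧ ∀ z, clt (rt (P z)) v = clt (rt (Q z)) w ∧ cle (rt (P z)) v = cle (rt (Q z)) w ∧
      ∀ g, SignType.sign ((P z g).eval v) = SignType.sign ((Q z g).eval w) := by
  rcases hpos with ⟨hv, rfl⟩ | ⟨hn, hlo, hhi⟩
  · have hw : w ∈ rt (Q i') := by
      rw [← clt_lt_cle, ← c1, ← c2, clt_lt_cle]; exact hv
    refine ⟨Or.inl ⟨hw, rfl⟩, ?_⟩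
    intro z
    obtain ⟨φ, hφ, hφz⟩ := h1 z
    have e : φ v = w := by
      have a := hφ.clt v (φ v) (by simp)
      rw [c1] at a
      have b1 := clt_eq a (φ v) ((hφ.mem v).2 hv)
      have b2 := clt_eq a w hw
      simp at b1 b2
      exact le_antisymm b2 b1
    subst e
    exact ⟨(hφz.clt v (φ v) (by simp)).symm, (hφz.cle v (φ v) (by simp)).symm, fun g => hφz g v⟩
  · -- main case
    have hA : ∀ z φ, SP φ (P i) (Q i) → SP φ (P z) (Q z) → ∀ r ∈ rt (P z), r < v →
        ∃ r' ∈ rt (P i), φ r ≤ φ r' ∧ φ r' < w := by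
      intro z φ hφ _ r hr hrv
      obtain ⟨r', hr', h3, h4⟩ := hlo z r hr hrv
      refine ⟨r', hr', φ.monotone h3, ?_⟩
      have a := hφ.clt v (φ v) (by simp)
      rw [c1] at a
      have := clt_eq a (φ r') ((hφ.mem r').2 hr')
      exact this.1 (φ.strictMono h4)
    have hB : ∀ z φ, SP φ (P i') (Q i') → SP φ (P z) (Q z) → ∀ r ∈ rt (P z), v < r →
        ∃ r' ∈ rt (P i'), w < φ r' ∧ φ r' ≤ φ r := by
      intro z φ hφ _ r hr hrv
      obtain ⟨r', hr', h3, h4⟩ := hhi z r hr hrv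
      refine ⟨r', hr', ?_, φ.monotone h4⟩
      have a := hφ.cle v (φ v) (by simp)
      rw [c2'] at a
      have := cle_eq a (φ r') ((hφ.mem r').2 hr')
      have h5 := φ.strictMono h3
      by_contra h6
      push Not at h6
      exact absurd (this.2 h6) (not_le.2 h5)
    have hA' : ∀ z φ, SP φ (P i) (Q i) → SP φ (P z) (Q z) → ∀ r ∈ rt (P z),
        (r < v → φ r < w) ∧ (v < r → w < φ r) := by
      intro z φ hφ hφz r hr
      constructor
      · intro h
        obtain ⟨r', _, h3, h4⟩ := hA z φ hφ hφz r hr h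
        exact h3.trans_lt h4
      · intro h
        obtain ⟨ψ, hψ, hψz⟩ := h2 z
        rw [hφz.unique hψz r hr]
        obtain ⟨r', _, h3, h4⟩ := hB z ψ hψ hψz r hr h
        exact h3.trans_le h4
    have hC : ∀ z φ, SP φ (P i) (Q i) → SP φ (P z) (Q z) → ∀ r ∈ rt (P z),
        (r < v ↔ φ r < w) ∧ (r ≤ v ↔ φ r ≤ w) ∧ φ r ≠ w := by
      intro z φ hφ hφz r hr
      have := hA' z φ hφ hφz r hr
      rcases lt_trichotomy r v with h | h | h
      · have h3 := this.1 h
        exact ⟨iff_of_true h h3, iff_of_true h.le h3.le, h3.ne⟩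
      · exact absurd (h ▸ hr) (hn z)
      · have h3 := this.2 h
        exact ⟨iff_of_false (not_lt.2 h.le) (not_lt.2 h3.le), iff_of_false (not_le.2 h) (not_le.2 h3), h3.ne'⟩
    refine ⟨Or.inr ⟨?_, ?_, ?_⟩, ?_⟩
    · intro z hz
      obtain ⟨φ, hφ, hφz⟩ := h1 z
      obtain ⟨r, rfl⟩ := φ.surjective w
      rw [hφz.mem] at hz
      exact (hC z φ hφ hφz r hz).2.2 rfl
    · intro z ρ hρ hρw
      obtain ⟨φ, hφ, hφz⟩ := h1 z
      obtain ⟨r, rfl⟩ := φ.surjective ρ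
      rw [hφz.mem] at hρ
      have := (hC z φ hφ hφz r hρ).1.2 hρw
      obtain ⟨r', hr', h3, h4⟩ := hA z φ hφ hφz r hρ this
      exact ⟨φ r', (hφ.mem _).2 hr', h3, h4⟩
    · intro z ρ hρ hρw
      obtain ⟨φ, hφ, hφz⟩ := h2 z
      obtain ⟨ψ, hψ, hψz⟩ := h1 z
      obtain ⟨r, rfl⟩ := φ.surjective ρ
      rw [hφz.mem] at hρ
      have hρw' := hρw
      rw [hφz.unique hψz r hρ] at hρw'
      have h5 : v < r := by
        by_contra h
        push Not at h
        exact absurd ((hC z ψ hψ hψz r hρ).2.1.1 h) (not_le.2 hρw')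
      obtain ⟨r', hr', h3, h4⟩ := hB z φ hφ hφz r hρ h5
      exact ⟨φ r', (hφ.mem _).2 hr', h3, h4⟩
    · intro z
      obtain ⟨φ, hφ, hφz⟩ := h1 z
      refine ⟨(hφz.clt v w (fun r hr => (hC z φ hφ hφz r hr).1)).symm,
        (hφz.cle v w (fun r hr => (hC z φ hφ hφz r hr).2.1)).symm, ?_⟩
      intro g
      rw [hφz g v]
      by_cases h0 : Q z g = 0
      · rw [h0, eval_zero, eval_zero]
      refine sign_const (g := fun t => (Q z g).eval t) (Q z g).continuous ?_
      intro ρ hρ h3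
      obtain ⟨r, rfl⟩ := φ.surjective ρ
      have hr : r ∈ rt (P z) := by
        rw [← hφz.mem, mem_rt]; exact ⟨g, h0, h3⟩
      have h4 := hC z φ hφ hφz r hr
      have h5 : r ≠ v := fun h => hn z (h ▸ hr)
      rw [mem_uIcc] at hρ
      rcases lt_or_gt_of_ne h5 with h6 | h6
      · have a1 := φ.strictMono h6
        have a2 := h4.1.1 h6
        rcases hρ with h | h <;> linarith
      · have a1 := φ.strictMono h6
        have a2 : w < φ r := by
          by_contra h
          push Not at h
          exact absurd (h4.2.1.2 h) (not_le.2 h6)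
        rcases hρ with h | h <;> linarith

end LST


namespace LST

open Polynomial Set Filter Topology

/-- Existence of a cell decomposition (of size `C s^t`) for sign-type data `sg` on `X`. -/
def HasDec {Ω Y Sg : Type} (X : Set Ω) (sg : Ω → Y → Sg) (P J : Type) (C t : ℕ) : Prop :=
  ∃ cell : (P → Y) → J → Set Ω, ∀ s : ℕ, 0 < s → ∀ S : Fin s → Y,
    ∃ T : Finset ((P → Fin s) × J), T.card ≤ C * s ^ t ∧
      (∀ q ∈ X, ∃ τ ∈ T, q ∈ cell (S ∘ τ.1) τ.2) ∧
      ∀ τ ∈ T, ∀ q ∈ X, q ∈ cell (S ∘ τ.1) τ.2 → ∀ q' ∈ X, q' ∈ cell (S ∘ τ.1) τ.2 →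
        ∀ z, sg q (S z) = sg q' (S z)

open Classical in
/-- change points of `f` along the finite set `U` -/
def Chg {T : Type} (f : ℝ → T) (U : Finset ℝ) : Finset ℝ :=
  U.filter (fun u => ∃ u' ∈ U, u' < u ∧ (∀ x ∈ U, ¬ (u' < x ∧ x < u)) ∧ f u' ≠ f u)

theorem const_of_chg {T : Type} (f : ℝ → T) (U : Finset ℝ) (a b : ℝ) (ha : a ∈ U) (hb : b ∈ U)
    (hab : a ≤ b) (h : ∀ x ∈ Chg f U, x ≤ b → x ≤ a) : f a = f b := by
  classical
  by_contra hne
  have hn : (U.filter (fun x => a ≤ x ∧ x ≤ b ∧ f a ≠ f x)).Nonempty := ⟨b, by simp [hb, hab, hne]⟩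
  set m := Finset.min' _ hn with hm
  have hmm := Finset.min'_mem _ hn
  rw [← hm, Finset.mem_filter] at hmm
  obtain ⟨hmU, ham, hmb, hfm⟩ := hmm
  have ham' : a < m := lt_of_le_of_ne ham (fun h => hfm (by rw [← h]))
  have hn2 : (U.filter (· < m)).Nonempty := ⟨a, by simp [ha, ham']⟩
  set p := Finset.max' _ hn2 with hp
  have hpm := Finset.max'_mem _ hn2
  rw [← hp, Finset.mem_filter] at hpm
  have hap : a ≤ p := Finset.le_max' _ _ (by simp [ha, ham'])
  have hfp : f a = f p := by
    by_contra hc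
    have : m ≤ p := Finset.min'_le _ _ (by simp [hpm.1, hap, hc]; linarith [hpm.2])
    linarith [hpm.2]
  have hch : m ∈ Chg f U := by
    unfold Chg
    rw [Finset.mem_filter]
    refine ⟨hmU, p, hpm.1, hpm.2, ?_, ?_⟩
    · rintro x hx ⟨h1, h2⟩
      have : x ≤ p := Finset.le_max' _ _ (by simp [hx, h2])
      linarith
    · rw [← hfp]; exact hfm
  have := h m hch hmb
  linarith

theorem one_fiber {ι I : Type} [Fintype I] (P : ι → I → ℝ[X]) (v w : ℝ) (i1 i1' i2 i2' i0 : ι)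
    (h1 : Pos P v i1 i1') (h2 : Pos P w i2 i2')
    (hi : (i0 = i1 ∧ i0 = i2) ∨ (i0 = i1' ∧ i0 = i2'))
    (c1 : clt (rt (P i0)) v = clt (rt (P i0)) w) (c2 : cle (rt (P i0)) v = cle (rt (P i0)) w) (z : ι) :
    clt (rt (P z)) v = clt (rt (P z)) w ∧ cle (rt (P z)) v = cle (rt (P z)) w := by
  rcases lt_trichotomy v w with h | h | h
  rotate_left
  · rw [h]; simp
  · have := one_fiber_lt P w v i2 i2' i1 i1' i0 h2 h1 (by tauto) c1.symm c2.symm h z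
    exact ⟨this.1.symm, this.2.symm⟩
  · exact one_fiber_lt P v w i1 i1' i2 i2' i0 h1 h2 hi c1 c2 h z
where
  one_fiber_lt {ι I : Type} [Fintype I] (P : ι → I → ℝ[X]) (v w : ℝ) (i1 i1' i2 i2' i0 : ι)
    (h1 : Pos P v i1 i1') (h2 : Pos P w i2 i2')
    (hi : (i0 = i1 ∧ i0 = i2) ∨ (i0 = i1' ∧ i0 = i2'))
    (c1 : clt (rt (P i0)) v = clt (rt (P i0)) w) (c2 : cle (rt (P i0)) v = cle (rt (P i0)) w)
    (hvw : v < w) (z : ι) :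
    clt (rt (P z)) v = clt (rt (P z)) w ∧ cle (rt (P z)) v = cle (rt (P z)) w := by
    have hiff : v ∈ rt (P i0) ↔ w ∈ rt (P i0) := by
      rw [← clt_lt_cle, ← clt_lt_cle, c1, c2]
    have hvn : v ∉ rt (P i0) := by
      intro hv
      exact absurd ((clt_eq c1 v hv).2 hvw) (lt_irrefl _)
    have hwn : w ∉ rt (P i0) := fun h => hvn (hiff.2 h)
    rcases h1 with ⟨hv, rfl⟩ | ⟨hv1, hv2, hv3⟩
    · exfalso
      rcases hi with hi | hi <;> exact hvn (hi.1 ▸ hv)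
    rcases h2 with ⟨hw, rfl⟩ | ⟨hw1, hw2, hw3⟩
    · exfalso
      rcases hi with hi | hi <;> exact hwn (hi.2 ▸ hw)
    have hno : ∀ r ∈ rt (P z), ¬ (v < r ∧ r < w) := by
      rintro r hr ⟨h3, h4⟩
      rcases hi with ⟨-, rfl⟩ | ⟨rfl, -⟩
      · obtain ⟨r', hr', h5, h6⟩ := hw2 z r hr h4
        have := (clt_eq c1 r' hr').2 h6
        linarith
      · obtain ⟨r', hr', h5, h6⟩ := hv3 z r hr h3
        have := (clt_eq c1 r' hr').2 (h6.trans_lt h4)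
        linarith
    have key : ∀ r ∈ rt (P z), (r < v ↔ r < w) ∧ (r ≤ v ↔ r ≤ w) := by
      intro r hr
      have n1 : r ≠ v := fun h => hv1 z (h ▸ hr)
      have n2 : r ≠ w := fun h => hw1 z (h ▸ hr)
      rcases lt_or_gt_of_ne n1 with h | h
      · have := h.trans hvw
        exact ⟨iff_of_true h this, iff_of_true h.le this.le⟩
      · have h5 : w < r := lt_of_le_of_ne (not_lt.1 (fun h6 => hno r hr ⟨h, h6⟩)) n2.symm
        exact ⟨iff_of_false (not_lt.2 h.le) (not_lt.2 h5.le), iff_of_false (not_le.2 h) (not_le.2 h5)⟩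
    constructor
    · unfold clt; congr 1; exact Finset.filter_congr (fun r hr => (key r hr).1)
    · unfold cle; congr 1; exact Finset.filter_congr (fun r hr => (key r hr).2)

/-- Abstract planar decomposition. -/
theorem D2_abs {W I T : Type} [Fintype I] (PP : W → ℝ → I → ℝ[X]) (ty : W → W → ℝ → T) (N B : ℕ)
    (hN : ∀ w u, (rt (PP w u)).card ≤ N) (hB : ∀ w w' U, (Chg (ty w w') U).card ≤ B)
    (hSP : ∀ w w' u0 u1, ty w w' u0 = ty w w' u1 →
      ∃ φ, SP φ (PP w u0) (PP w u1) ∧ SP φ (PP w' u0) (PP w' u1))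
    (X : Finset (ℝ × ℝ)) :
    HasDec (X : Set (ℝ × ℝ)) (fun q w => fun g => SignType.sign ((PP w q.1 g).eval q.2)) (Fin 6)
      (Fin (B + 2) × Fin (B + 2) × Fin (N + 1) × Fin (N + 1) × Fin (N + 1) × Fin (N + 1))
      (2 * (1 + B) * (N + 1) ^ 2) 2 := by
  classical
  set U : Finset ℝ := X.image Prod.fst with hU
  refine ⟨fun w j => {q | j.1.val ≤ cle (Chg (ty (w 2) (w 3)) U) q.1 ∧
    cle (Chg (ty (w 4) (w 5)) U) q.1 < j.2.1.val ∧
    clt (rt (PP (w 0) q.1)) q.2 = j.2.2.1.val ∧ cle (rt (PP (w 0) q.1)) q.2 = j.2.2.2.1.val ∧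
    clt (rt (PP (w 1) q.1)) q.2 = j.2.2.2.2.1.val ∧ cle (rt (PP (w 1) q.1)) q.2 = j.2.2.2.2.2.val}, ?_⟩
  intro s hs S
  choose i i' hpos using fun q : ℝ × ℝ => exists_pos hs (fun z => PP (S z) q.1) q.2
  set CH : Fin s → Finset ℝ := fun a => Finset.univ.biUnion (fun z => Chg (ty (S a) (S z)) U) with hCH
  have hCHU : ∀ a, ∀ x ∈ CH a, x ∈ U := by
    intro a x hx
    simp only [hCH, Finset.mem_biUnion, Chg, Finset.mem_filter] at hx
    obtain ⟨z, -, h, -⟩ := hx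
    exact h
  have hmemCH : ∀ a z x, x ∈ Chg (ty (S a) (S z)) U → x ∈ CH a := by
    intro a z x hx
    simp only [hCH, Finset.mem_biUnion, Finset.mem_univ, true_and]
    exact ⟨z, hx⟩
  set UU : ℝ × ℝ → Finset ℝ := fun q => CH (i q) ∪ CH (i' q) with hUU
  -- low data
  have hlow : ∀ q : ℝ × ℝ, ∃ (b : Bool) (i0 : Fin s) (L : Option ℝ), i0 = cond b (i q) (i' q) ∧
      L ∈ insert none ((CH i0).image some) ∧ (∀ L', L = some L' → L' ≤ q.1 ∧ ∀ x ∈ UU q, x ≤ q.1 → x ≤ L') ∧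
      (L = none → ∀ x ∈ UU q, ¬ x ≤ q.1) := by
    intro q
    by_cases hn : ((UU q).filter (· ≤ q.1)).Nonempty
    · have hm := Finset.max'_mem _ hn
      set L := Finset.max' _ hn with hL
      rw [Finset.mem_filter] at hm
      have hmax : ∀ x ∈ UU q, x ≤ q.1 → x ≤ L := fun x hx hxq =>
        Finset.le_max' _ _ (by simp [hx, hxq])
      have hm1 := hm.1
      rw [hUU, Finset.mem_union] at hm1
      rcases hm1 with h | h
      · refine ⟨true, i q, some L, rfl, by simp [h], ?_, by simp⟩
        intro L' hL'
        cases hL'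
        exact ⟨hm.2, hmax⟩
      · refine ⟨false, i' q, some L, rfl, by simp [h], ?_, by simp⟩
        intro L' hL'
        cases hL'
        exact ⟨hm.2, hmax⟩
    · refine ⟨true, i q, none, rfl, by simp, by simp, ?_⟩
      intro _ x hx hxq
      exact hn ⟨x, by simp [hx, hxq]⟩
  choose b i0 L hi0 hLmem hLs hLn using hlow
  set key : ℝ × ℝ → Bool × (Σ _ : Fin s, Option ℝ) × ℕ × ℕ := fun q =>
    (b q, ⟨i0 q, L q⟩, clt (rt (PP (S (i0 q)) q.1)) q.2, cle (rt (PP (S (i0 q)) q.1)) q.2) with hkey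
  -- transport
  have htrans : ∀ q ∈ X, ∀ u0 ∈ U, u0 ≤ q.1 → (∀ x ∈ UU q, x ≤ q.1 → x ≤ u0) → ∃ v,
      Pos (fun z => PP (S z) u0) v (i q) (i' q) ∧ ∀ z,
        clt (rt (PP (S z) q.1)) q.2 = clt (rt (PP (S z) u0)) v ∧
        cle (rt (PP (S z) q.1)) q.2 = cle (rt (PP (S z) u0)) v := by
    intro q hq u0 hu0 hle hx
    have hqU : q.1 ∈ U := Finset.mem_image_of_mem _ hq
    have t1 : ∀ z, ty (S (i q)) (S z) q.1 = ty (S (i q)) (S z) u0 := fun z =>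
      (const_of_chg _ U u0 q.1 hu0 hqU hle (fun x hx1 => hx x (by
        rw [hUU, Finset.mem_union]; exact Or.inl (hmemCH _ z x hx1)))).symm
    have t2 : ∀ z, ty (S (i' q)) (S z) q.1 = ty (S (i' q)) (S z) u0 := fun z =>
      (const_of_chg _ U u0 q.1 hu0 hqU hle (fun x hx1 => hx x (by
        rw [hUU, Finset.mem_union]; exact Or.inr (hmemCH _ z x hx1)))).symm
    obtain ⟨φ, hφ1, hφ2⟩ := hSP _ _ _ _ (t1 (i' q))
    obtain ⟨hp, hc⟩ := fiber (fun z => PP (S z) q.1) (fun z => PP (S z) u0) q.2 (φ q.2) (i q) (i' q)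
      (hpos q) (fun z => hSP _ _ _ _ (t1 z)) (fun z => hSP _ _ _ _ (t2 z))
      (hφ1.clt _ _ (by simp)).symm (hφ1.cle _ _ (by simp)).symm
      (hφ2.clt _ _ (by simp)).symm (hφ2.cle _ _ (by simp)).symm
    exact ⟨φ q.2, hp, fun z => ⟨(hc z).1, (hc z).2.1⟩⟩
  have hsame : ∀ q1 ∈ X, ∀ q2 ∈ X, key q1 = key q2 → ∀ z,
      clt (rt (PP (S z) q1.1)) q1.2 = clt (rt (PP (S z) q2.1)) q2.2 ∧
      cle (rt (PP (S z) q1.1)) q1.2 = cle (rt (PP (S z) q2.1)) q2.2 := by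
    intro q1 hq1 q2 hq2 hk z
    simp only [hkey, Prod.mk.injEq, Sigma.mk.injEq, heq_eq_eq] at hk
    obtain ⟨hb, ⟨hi, hL⟩, hc1, hc2⟩ := hk
    obtain ⟨u0, hu0, e1, e2, e3, e4⟩ : ∃ u0 ∈ U, u0 ≤ q1.1 ∧ u0 ≤ q2.1 ∧
        (∀ x ∈ UU q1, x ≤ q1.1 → x ≤ u0) ∧ (∀ x ∈ UU q2, x ≤ q2.1 → x ≤ u0) := by
      rcases hL1 : L q1 with _ | L'
      · have hne : U.Nonempty := ⟨q1.1, Finset.mem_image_of_mem _ hq1⟩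
        refine ⟨U.min' hne, Finset.min'_mem _ _, Finset.min'_le _ _ (Finset.mem_image_of_mem _ hq1),
          Finset.min'_le _ _ (Finset.mem_image_of_mem _ hq2), ?_, ?_⟩
        · intro x hx hxq; exact absurd hxq (hLn q1 hL1 x hx)
        · intro x hx hxq; exact absurd hxq (hLn q2 (hL ▸ hL1) x hx)
      · have hm := hLmem q1
        rw [hL1] at hm
        simp only [Finset.mem_insert, reduceCtorEq, Finset.mem_image, Option.some.injEq,
          exists_eq_right, false_or] at hm
        have a1 := hLs q1 L' hL1
        have a2 := hLs q2 L' (hL ▸ hL1)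
        exact ⟨L', hCHU _ _ hm, a1.1, a2.1, a1.2, a2.2⟩
    obtain ⟨v1, p1, c1⟩ := htrans q1 hq1 u0 hu0 e1 e3
    obtain ⟨v2, p2, c2⟩ := htrans q2 hq2 u0 hu0 e2 e4
    have hor : (i0 q1 = i q1 ∧ i0 q1 = i q2) ∨ (i0 q1 = i' q1 ∧ i0 q1 = i' q2) := by
      have a1 := hi0 q1
      have a2 := hi0 q2
      rw [← hb] at a2
      rcases hbq : b q1 <;> rw [hbq] at a1 a2
      · right; exact ⟨a1, hi.trans a2⟩
      · left; exact ⟨a1, hi.trans a2⟩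
    have := one_fiber (fun z => PP (S z) u0) v1 v2 _ _ _ _ (i0 q1) p1 p2 hor
      (by
        rw [← hi] at hc1
        rw [← (c1 (i0 q1)).1, ← (c2 (i0 q1)).1]; exact hc1)
      (by
        rw [← hi] at hc2
        rw [← (c1 (i0 q1)).2, ← (c2 (i0 q1)).2]; exact hc2) z
    rw [(c1 z).1, (c2 z).1, (c1 z).2, (c2 z).2]
    exact this
  -- tuples
  have hB2 : ∀ w w' x, cle (Chg (ty w w') U) x < B + 1 := fun w w' x =>
    Nat.lt_succ_of_le ((cle_le _ _).trans (hB _ _ _))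
  have hN2 : ∀ w u x, cle (rt (PP w u)) x < N + 1 := fun w u x =>
    Nat.lt_succ_of_le ((cle_le _ _).trans (hN _ _))
  have hN1 : ∀ w u x, clt (rt (PP w u)) x < N + 1 := fun w u x =>
    Nat.lt_succ_of_le ((clt_le _ _).trans (hN _ _))
  have htau : ∀ q : ℝ × ℝ, ∃ (z2 z3 z4 z5 : Fin s) (a c : Fin (B + 2)),
      (∀ u, a.val ≤ cle (Chg (ty (S z2) (S z3)) U) u ↔ ∀ x ∈ UU q, x ≤ q.1 → x ≤ u) ∧
      (∀ u, cle (Chg (ty (S z4) (S z5)) U) u < c.val ↔ ∀ x ∈ UU q, q.1 < x → u < x) := by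
    intro q
    have hex : ∀ x ∈ UU q, ∃ z2 z3, x ∈ Chg (ty (S z2) (S z3)) U := by
      intro x hx
      simp only [hUU, hCH, Finset.mem_union, Finset.mem_biUnion, Finset.mem_univ, true_and] at hx
      rcases hx with ⟨z, h⟩ | ⟨z, h⟩
      · exact ⟨_, _, h⟩
      · exact ⟨_, _, h⟩
    have hmono : ∀ (F : Finset ℝ) (x : ℝ), x ∈ F → ∀ u, cle F x ≤ cle F u ↔ x ≤ u := by
      intro F x hx u
      constructor
      · intro h
        by_contra hu
        push Not at hu
        have hsub : F.filter (· ≤ u) ⊆ F.filter (· ≤ x) := by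
          intro r hr
          rw [Finset.mem_filter] at hr ⊢
          exact ⟨hr.1, hr.2.trans hu.le⟩
        have := Finset.eq_of_subset_of_card_le hsub h
        have h2 : x ∈ F.filter (· ≤ x) := by simp [hx]
        rw [← this, Finset.mem_filter] at h2
        linarith [h2.2]
      · intro h
        apply Finset.card_le_card
        intro r hr
        rw [Finset.mem_filter] at hr ⊢
        exact ⟨hr.1, hr.2.trans h⟩
    have h1 : ∃ (z2 z3 : Fin s) (a : Fin (B + 2)),
        ∀ u, a.val ≤ cle (Chg (ty (S z2) (S z3)) U) u ↔ ∀ x ∈ UU q, x ≤ q.1 → x ≤ u := by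
      by_cases hn : ((UU q).filter (· ≤ q.1)).Nonempty
      · have hm := Finset.max'_mem _ hn
        have hmax := Finset.le_max' ((UU q).filter (· ≤ q.1))
        set L := Finset.max' _ hn with hL
        rw [Finset.mem_filter] at hm
        obtain ⟨z2, z3, hz⟩ := hex L hm.1
        refine ⟨z2, z3, ⟨cle (Chg (ty (S z2) (S z3)) U) L, by have := hB2 (S z2) (S z3) L; omega⟩, ?_⟩
        intro u
        rw [hmono _ L hz]
        constructor
        · intro h x hx hxq
          exact (hmax x (by simp [hx, hxq])).trans h
        · intro h; exact h L hm.1 hm.2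
      · refine ⟨⟨0, hs⟩, ⟨0, hs⟩, ⟨0, by omega⟩, ?_⟩
        intro u
        simp only [Nat.zero_le, true_iff]
        intro x hx hxq
        exact absurd ⟨x, by simp [hx, hxq]⟩ hn
    have h2 : ∃ (z2 z3 : Fin s) (a : Fin (B + 2)),
        ∀ u, cle (Chg (ty (S z2) (S z3)) U) u < a.val ↔ ∀ x ∈ UU q, q.1 < x → u < x := by
      by_cases hn : ((UU q).filter (q.1 < ·)).Nonempty
      · have hm := Finset.min'_mem _ hn
        have hmin := Finset.min'_le ((UU q).filter (q.1 < ·))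
        set L := Finset.min' _ hn with hL
        rw [Finset.mem_filter] at hm
        obtain ⟨z2, z3, hz⟩ := hex L hm.1
        refine ⟨z2, z3, ⟨cle (Chg (ty (S z2) (S z3)) U) L, by have := hB2 (S z2) (S z3) L; omega⟩, ?_⟩
        intro u
        rw [← not_le, hmono _ L hz, not_le]
        constructor
        · intro h x hx hxq
          exact h.trans_le (hmin x (by simp [hx, hxq]))
        · intro h; exact h L hm.1 hm.2
      · refine ⟨⟨0, hs⟩, ⟨0, hs⟩, ⟨B + 1, by omega⟩, ?_⟩
        intro u
        simp only [hB2, true_iff]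
        intro x hx hxq
        exact absurd ⟨x, by simp [hx, hxq]⟩ hn
    obtain ⟨z2, z3, a, ha⟩ := h1
    obtain ⟨z4, z5, c, hc⟩ := h2
    exact ⟨z2, z3, z4, z5, a, c, ha, hc⟩
  choose z2 z3 z4 z5 ja jc hja hjc using htau
  set tau : ℝ × ℝ → ((Fin 6 → Fin s) × (Fin (B + 2) × Fin (B + 2) × Fin (N + 1) × Fin (N + 1) × Fin (N + 1) × Fin (N + 1))) :=
    fun q => (![i q, i' q, z2 q, z3 q, z4 q, z5 q], ja q, jc q,
      ⟨_, hN1 (S (i q)) q.1 q.2⟩, ⟨_, hN2 (S (i q)) q.1 q.2⟩,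
      ⟨_, hN1 (S (i' q)) q.1 q.2⟩, ⟨_, hN2 (S (i' q)) q.1 q.2⟩) with htaudef
  -- representative
  have hrep : ∀ κ, ∃ q : ℝ × ℝ, (∃ q' ∈ X, key q' = κ) → (q ∈ X ∧ key q = κ ∧ ∀ q' ∈ X, key q' = κ → q'.1 ≤ q.1) := by
    intro κ
    by_cases h : ∃ q' ∈ X, key q' = κ
    · obtain ⟨q', hq', hk⟩ := h
      obtain ⟨q, hq, hmax⟩ := Finset.exists_max_image (X.filter (fun q => key q = κ)) Prod.fst
        ⟨q', by simp [hq', hk]⟩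
      rw [Finset.mem_filter] at hq
      exact ⟨q, fun _ => ⟨hq.1, hq.2, fun q' h1 h2 => hmax q' (by simp [h1, h2])⟩⟩
    · exact ⟨(0, 0), fun h' => absurd h' h⟩
  choose rep hrep using hrep
  refine ⟨(X.image key).image (fun κ => tau (rep κ)), ?_, ?_, ?_⟩
  · refine Finset.card_image_le.trans ?_
    set K : Finset (Bool × (Σ _ : Fin s, Option ℝ) × ℕ × ℕ) :=
      Finset.univ ×ˢ ((Finset.univ.sigma (fun a => insert none ((CH a).image some))) ×ˢ
        (Finset.range (N + 1) ×ˢ Finset.range (N + 1))) with hK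
    have hsub : X.image key ⊆ K := by
      intro κ hκ
      rw [Finset.mem_image] at hκ
      obtain ⟨q, hq, rfl⟩ := hκ
      simp only [hK, hkey, Finset.mem_product, Finset.mem_univ, true_and, Finset.mem_sigma,
        Finset.mem_range]
      exact ⟨hLmem q, hN1 _ _ _, hN2 _ _ _⟩
    refine (Finset.card_le_card hsub).trans ?_
    rw [hK, Finset.card_product, Finset.card_product, Finset.card_product, Finset.card_sigma,
      Finset.card_range, Finset.card_univ, Fintype.card_bool]
    have h1 : ∀ a, (insert none ((CH a).image some) : Finset (Option ℝ)).card ≤ s * B + 1 := by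
      intro a
      refine (Finset.card_insert_le _ _).trans ?_
      gcongr
      refine Finset.card_image_le.trans ?_
      rw [hCH]
      refine Finset.card_biUnion_le.trans ?_
      refine (Finset.sum_le_card_nsmul _ _ B (fun z _ => hB _ _ _)).trans ?_
      simp
    have h2 := Finset.sum_le_card_nsmul Finset.univ
      (fun a => (insert none ((CH a).image some) : Finset (Option ℝ)).card) (s * B + 1) (fun a _ => h1 a)
    rw [Finset.card_univ, Fintype.card_fin, smul_eq_mul] at h2
    have h3 : s * (s * B + 1) ≤ (1 + B) * s ^ 2 := by nlinarith
    calc _ ≤ 2 * (((1 + B) * s ^ 2) * ((N + 1) * (N + 1))) := by gcongr; exact h2.trans h3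
      _ = _ := by ring
  · intro q hq
    have hq' : q ∈ X := hq
    obtain ⟨hr1, hr2, hr3⟩ := hrep (key q) ⟨q, hq', rfl⟩
    refine ⟨_, Finset.mem_image_of_mem _ (Finset.mem_image_of_mem _ hq'), ?_⟩
    set r := rep (key q) with hr
    have hle := hr3 q hq' rfl
    have hs1 := hsame q hq' r hr1 hr2.symm
    refine ⟨?_, ?_, (hs1 (i r)).1, (hs1 (i r)).2, (hs1 (i' r)).1, (hs1 (i' r)).2⟩
    · refine (hja r q.1).2 ?_
      intro x hx hxr
      have hLq : L r = L q := by
        simp only [hkey, Prod.mk.injEq, Sigma.mk.injEq, heq_eq_eq] at hr2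
        exact hr2.2.1.2
      rcases hL1 : L r with _ | L'
      · exact absurd hxr (hLn r hL1 x hx)
      · exact ((hLs r L' hL1).2 x hx hxr).trans (hLs q L' (hLq ▸ hL1)).1
    · refine (hjc r q.1).2 ?_
      intro x hx hxr
      linarith
  · intro τ hτ
    simp only [Finset.mem_image] at hτ
    obtain ⟨_, ⟨q, hq, rfl⟩, rfl⟩ := hτ
    obtain ⟨hr1, hr2, hr3⟩ := hrep (key q) ⟨q, hq, rfl⟩
    set r := rep (key q) with hr
    have main : ∀ q1 ∈ (X : Set (ℝ × ℝ)), (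
      (ja r).val ≤ cle (Chg (ty (S (z2 r)) (S (z3 r))) U) q1.1 ∧
      cle (Chg (ty (S (z4 r)) (S (z5 r))) U) q1.1 < (jc r).val ∧
      clt (rt (PP (S (i r)) q1.1)) q1.2 = clt (rt (PP (S (i r)) r.1)) r.2 ∧
      cle (rt (PP (S (i r)) q1.1)) q1.2 = cle (rt (PP (S (i r)) r.1)) r.2 ∧
      clt (rt (PP (S (i' r)) q1.1)) q1.2 = clt (rt (PP (S (i' r)) r.1)) r.2 ∧
      cle (rt (PP (S (i' r)) q1.1)) q1.2 = cle (rt (PP (S (i' r)) r.1)) r.2) →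
      ∀ z, (fun g => SignType.sign ((PP (S z) r.1 g).eval r.2)) =
        (fun g => SignType.sign ((PP (S z) q1.1 g).eval q1.2)) := by
      intro q1 hq1 ⟨d1, d2, d3, d4, d5, d6⟩ z
      have hq1U : q1.1 ∈ U := Finset.mem_image_of_mem _ hq1
      have hrU : r.1 ∈ U := Finset.mem_image_of_mem _ hr1
      have d1' := (hja r q1.1).1 d1
      have d2' := (hjc r q1.1).1 d2
      have tt : ∀ a, (∀ x ∈ CH a, x ∈ UU r) → ∀ z, ty (S a) (S z) r.1 = ty (S a) (S z) q1.1 := by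
        intro a ha z
        rcases le_total r.1 q1.1 with h | h
        · refine const_of_chg _ U _ _ hrU hq1U h ?_
          intro x hx hxq
          by_contra hc
          push Not at hc
          have := d2' x (ha x (hmemCH a z x hx)) hc
          linarith
        · refine (const_of_chg _ U _ _ hq1U hrU h ?_).symm
          intro x hx hxq
          exact d1' x (ha x (hmemCH a z x hx)) hxq
      have t1 := tt (i r) (fun x hx => by rw [hUU, Finset.mem_union]; exact Or.inl hx)
      have t2 := tt (i' r) (fun x hx => by rw [hUU, Finset.mem_union]; exact Or.inr hx)
      obtain ⟨-, hc⟩ := fiber (fun z => PP (S z) r.1) (fun z => PP (S z) q1.1) r.2 q1.2 (i r) (i' r)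
        (hpos r) (fun z => hSP _ _ _ _ (t1 z)) (fun z => hSP _ _ _ _ (t2 z))
        d3.symm d4.symm d5.symm d6.symm
      funext g
      exact (hc z).2.2 g
    intro q1 hq1 h1 q2 hq2 h2 z
    exact (main q1 hq1 h1 z).symm.trans (main q2 hq2 h2 z)

end LST

namespace LST
open Polynomial Set Filter Topology

theorem rt_card {I : Type} [Fintype I] (P : I → ℝ[X]) (d : I → ℕ) (h : ∀ g, (P g).natDegree ≤ d g) :
    (rt P).card ≤ ∑ g, d g := by
  unfold rt
  refine Finset.card_biUnion_le.trans (Finset.sum_le_sum fun g _ => ?_)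
  exact (Multiset.toFinset_card_le _).trans ((card_roots' _).trans (h g))

theorem chg_card {I : Type} [Fintype I] (P : I → ℝ[X]) (U : Finset ℝ) :
    (Chg (fun u => fun g => SignType.sign ((P g).eval u)) U).card ≤ 2 * (rt P).card := by
  classical
  set f : ℝ → I → SignType := fun u => fun g => SignType.sign ((P g).eval u) with hf
  have key : ∀ u ∈ Chg f U, ∃ ρ ∈ rt P, ρ ≤ u ∧ ∀ x ∈ U, ρ < x → u ≤ x := by
    intro u hu
    simp only [Chg, Finset.mem_filter] at hu
    obtain ⟨-, u', hu', hlt, hno, hne⟩ := hu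
    have : ∃ g, SignType.sign ((P g).eval u') ≠ SignType.sign ((P g).eval u) := by
      by_contra hc
      push Not at hc
      exact hne (funext hc)
    obtain ⟨g, hg⟩ := this
    have : ∃ z ∈ uIcc u' u, (P g).eval z = 0 := by
      by_contra hc
      push Not at hc
      exact hg (sign_const (P g).continuous hc)
    obtain ⟨z, hz, hz0⟩ := this
    rw [uIcc_of_le hlt.le] at hz
    refine ⟨z, mem_rt.2 ⟨g, ?_, hz0⟩, hz.2, ?_⟩
    · intro h0; rw [h0] at hg; simp at hg
    · intro x hx hzx
      by_contra hc
      push Not at hc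
      exact hno x hx ⟨hz.1.trans_lt hzx, hc⟩
  choose! ρ hρ using key
  calc (Chg f U).card ≤ (rt P ×ˢ (Finset.univ : Finset Bool)).card := by
        apply Finset.card_le_card_of_injOn (fun u => (ρ u, decide (ρ u = u)))
        · intro u hu
          simp [(hρ u hu).1, em]
        · intro u hu v hv huv
          simp only [Prod.mk.injEq, decide_eq_decide] at huv
          obtain ⟨h1, h2⟩ := huv
          obtain ⟨-, a2, a3⟩ := hρ u hu
          obtain ⟨-, b2, b3⟩ := hρ v hv
          have hu' : u ∈ U := by
            simp only [Chg, Finset.mem_filter, Finset.mem_coe] at hu; exact hu.1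
          have hv' : v ∈ U := by
            simp only [Chg, Finset.mem_filter, Finset.mem_coe] at hv; exact hv.1
          by_cases h : ρ u = u
          · rw [← h, h1, h2.1 h]
          · have h' : ρ v ≠ v := fun h' => h (h2.2 h')
            have c1 := a3 v hv' (h1 ▸ lt_of_le_of_ne b2 h')
            have c2 := b3 u hu' (h1 ▸ lt_of_le_of_ne a2 h)
            exact le_antisymm c1 c2
    _ = 2 * (rt P).card := by simp [mul_comm]

/-! towers of polynomial rings over functions -/
abbrev A1 (W : Type) := (W → ℝ)[X]
abbrev A2 (W : Type) := (A1 W)[X]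
abbrev A3 (W : Type) := (A2 W)[X]
abbrev A4 (W : Type) := (A3 W)[X]

def e0 {W : Type} (w : W) : (W → ℝ) →+* ℝ := Pi.evalRingHom _ w
def e1 {W : Type} (w : W) (u : ℝ) : A1 W →+* ℝ := eval₂RingHom (e0 w) u
def e2 {W : Type} (w : W) (q : ℝ × ℝ) : A2 W →+* ℝ := eval₂RingHom (e1 w q.1) q.2
def e3 {W : Type} (w : W) (q : (ℝ × ℝ) × ℝ) : A3 W →+* ℝ := eval₂RingHom (e2 w q.1) q.2
def e4 {W : Type} (w : W) (q : ((ℝ × ℝ) × ℝ) × ℝ) : A4 W →+* ℝ := eval₂RingHom (e3 w q.1) q.2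

def pl0 {W V : Type} (π : V → W) : (W → ℝ) →+* (V → ℝ) := RingHom.pi (fun v => e0 (π v))
def pl1 {W V : Type} (π : V → W) : A1 W →+* A1 V := mapRingHom (pl0 π)
def pl2 {W V : Type} (π : V → W) : A2 W →+* A2 V := mapRingHom (pl1 π)

theorem e0_pl {W V : Type} (π : V → W) (v : V) : (e0 v).comp (pl0 π) = e0 (π v) := by
  ext g; rfl
theorem eval₂_mapRH {R R' : Type} [CommRing R] [CommRing R'] (p : R →+* R') (a : R' →+* ℝ)
    (b : R →+* ℝ) (h : a.comp p = b) (t : ℝ) :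
    (eval₂RingHom a t).comp (mapRingHom p) = eval₂RingHom b t := by
  apply RingHom.ext
  intro g
  simp only [RingHom.comp_apply, coe_mapRingHom, coe_eval₂RingHom, eval₂_map, h]
theorem e1_pl {W V : Type} (π : V → W) (v : V) (u : ℝ) : (e1 v u).comp (pl1 π) = e1 (π v) u :=
  eval₂_mapRH _ _ _ (e0_pl π v) u
theorem e2_pl {W V : Type} (π : V → W) (v : V) (u : ℝ × ℝ) : (e2 v u).comp (pl2 π) = e2 (π v) u :=
  eval₂_mapRH _ _ _ (e1_pl π v _) _
/-- `OI` for two pulled-back copies -/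
theorem OI2 {R R' : Type} [CommRing R] [CommRing R'] (p1 p2 : R →+* R') (G : Finset R[X]) :
    ∃ H : Finset R', ∀ α β : R' →+* ℝ,
      (∀ h ∈ H, SignType.sign (α h) = SignType.sign (β h)) →
      ∃ φ : ℝ ≃o ℝ, SP φ (fun g : G => g.1.map (α.comp p1)) (fun g : G => g.1.map (β.comp p1)) ∧
        SP φ (fun g : G => g.1.map (α.comp p2)) (fun g : G => g.1.map (β.comp p2)) := by
  classical
  obtain ⟨H, hH, h⟩ := OI (G.val.map (fun g => g.map p1) + G.val.map (fun g => g.map p2))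
  refine ⟨hH.toFinset, fun α β hab => ?_⟩
  obtain ⟨φ, hφ⟩ := h α β (by simpa using hab)
  refine ⟨φ, fun g t => ?_, fun g t => ?_⟩
  · have := hφ (g.1.map p1) (by
      rw [Multiset.mem_add]; left; exact Multiset.mem_map_of_mem _ g.2) t
    simpa only [eval_map, eval₂_map] using this
  · have := hφ (g.1.map p2) (by
      rw [Multiset.mem_add]; right; exact Multiset.mem_map_of_mem _ g.2) t
    simpa only [eval_map, eval₂_map] using this

def sgn2 {W : Type} (G : Finset (A2 W)) (q : ℝ × ℝ) (w : W) : G → SignType :=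
  fun g => SignType.sign (e2 w q g.1)
def sgn3 {W : Type} (G : Finset (A3 W)) (q : (ℝ × ℝ) × ℝ) (w : W) : G → SignType :=
  fun g => SignType.sign (e3 w q g.1)

theorem ex_wrap {Ω Y Sg P J : Type} {sg : Ω → Y → Sg} [iP : Fintype P] [iJ : Fintype J] {C t : ℕ}
    (h : ∀ X : Finset Ω, HasDec (X : Set Ω) sg P J C t) :
    ∃ (P J : Type) (_ : Fintype P) (_ : Fintype J) (C : ℕ),
      ∀ X : Finset Ω, HasDec (X : Set Ω) sg P J C t := ⟨P, J, iP, iJ, C, h⟩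

theorem D2 {W : Type} (G : Finset (A2 W)) : ∃ (P J : Type) (_ : Fintype P) (_ : Fintype J) (C : ℕ),
    ∀ X : Finset (ℝ × ℝ), HasDec (X : Set (ℝ × ℝ)) (sgn2 G) P J C 2 := by
  classical
  obtain ⟨H, hH⟩ := OI2 (pl1 (Prod.fst : W × W → W)) (pl1 Prod.snd) G
  set PP : W → ℝ → G → ℝ[X] := fun w u g => g.1.map (e1 w u) with hPP
  set ty : W → W → ℝ → H → SignType := fun w w' u h =>
    SignType.sign (((h.1 : A1 (W × W)).map (e0 (w, w'))).eval u) with hty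
  have := D2_abs PP ty (∑ g : G, g.1.natDegree) (2 * ∑ h : H, h.1.natDegree)
    (fun w u => rt_card _ _ (fun g => natDegree_map_le))
    (fun w w' U => (chg_card (fun h : H => h.1.map (e0 (w, w'))) U).trans
      (Nat.mul_le_mul_left _ (rt_card _ _ (fun g => natDegree_map_le))))
    (fun w w' u0 u1 h => by
      obtain ⟨φ, h1, h2⟩ := hH (e1 (w, w') u0) (e1 (w, w') u1) (fun g hg => by
        have := congrFun h ⟨g, hg⟩
        simp only [hty, eval_map] at this; exact this)
      refine ⟨φ, ?_, ?_⟩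
      · simpa only [e1_pl] using h1
      · simpa only [e1_pl] using h2)
  simp only [hPP, eval_map] at this
  exact ex_wrap this

end LST

namespace LST
open Polynomial Set Filter Topology

theorem D3 {W : Type} (G : Finset (A3 W)) : ∃ (P J : Type) (_ : Fintype P) (_ : Fintype J) (C : ℕ),
    ∀ X : Finset ((ℝ × ℝ) × ℝ), HasDec (X : Set ((ℝ × ℝ) × ℝ)) (sgn3 G) P J C 4 := by
  classical
  obtain ⟨H, hH⟩ := OI2 (R := A2 W) (R' := A2 (W × W)) (pl2 Prod.fst) (pl2 Prod.snd) G
  set π1 : (W × W) × W → W × W := fun w => (w.1.1, w.2) with hπ1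
  set π2 : (W × W) × W → W × W := fun w => (w.1.2, w.2) with hπ2
  obtain ⟨P, J, _, _, C, hD⟩ := D2 (H.image (pl2 π1) ∪ H.image (pl2 π2))
  set PP : W → ℝ × ℝ → G → ℝ[X] := fun w u g => g.1.map (e2 w u) with hPP
  set N := ∑ g : G, g.1.natDegree with hN
  have hrt : ∀ w u, (rt (PP w u)).card ≤ N := fun w u => rt_card _ _ (fun g => natDegree_map_le)
  apply ex_wrap (P := Bool ⊕ P) (J := J × Fin (N + 1) × Fin (N + 1) × Fin (N + 1) × Fin (N + 1))
    (C := C * (N + 1) ^ 4)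
  intro X
  obtain ⟨cell2, hc2⟩ := hD (X.image Prod.fst)
  refine ⟨fun w j => {q | q.1 ∈ cell2 (fun p => ((w (Sum.inl true), w (Sum.inl false)), w (Sum.inr p))) j.1 ∧
    clt (rt (PP (w (Sum.inl true)) q.1)) q.2 = j.2.1.val ∧
    cle (rt (PP (w (Sum.inl true)) q.1)) q.2 = j.2.2.1.val ∧
    clt (rt (PP (w (Sum.inl false)) q.1)) q.2 = j.2.2.2.1.val ∧
    cle (rt (PP (w (Sum.inl false)) q.1)) q.2 = j.2.2.2.2.val}, ?_⟩
  intro s hs S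
  choose T2 hT2c hT2cov hT2un using fun i i' : Fin s => hc2 s hs (fun z => ((S i, S i'), S z))
  set mk : (Fin s × Fin s) → ((P → Fin s) × J) × (Fin (N + 1) × Fin (N + 1) × Fin (N + 1) × Fin (N + 1)) →
    ((Bool ⊕ P) → Fin s) × (J × Fin (N + 1) × Fin (N + 1) × Fin (N + 1) × Fin (N + 1)) :=
    fun ii x => (Sum.elim (fun b => if b then ii.1 else ii.2) x.1.1, (x.1.2, x.2)) with hmk
  set T0 := (Finset.univ : Finset (Fin s × Fin s)).biUnion (fun ii =>
    ((T2 ii.1 ii.2) ×ˢ Finset.univ).image (mk ii)) with hT0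
  generalize hcell : (fun (w : Bool ⊕ P → W) (j : J × Fin (N + 1) × Fin (N + 1) × Fin (N + 1) × Fin (N + 1)) => {q : (ℝ × ℝ) × ℝ | q.1 ∈ cell2 (fun p => ((w (Sum.inl true), w (Sum.inl false)), w (Sum.inr p))) j.1 ∧
    clt (rt (PP (w (Sum.inl true)) q.1)) q.2 = j.2.1.val ∧
    cle (rt (PP (w (Sum.inl true)) q.1)) q.2 = j.2.2.1.val ∧
    clt (rt (PP (w (Sum.inl false)) q.1)) q.2 = j.2.2.2.1.val ∧
    cle (rt (PP (w (Sum.inl false)) q.1)) q.2 = j.2.2.2.2.val}) = cell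
  refine ⟨T0.filter (fun τ => ∀ q ∈ (X : Set ((ℝ × ℝ) × ℝ)), q ∈ cell (S ∘ τ.1) τ.2 →
    ∀ q' ∈ (X : Set ((ℝ × ℝ) × ℝ)), q' ∈ cell (S ∘ τ.1) τ.2 →
        ∀ z, sgn3 G q (S z) = sgn3 G q' (S z)), ?_, ?_, ?_⟩
  · refine (Finset.card_filter_le _ _).trans ?_
    refine Finset.card_biUnion_le.trans ?_
    calc _ ≤ ∑ ii : Fin s × Fin s, (C * s ^ 2) * (N + 1) ^ 4 := by
          refine Finset.sum_le_sum fun ii _ => Finset.card_image_le.trans ?_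
          rw [Finset.card_product]
          refine (Nat.mul_le_mul_right _ (hT2c ii.1 ii.2)).trans (le_of_eq ?_)
          simp only [Finset.card_univ, Fintype.card_prod, Fintype.card_fin]; ring
      _ = C * (N + 1) ^ 4 * s ^ 4 := by
          simp only [Finset.sum_const, Finset.card_univ, Fintype.card_prod, Fintype.card_fin, smul_eq_mul]; ring
  · intro q hq
    obtain ⟨i, i', hpos⟩ := exists_pos hs (fun z => PP (S z) q.1) q.2
    obtain ⟨τ, hτ, hqτ⟩ := hT2cov i i' q.1 (by simpa using ⟨q.2, hq⟩)
    set jj : Fin (N + 1) × Fin (N + 1) × Fin (N + 1) × Fin (N + 1) :=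
      (⟨clt (rt (PP (S i) q.1)) q.2, Nat.lt_succ_of_le ((clt_le _ _).trans (hrt _ _))⟩,
       ⟨cle (rt (PP (S i) q.1)) q.2, Nat.lt_succ_of_le ((cle_le _ _).trans (hrt _ _))⟩,
       ⟨clt (rt (PP (S i') q.1)) q.2, Nat.lt_succ_of_le ((clt_le _ _).trans (hrt _ _))⟩,
       ⟨cle (rt (PP (S i') q.1)) q.2, Nat.lt_succ_of_le ((cle_le _ _).trans (hrt _ _))⟩) with hjj
    have hmem : q ∈ cell (S ∘ (mk (i, i') (τ, jj)).1) (mk (i, i') (τ, jj)).2 := by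
      rw [← hcell]
      exact ⟨hqτ, rfl, rfl, rfl, rfl⟩
    refine ⟨mk (i, i') (τ, jj), ?_, hmem⟩
    rw [Finset.mem_filter]
    refine ⟨?_, ?_⟩
    · rw [hT0, Finset.mem_biUnion]
      exact ⟨(i, i'), Finset.mem_univ _, Finset.mem_image_of_mem _ (Finset.mem_product.2 ⟨hτ, Finset.mem_univ _⟩)⟩
    have main : ∀ q' ∈ (X : Set ((ℝ × ℝ) × ℝ)), q' ∈ cell (S ∘ (mk (i, i') (τ, jj)).1) (mk (i, i') (τ, jj)).2 →
        ∀ z, sgn3 G q (S z) = sgn3 G q' (S z) := by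
      intro q' hq' hc
      rw [← hcell] at hc
      obtain ⟨d1, d2, d3, d4, d5⟩ := hc
      have hs2 := hT2un i i' τ hτ q.1 (by simpa using ⟨q.2, hq⟩) hqτ q'.1 (by simpa using ⟨q'.2, hq'⟩) d1
      have f1 : ∀ z, ∃ φ, SP φ (PP (S i) q.1) (PP (S i) q'.1) ∧ SP φ (PP (S z) q.1) (PP (S z) q'.1) := by
        intro z
        obtain ⟨φ, h1, h2⟩ := hH (e2 (S i, S z) q.1) (e2 (S i, S z) q'.1) (fun h hh => by
          have := congrFun (hs2 z) ⟨pl2 π1 h, Finset.mem_union_left _ (Finset.mem_image_of_mem _ hh)⟩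
          simp only [sgn2, ← RingHom.comp_apply, e2_pl] at this
          exact this)
        simp only [e2_pl] at h1 h2
        exact ⟨φ, h1, h2⟩
      have f2 : ∀ z, ∃ φ, SP φ (PP (S i') q.1) (PP (S i') q'.1) ∧ SP φ (PP (S z) q.1) (PP (S z) q'.1) := by
        intro z
        obtain ⟨φ, h1, h2⟩ := hH (e2 (S i', S z) q.1) (e2 (S i', S z) q'.1) (fun h hh => by
          have := congrFun (hs2 z) ⟨pl2 π2 h, Finset.mem_union_right _ (Finset.mem_image_of_mem _ hh)⟩
          simp only [sgn2, ← RingHom.comp_apply, e2_pl] at this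
          exact this)
        simp only [e2_pl] at h1 h2
        exact ⟨φ, h1, h2⟩
      obtain ⟨-, hc⟩ := fiber (fun z => PP (S z) q.1) (fun z => PP (S z) q'.1) q.2 q'.2 i i' hpos f1 f2
        d2.symm d3.symm d4.symm d5.symm
      intro z
      funext g
      have := (hc z).2.2 g
      simp only [hPP, eval_map] at this
      exact this
    intro q1 hq1 h1 q2 hq2 h2 z
    exact (main q1 hq1 h1 z).symm.trans (main q2 hq2 h2 z)
  · intro τ hτ
    exact (Finset.mem_filter.1 hτ).2

end LST

namespace LST
open Polynomial Set Filter Topology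

theorem sampling {Y P J : Type} [Fintype Y] [Fintype P] [Fintype J] (cr : (P → Y) → J → Finset Y)
    (s : ℕ) (θ : ℝ) (hθ0 : 0 ≤ θ) (hθ1 : θ ≤ 1) [Nonempty Y]
    (hs : (s : ℝ) ^ (Fintype.card P) * Fintype.card J * (1 - θ) ^ (s - Fintype.card P) < 1) :
    ∃ S : Fin s → Y, ∀ (ι : P → Fin s) (j : J), (∀ z, S z ∉ cr (S ∘ ι) j) →
      ((cr (S ∘ ι) j).card : ℝ) ≤ θ * Fintype.card Y := by
  classical
  set n := Fintype.card Y with hn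
  have hn0 : 0 < (n : ℝ) := by exact_mod_cast Fintype.card_pos
  set Bad : (P → Fin s) → J → Finset (Fin s → Y) := fun ι j => Finset.univ.filter
    (fun S => θ * n < (cr (S ∘ ι) j).card ∧ ∀ z, S z ∉ cr (S ∘ ι) j) with hBad
  have key : ∀ ι j, ((Bad ι j).card : ℝ) ≤ (n : ℝ) ^ s * (1 - θ) ^ (s - Fintype.card P) := by
    intro ι j
    set p : Fin s → Prop := fun z => z ∈ Set.range ι with hp
    set ext : ({z // p z} → Y) → P → Y := fun a x => a ⟨ι x, x, rfl⟩ with hext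
    set B : ({z // p z} → Y) → Finset ({z // ¬ p z} → Y) := fun a =>
      if θ * n < (cr (ext a) j).card then Fintype.piFinset (fun _ => (cr (ext a) j)ᶜ) else ∅ with hB
    have h1 : (Bad ι j).card ≤ ((Finset.univ : Finset ({z // p z} → Y)).sigma B).card := by
      apply Finset.card_le_card_of_injOn (fun S => ⟨fun z => S z.1, fun z => S z.1⟩)
      · intro S hS
        simp only [hBad, Finset.coe_filter, Finset.mem_univ, true_and, Set.mem_ofPred_eq] at hS
        simp only [Finset.coe_sigma, Set.mem_sigma_iff, Finset.coe_univ, Set.mem_univ, true_and, hB]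
        have he : ext (fun z => S z.1) = S ∘ ι := rfl
        rw [he, if_pos hS.1]
        simp only [Finset.mem_coe, Fintype.mem_piFinset, Finset.mem_compl]
        intro z; exact hS.2 z
      · intro S _ S' _ h
        simp only [Sigma.mk.injEq, heq_eq_eq] at h
        funext z
        by_cases hz : p z
        · exact congrFun h.1 ⟨z, hz⟩
        · exact congrFun h.2 ⟨z, hz⟩
    set m := Fintype.card {z // ¬ p z} with hm
    have hcard : Fintype.card {z // p z} + m = s := by
      have := Fintype.card_subtype_compl p
      have h2 := Fintype.card_subtype_le p
      rw [Fintype.card_fin] at this h2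
      omega
    have hple : Fintype.card {z // p z} ≤ Fintype.card P := by
      apply Fintype.card_le_of_surjective (fun x : P => (⟨ι x, x, rfl⟩ : {z // p z}))
      rintro ⟨z, x, rfl⟩
      exact ⟨x, rfl⟩
    have h2 : ∀ a, ((B a).card : ℝ) ≤ ((1 - θ) * n) ^ m := by
      intro a
      simp only [hB]
      split_ifs with h
      · rw [Fintype.card_piFinset]
        simp only [Finset.prod_const, Finset.card_univ, Nat.cast_pow, Finset.card_compl]
        rw [Nat.cast_sub (Finset.card_le_univ _)]
        apply pow_le_pow_left₀
        · rw [sub_nonneg]; exact_mod_cast Finset.card_le_univ _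
        · linarith
      · have : 0 ≤ 1 - θ := by linarith
        simp only [Finset.card_empty, Nat.cast_zero]; positivity
    have hq : 0 ≤ 1 - θ := by linarith
    calc ((Bad ι j).card : ℝ) ≤ (((Finset.univ : Finset ({z // p z} → Y)).sigma B).card : ℕ) := by
          exact_mod_cast h1
      _ = ∑ a, ((B a).card : ℝ) := by rw [Finset.card_sigma]; push_cast; rfl
      _ ≤ ∑ a : ({z // p z} → Y), ((1 - θ) * n) ^ m := Finset.sum_le_sum (fun a _ => h2 a)
      _ = (n : ℝ) ^ s * (1 - θ) ^ m := by
          rw [Finset.sum_const, Finset.card_univ, Fintype.card_fun, nsmul_eq_mul,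
            show (n : ℝ) ^ s = (n : ℝ) ^ (Fintype.card {z // p z}) * (n : ℝ) ^ m by
              rw [← pow_add, hcard], mul_pow]
          push_cast; ring
      _ ≤ _ := by
          apply mul_le_mul_of_nonneg_left _ (by positivity)
          apply pow_le_pow_of_le_one hq (by linarith)
          omega
  by_contra hcon
  push Not at hcon
  have hall : (Finset.univ : Finset (Fin s → Y)) ⊆
      (Finset.univ : Finset ((P → Fin s) × J)).biUnion (fun x => Bad x.1 x.2) := by
    intro S _
    obtain ⟨ι, j, h1, h2⟩ := hcon S
    rw [Finset.mem_biUnion]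
    exact ⟨(ι, j), Finset.mem_univ _, by simp only [hBad, Finset.mem_filter, Finset.mem_univ, true_and]; exact ⟨h2, h1⟩⟩
  have h1 := (Finset.card_le_card hall).trans Finset.card_biUnion_le
  rw [Finset.card_univ, Fintype.card_fun, Fintype.card_fin] at h1
  have h2 : (n : ℝ) ^ s ≤ ∑ x : (P → Fin s) × J, ((Bad x.1 x.2).card : ℝ) := by exact_mod_cast h1
  have h3 := h2.trans (Finset.sum_le_sum (fun x _ => key x.1 x.2))
  rw [Finset.sum_const, Finset.card_univ, Fintype.card_prod, Fintype.card_fun, Fintype.card_fin,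
    nsmul_eq_mul] at h3
  push_cast at h3
  have hns : 0 < (n : ℝ) ^ s := by positivity
  nlinarith

theorem params (p cJ : ℕ) (C ε : ℝ) (hC : 0 < C) (hε : 0 < ε) (hε1 : ε ≤ 1 / 5) :
    ∃ (s : ℕ) (θ : ℝ), 0 < s ∧ 0 < θ ∧ θ < 1 ∧
      (s : ℝ) ^ p * cJ * (1 - θ) ^ (s - p) < 1 ∧
      θ ^ ((4 : ℝ) / 5 + ε) * (C * (s : ℝ) ^ 4) ^ ((1 : ℝ) / 5) ≤ 1 / 4 := by
  set η := ε / 2 with hη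
  have t1 : Tendsto (fun s : ℕ => ((s : ℝ) ^ (p : ℝ) * cJ) * Real.exp (-(1 / 2) * (s : ℝ) ^ η)) atTop (𝓝 0) := by
    have a : Tendsto (fun x : ℝ => x ^ ((p : ℝ) / η) * Real.exp (-(1 / 2) * x)) atTop (𝓝 0) :=
      tendsto_rpow_mul_exp_neg_mul_atTop_nhds_zero _ _ (by norm_num)
    have b : Tendsto (fun s : ℕ => (s : ℝ) ^ η) atTop atTop :=
      (tendsto_rpow_atTop (by positivity)).comp tendsto_natCast_atTop_atTop
    have c := ((a.comp b).const_mul (cJ : ℝ))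
    rw [mul_zero] at c
    refine c.congr (fun s => ?_)
    simp only [Function.comp]
    rw [← Real.rpow_mul (by positivity), mul_div_cancel₀ _ (by positivity)]
    ring
  have t2 : Tendsto (fun s : ℕ => C ^ ((1 : ℝ) / 5) * (s : ℝ) ^ (-(ε / 2))) atTop (𝓝 0) := by
    have := ((tendsto_rpow_neg_atTop (show 0 < ε / 2 by positivity)).comp
      tendsto_natCast_atTop_atTop).const_mul (C ^ ((1 : ℝ) / 5))
    rw [mul_zero] at this
    exact this
  have := ((t1.eventually (gt_mem_nhds (show (0 : ℝ) < 1 by norm_num))).and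
    (t2.eventually (gt_mem_nhds (show (0 : ℝ) < 1 / 4 by norm_num)))).and
    ((eventually_ge_atTop (2 * p)).and (eventually_gt_atTop 1))
  obtain ⟨s, ⟨h1, h2⟩, h3, h4⟩ := this.exists
  have hs0 : (0 : ℝ) < s := by exact_mod_cast (by omega : 0 < s)
  have hs1 : (1 : ℝ) < s := by exact_mod_cast h4
  have hθ1 : (s : ℝ) ^ (-1 + η) < 1 := by
    apply Real.rpow_lt_one_of_one_lt_of_neg hs1
    rw [hη]; linarith
  refine ⟨s, (s : ℝ) ^ (-1 + η), by omega, by positivity, hθ1, ?_, ?_⟩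
  · refine lt_of_le_of_lt ?_ h1
    rw [Real.rpow_natCast]
    apply mul_le_mul_of_nonneg_left _ (by positivity)
    set θ := (s : ℝ) ^ (-1 + η) with hθ
    have e1 : 1 - θ ≤ Real.exp (-θ) := by have := Real.add_one_le_exp (-θ); linarith
    calc (1 - θ) ^ (s - p) ≤ (Real.exp (-θ)) ^ (s - p) := pow_le_pow_left₀ (by linarith) e1 _
      _ = Real.exp (-(((s - p : ℕ) : ℝ) * θ)) := by rw [← Real.exp_nat_mul]; ring_nf
      _ ≤ _ := by
        apply Real.exp_le_exp.2
        have e2 : (s : ℝ) / 2 ≤ ((s - p : ℕ) : ℝ) := by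
          rw [Nat.cast_sub (by omega)]
          have : (2 * p : ℝ) ≤ s := by exact_mod_cast h3
          linarith
        have e3 : (s : ℝ) ^ η = s * θ := by
          rw [hθ, Real.rpow_add hs0, Real.rpow_neg_one]; field_simp
        have e4 : 0 < θ := by positivity
        rw [e3]
        nlinarith
  · refine le_trans ?_ h2.le
    rw [← Real.rpow_mul hs0.le, Real.mul_rpow hC.le (by positivity), ← Real.rpow_natCast,
      ← Real.rpow_mul hs0.le, mul_left_comm, ← Real.rpow_add hs0]
    apply mul_le_mul_of_nonneg_left _ (by positivity)
    apply Real.rpow_le_rpow_of_exponent_le hs1.le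
    rw [hη]; push_cast; nlinarith

end LST

namespace LST
open Polynomial Set Filter Topology

open Classical in
def inc {Ω Y : Type} (E : Ω → Y → Prop) (X : Finset Ω) (L : Finset Y) : ℕ :=
  ∑ x ∈ X, (L.filter (E x)).card

open Classical in
def KF {Ω Y : Type} (E : Ω → Y → Prop) (M : ℕ) (X : Finset Ω) (L : Finset Y) : Prop :=
  ∀ G ⊆ X, G.card = 4 → (L.filter (fun y => ∀ x ∈ G, E x y)).card ≤ M

section
variable {Ω Y : Type} {E : Ω → Y → Prop} {M : ℕ} {X X' : Finset Ω} {L L' : Finset Y}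

theorem KF.mono (h : KF E M X L) (hX : X' ⊆ X) (hL : L' ⊆ L) : KF E M X' L' := by
  classical
  intro G hG hc
  refine le_trans (Finset.card_le_card ?_) (h G (hG.trans hX) hc)
  exact Finset.filter_subset_filter _ hL

theorem inc_le : inc E X L ≤ X.card * L.card := by
  classical
  unfold inc
  refine (Finset.sum_le_card_nsmul _ _ L.card (fun x _ => Finset.card_filter_le _ _)).trans ?_
  simp

theorem inc_swap [DecidableRel E] : inc E X L = ∑ y ∈ L, (X.filter (fun x => E x y)).card := by
  classical
  unfold inc
  simp only [Finset.card_filter]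
  rw [Finset.sum_comm]
  congr!

theorem inc_split (p : Y → Prop) [DecidablePred p] :
    inc E X L = inc E X (L.filter p) + inc E X (L.filter (fun y => ¬ p y)) := by
  classical
  unfold inc
  rw [← Finset.sum_add_distrib]
  refine Finset.sum_congr rfl fun x _ => ?_
  rw [Finset.filter_comm, Finset.filter_comm (fun y => ¬ p y), Finset.card_filter_add_card_filter_not]

theorem inc_splitX (p : Ω → Prop) [DecidablePred p] :
    inc E X L = inc E (X.filter p) L + inc E (X.filter (fun y => ¬ p y)) L :=
  (Finset.sum_filter_add_sum_filter_not _ _ _).symm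

theorem inc_mono (hX : X' ⊆ X) (hL : L' ⊆ L) : inc E X' L' ≤ inc E X L := by
  classical
  unfold inc
  refine (Finset.sum_le_sum (fun x _ => ?_)).trans (Finset.sum_le_sum_of_subset hX)
  exact Finset.card_le_card (Finset.filter_subset_filter _ hL)

theorem inc_fiber {T : Type} [DecidableEq T] (f : Ω → T) (S : Finset T) (h : ∀ x ∈ X, f x ∈ S) :
    inc E X L = ∑ τ ∈ S, inc E (X.filter (fun x => f x = τ)) L := by
  unfold inc
  exact (Finset.sum_fiberwise_of_maps_to h _).symm

theorem choose4 (d : ℕ) : d ≤ 3 + d.choose 4 := by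
  induction d with
  | zero => simp
  | succ d ih =>
    have h5 : (d + 1).choose 4 = d.choose 3 + d.choose 4 := Nat.choose_succ_succ d 3
    rw [h5]
    by_cases h : 3 ≤ d
    · have := Nat.choose_pos h
      omega
    · omega

theorem KST (h : KF E M X L) : inc E X L ≤ 3 * L.card + M * X.card ^ 4 := by
  classical
  rw [inc_swap]
  calc _ ≤ ∑ y ∈ L, (3 + ((X.filter (fun x => E x y)).card).choose 4) :=
        Finset.sum_le_sum fun y _ => choose4 _
    _ = 3 * L.card + ∑ y ∈ L, ∑ G ∈ X.powersetCard 4, if ∀ x ∈ G, E x y then 1 else 0 := by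
        rw [Finset.sum_add_distrib, Finset.sum_const, smul_eq_mul, mul_comm]
        congr 1
        refine Finset.sum_congr rfl fun y _ => ?_
        rw [← Finset.card_powersetCard, ← Finset.card_filter]
        congr 1
        ext G
        simp only [Finset.mem_powersetCard, Finset.mem_filter, Finset.subset_iff]
        grind
    _ = 3 * L.card + ∑ G ∈ X.powersetCard 4, (L.filter (fun y => ∀ x ∈ G, E x y)).card := by
        rw [Finset.sum_comm]
        simp only [Finset.card_filter]
    _ ≤ 3 * L.card + ∑ G ∈ X.powersetCard 4, M := by
        gcongr with G hG
        rw [Finset.mem_powersetCard] at hG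
        convert h G hG.1 hG.2
    _ ≤ _ := by
        rw [Finset.sum_const, Finset.card_powersetCard, smul_eq_mul, mul_comm M]
        gcongr
        exact Nat.choose_le_pow _ _

theorem inc_cell (h : KF E M X L) (hc : ∀ y ∈ L, ∀ x ∈ X, ∀ x' ∈ X, E x y → E x' y)
    (h4 : 4 ≤ X.card) : inc E X L ≤ M * X.card := by
  classical
  obtain ⟨G, hG, hG4⟩ := Finset.exists_subset_card_eq h4
  unfold inc
  refine (Finset.sum_le_card_nsmul _ _ M (fun x hx => ?_)).trans (by simp [mul_comm])
  refine le_trans (Finset.card_le_card ?_) (h G hG hG4)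
  intro y hy
  rw [Finset.mem_filter] at hy ⊢
  exact ⟨hy.1, fun x' hx' => hc y hy.1 x hx x' (hG hx') hy.2⟩
end

theorem sum_rpow_le {T : Type} (S : Finset T) (f : T → ℝ) (hf : ∀ τ ∈ S, 0 ≤ f τ) :
    ∑ τ ∈ S, (f τ) ^ ((4 : ℝ) / 5) ≤ (S.card : ℝ) ^ ((1 : ℝ) / 5) * (∑ τ ∈ S, f τ) ^ ((4 : ℝ) / 5) := by
  have h := Real.inner_le_Lp_mul_Lq_of_nonneg S (p := 5) (q := 5 / 4) (f := fun _ => (1 : ℝ))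
    (g := fun τ => (f τ) ^ ((4 : ℝ) / 5))
    (by constructor <;> norm_num) (fun _ _ => zero_le_one) (fun τ hτ => Real.rpow_nonneg (hf τ hτ) _)
  simp only [one_mul, Real.one_rpow, Finset.sum_const, nsmul_eq_mul, mul_one] at h
  refine h.trans (le_of_eq ?_)
  congr 1
  rw [show (1 : ℝ) / (5 / 4) = 4 / 5 by norm_num]
  congr 1
  refine Finset.sum_congr rfl fun τ hτ => ?_
  rw [← Real.rpow_mul (hf τ hτ)]; norm_num

end LST

namespace LST
open Polynomial Set Filter Topology

theorem cells_bound {Ω Y T : Type} [DecidableEq T] [DecidableEq Y] {E : Ω → Y → Prop} {M : ℕ} {X : Finset Ω}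
    {L : Finset Y} (hK : KF E M X L) (f : Ω → T) (S : Finset T) (hf : ∀ x ∈ X, f x ∈ S)
    (cr : T → Finset Y)
    (hcr : ∀ τ ∈ S, ∀ y ∈ L, y ∉ cr τ → ∀ x ∈ X, f x = τ → ∀ x' ∈ X, f x' = τ → E x y → E x' y) :
    inc E X L ≤ ∑ τ ∈ S, inc E (X.filter (fun x => f x = τ)) (L.filter (fun y => y ∈ cr τ)) +
      M * X.card + 3 * S.card * L.card := by
  rw [inc_fiber f S hf]
  have : ∀ τ ∈ S, inc E (X.filter (fun x => f x = τ)) L ≤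
      inc E (X.filter (fun x => f x = τ)) (L.filter (fun y => y ∈ cr τ)) +
      M * (X.filter (fun x => f x = τ)).card + 3 * L.card := by
    intro τ hτ
    rw [inc_split (fun y => y ∈ cr τ), add_assoc]
    gcongr
    by_cases h4 : 4 ≤ (X.filter (fun x => f x = τ)).card
    · refine (inc_cell (hK.mono (Finset.filter_subset _ _) (Finset.filter_subset _ _)) ?_ h4).trans
        (Nat.le_add_right _ _)
      intro y hy x hx x' hx'
      rw [Finset.mem_filter] at hy hx hx'
      exact hcr τ hτ y hy.1 hy.2 x hx.1 hx.2 x' hx'.1 hx'.2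
    · refine le_trans ?_ (Nat.le_add_left _ _)
      refine inc_le.trans (Nat.mul_le_mul (by omega) (Finset.card_filter_le _ _))
  refine (Finset.sum_le_sum this).trans (le_of_eq ?_)
  rw [Finset.sum_add_distrib, Finset.sum_add_distrib, ← Finset.mul_sum, Finset.sum_const,
    ← Finset.card_eq_sum_card_fiberwise hf, smul_eq_mul]
  ring

theorem low_bound {Ω Y T : Type} [DecidableEq T] {E : Ω → Y → Prop} {M : ℕ} {X : Finset Ω}
    {L : Finset Y} (hK : KF E M X L) (f : Ω → T) (S : Finset T) (hf : ∀ x ∈ X, f x ∈ S)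
    (hcr : ∀ τ ∈ S, ∀ y ∈ L, ∀ x ∈ X, f x = τ → ∀ x' ∈ X, f x' = τ → E x y → E x' y) :
    ∃ X' ⊆ X, X'.card ≤ 3 * S.card ∧ inc E X L ≤ M * X.card + inc E X' L := by
  classical
  refine ⟨X.filter (fun x => (X.filter (fun x' => f x' = f x)).card < 4), Finset.filter_subset _ _, ?_, ?_⟩
  · rw [Finset.card_eq_sum_card_fiberwise (f := f) (t := S) (fun x hx => hf x (Finset.mem_filter.1 hx).1)]
    refine (Finset.sum_le_card_nsmul _ _ 3 (fun τ hτ => ?_)).trans (by simp [mul_comm])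
    by_contra hc
    push Not at hc
    have hne := Finset.card_pos.1 (lt_of_lt_of_le (by norm_num : 0 < 4) hc)
    obtain ⟨x, hx⟩ := hne
    simp only [Finset.mem_filter] at hx
    have h1 := hx.1.2
    rw [hx.2] at h1
    have : (Finset.filter (fun x => f x = τ) (X.filter (fun x => (X.filter (fun x' => f x' = f x)).card < 4))).card
      ≤ (X.filter (fun x' => f x' = τ)).card :=
        Finset.card_le_card (Finset.filter_subset_filter _ (Finset.filter_subset _ _))
    omega
  · rw [inc_splitX (fun x => (X.filter (fun x' => f x' = f x)).card < 4), add_comm]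
    gcongr
    set Xh := X.filter (fun x => ¬ (X.filter (fun x' => f x' = f x)).card < 4) with hXh
    have hsub : Xh ⊆ X := Finset.filter_subset _ _
    rw [inc_fiber f S (fun x hx => hf x (hsub hx))]
    calc _ ≤ ∑ τ ∈ S, M * (Xh.filter (fun x => f x = τ)).card := by
          refine Finset.sum_le_sum fun τ hτ => ?_
          by_cases hne : (Xh.filter (fun x => f x = τ)).Nonempty
          · obtain ⟨x, hx⟩ := hne
            have heq : Xh.filter (fun x => f x = τ) = X.filter (fun x => f x = τ) := by
              ext x'
              simp only [hXh, Finset.mem_filter] at hx ⊢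
              rw [← hx.2]
              constructor
              · rintro ⟨⟨a, b⟩, c⟩; exact ⟨a, c⟩
              · rintro ⟨a, c⟩
                refine ⟨⟨a, ?_⟩, c⟩
                rw [c]; exact hx.1.2
            apply inc_cell (hK.mono ((Finset.filter_subset _ _).trans hsub) (Finset.Subset.refl _))
            · intro y hy x hx x' hx'
              rw [Finset.mem_filter] at hx hx'
              exact hcr τ hτ y hy x (hsub hx.1) hx.2 x' (hsub hx'.1) hx'.2
            · rw [heq]
              simp only [hXh, Finset.mem_filter] at hx
              rw [← hx.2]
              have := hx.1.2
              omega
          · rw [Finset.not_nonempty_iff_eq_empty] at hne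
            rw [hne]; simp [inc]
      _ = M * Xh.card := by
          rw [← Finset.mul_sum, ← Finset.card_eq_sum_card_fiberwise (fun x hx => hf x (hsub hx))]
      _ ≤ _ := Nat.mul_le_mul_left _ (Finset.card_le_card hsub)

end LST

namespace LST
open Polynomial Set Filter Topology

def bnd (ε : ℝ) (n k : ℕ) : ℝ := (n : ℝ) ^ ((4 : ℝ) / 5 + ε) * (k : ℝ) ^ ((4 : ℝ) / 5)

theorem bnd_nonneg (ε : ℝ) (n k : ℕ) : 0 ≤ bnd ε n k := by unfold bnd; positivity

/-- `n ≤ n^{-ε} main` when `n ≤ k^4` -/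
theorem n_le_bnd {ε : ℝ} (_ : 0 < ε) {n k : ℕ} (hnk : n ≤ k ^ 4) : (n : ℝ) * (n : ℝ) ^ ε ≤ bnd ε n k := by
  rcases Nat.eq_zero_or_pos n with rfl | hn
  · simp [bnd_nonneg]
  have hn' : (0 : ℝ) < n := by exact_mod_cast hn
  have h1 : (n : ℝ) ^ ((1 : ℝ) / 5) ≤ (k : ℝ) ^ ((4 : ℝ) / 5) := by
    have : (n : ℝ) ≤ (k : ℝ) ^ 4 := by exact_mod_cast hnk
    calc (n : ℝ) ^ ((1 : ℝ) / 5) ≤ ((k : ℝ) ^ 4) ^ ((1 : ℝ) / 5) := Real.rpow_le_rpow hn'.le this (by norm_num)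
      _ = _ := by rw [← Real.rpow_natCast, ← Real.rpow_mul (by positivity)]; norm_num
  unfold bnd
  calc (n : ℝ) * (n : ℝ) ^ ε = (n : ℝ) ^ ((4 : ℝ) / 5 + ε) * (n : ℝ) ^ ((1 : ℝ) / 5) := by
        rw [← Real.rpow_add hn']
        nth_rewrite 1 [← Real.rpow_one (n : ℝ)]
        rw [← Real.rpow_add hn']; congr 1; ring
    _ ≤ _ := by gcongr

theorem k_le_bnd {ε : ℝ} (_ : 0 < ε) {n k : ℕ} {D : ℝ} (hn : 0 < n) (hD : 1 ≤ D)
    (hnk : (k : ℝ) ≤ D * (n : ℝ) ^ 4) : (k : ℝ) * (n : ℝ) ^ ε ≤ D * bnd ε n k := by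
  rcases Nat.eq_zero_or_pos k with rfl | hk
  · simp only [Nat.cast_zero, zero_mul]; have := bnd_nonneg ε n 0; positivity
  have hn' : (0 : ℝ) < n := by exact_mod_cast hn
  have hk' : (0 : ℝ) < k := by exact_mod_cast hk
  have h1 : (k : ℝ) ^ ((1 : ℝ) / 5) ≤ D * (n : ℝ) ^ ((4 : ℝ) / 5) := by
    calc (k : ℝ) ^ ((1 : ℝ) / 5) ≤ (D * (n : ℝ) ^ 4) ^ ((1 : ℝ) / 5) := Real.rpow_le_rpow hk'.le hnk (by norm_num)
      _ = D ^ ((1 : ℝ) / 5) * (n : ℝ) ^ ((4 : ℝ) / 5) := by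
        rw [Real.mul_rpow (by linarith) (by positivity), ← Real.rpow_natCast (n : ℝ), ← Real.rpow_mul (by positivity)]; norm_num
      _ ≤ _ := by
        gcongr
        nth_rewrite 2 [← Real.rpow_one D]
        exact Real.rpow_le_rpow_of_exponent_le hD (by norm_num)
  unfold bnd
  calc (k : ℝ) * (n : ℝ) ^ ε = (k : ℝ) ^ ((1 : ℝ) / 5) * (k : ℝ) ^ ((4 : ℝ) / 5) * (n : ℝ) ^ ε := by
        rw [← Real.rpow_add hk']; norm_num
    _ ≤ D * (n : ℝ) ^ ((4 : ℝ) / 5) * (k : ℝ) ^ ((4 : ℝ) / 5) * (n : ℝ) ^ ε := by gcongr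
    _ = _ := by rw [Real.rpow_add hn']; ring

theorem bnd_mono {ε : ℝ} (hε : 0 < ε) {n k n' k' : ℕ} (hn : n' ≤ n) (hk : k' ≤ k) :
    bnd ε n' k' ≤ bnd ε n k := by
  unfold bnd
  have : (n' : ℝ) ≤ n := by exact_mod_cast hn
  have : (k' : ℝ) ≤ k := by exact_mod_cast hk
  gcongr

set_option maxHeartbeats 2000000 in
theorem comb (P J : Type) [Fintype P] [Fintype J] (C M : ℕ) (ε : ℝ) (hε : 0 < ε) (hε1 : ε ≤ 1 / 5) :
    ∃ A : ℝ, 0 < A ∧ ∀ (Ω Y Sg : Type) (sg : Ω → Y → Sg) (X : Finset Ω) (E : Ω → Y → Prop),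
      HasDec (X : Set Ω) sg P J C 4 →
      (∀ x ∈ X, ∀ x' ∈ X, ∀ y, sg x y = sg x' y → E x y → E x' y) →
      ∀ (X' : Finset Ω) (L : Finset Y), X' ⊆ X → KF E M X' L →
        (inc E X' L : ℝ) ≤ A * (bnd ε L.card X'.card + L.card + X'.card) := by
  classical
  set D : ℝ := (C : ℝ) + 1 with hD
  have hD1 : 1 ≤ D := by rw [hD]; linarith [Nat.cast_nonneg (α := ℝ) C]
  obtain ⟨s, θ, hs0, hθ0, hθ1, hsam, hκ⟩ := params (Fintype.card P) (Fintype.card J) D ε (by linarith) hε hε1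
  have ht : Tendsto (fun n : ℕ => (n : ℝ) ^ ε) atTop atTop :=
    (tendsto_rpow_atTop hε).comp tendsto_natCast_atTop_atTop
  obtain ⟨n0, hn0⟩ := (ht.eventually_ge_atTop (16 * D * (s : ℝ) ^ 4 + 24 * D)).exists_forall_of_atTop
  set A : ℝ := n0 + 3 + 2 * M with hA
  have hA3 : 3 ≤ A := by
    rw [hA]; linarith [Nat.cast_nonneg (α := ℝ) n0, Nat.cast_nonneg (α := ℝ) M]
  have hAM : 2 * (M : ℝ) ≤ A := by
    rw [hA]; linarith [Nat.cast_nonneg (α := ℝ) n0, Nat.cast_nonneg (α := ℝ) M]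
  refine ⟨A, by linarith, ?_⟩
  intro Ω Y Sg sg X E hdec hE
  have main : ∀ m : ℕ, ∀ (X' : Finset Ω) (L : Finset Y), X' ⊆ X → KF E M X' L → X'.card + L.card < m →
        (inc E X' L : ℝ) ≤ A * (bnd ε L.card X'.card + L.card + X'.card) := by
    intro m
    induction m with
    | zero => intro X' L _ _ h; omega
    | succ m ih =>
    intro X' L hX' hK hm
    set n := L.card with hn
    set k := X'.card with hk
    have hb := bnd_nonneg ε n k
    have hnn : (0 : ℝ) ≤ n := Nat.cast_nonneg n
    have hkk : (0 : ℝ) ≤ k := Nat.cast_nonneg k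
    have hMM : (0 : ℝ) ≤ M := Nat.cast_nonneg M
    by_cases h1 : k ^ 4 ≤ n
    · have h := KST hK
      have h' : (inc E X' L : ℝ) ≤ 3 * n + M * (k : ℝ) ^ 4 := by exact_mod_cast h
      have h'' : (k : ℝ) ^ 4 ≤ n := by exact_mod_cast h1
      have h3 : (M : ℝ) * (k : ℝ) ^ 4 ≤ M * n := by gcongr
      have : (3 + M : ℝ) * n ≤ A * n := by
        gcongr; rw [hA]; linarith [Nat.cast_nonneg (α := ℝ) n0]
      nlinarith
    by_cases h2 : n < n0
    · have h : inc E X' L ≤ k * n := inc_le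
      have h' : (inc E X' L : ℝ) ≤ k * n := by exact_mod_cast h
      have : (n : ℝ) ≤ A := by
        have : (n : ℝ) ≤ n0 := by exact_mod_cast h2.le
        rw [hA]; linarith
      nlinarith
    push Not at h1 h2
    have hk0 : 0 < k := by
      rcases Nat.eq_zero_or_pos k with h | h
      · rw [h] at h1; simp at h1
      · exact h
    have hlarge := hn0 n h2
    rcases Nat.eq_zero_or_pos n with hn00 | hnpos
    · have : inc E X' L ≤ k * n := inc_le
      rw [hn00, mul_zero] at this
      have : inc E X' L = 0 := by omega
      rw [this, Nat.cast_zero]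
      positivity
    obtain ⟨x0, hx0⟩ := Finset.card_pos.1 hk0
    obtain ⟨cell, hcell⟩ := hdec
    by_cases h3 : 6 * D * (n : ℝ) ^ 4 ≤ k
    · -- many points
      obtain ⟨T, hTc, hTcov, hTun⟩ := hcell n hnpos (fun z => (L.equivFin.symm z).1)
      have hne0 : Nonempty ((P → Fin _) × J) := ⟨(hTcov x0 (hX' hx0)).choose⟩
      choose! f hfT hfc using hTcov
      obtain ⟨X2, hX2, hX2c, hX2i⟩ := low_bound hK f T (fun x hx => hfT x (hX' hx)) (by
        intro τ hτ y hy x hx hxt x' hx' hxt' he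
        refine hE x (hX' hx) x' (hX' hx') y ?_ he
        have := hTun τ hτ x (hX' hx) (hxt ▸ hfc x (hX' hx)) x' (hX' hx') (hxt' ▸ hfc x' (hX' hx'))
          (L.equivFin ⟨y, hy⟩)
        simpa using this)
      have hc2 : (X2.card : ℝ) ≤ k / 2 := by
        have : (X2.card : ℝ) ≤ 3 * (C * (n : ℝ) ^ 4) := by
          exact_mod_cast hX2c.trans (Nat.mul_le_mul_left 3 hTc)
        have h4 : (0 : ℝ) ≤ (n : ℝ) ^ 4 := by positivity
        nlinarith
      have hlt : X2.card < k := by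
        have : (X2.card : ℝ) < k := by
          have : (0 : ℝ) < k := by exact_mod_cast hk0
          linarith
        exact_mod_cast this
      have hI := ih X2 L (hX2.trans hX') (hK.mono hX2 (Finset.Subset.refl _)) (by omega)
      have hb2 : bnd ε n X2.card ≤ bnd ε n k := bnd_mono hε le_rfl hlt.le
      have hX2i' : (inc E X' L : ℝ) ≤ M * k + inc E X2 L := by exact_mod_cast hX2i
      calc (inc E X' L : ℝ) ≤ M * k + A * (bnd ε n X2.card + n + X2.card) := by linarith
        _ ≤ M * k + A * (bnd ε n k + n + k / 2) := by gcongr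
        _ ≤ _ := by nlinarith
    push Not at h3
    have : Nonempty L := by
      obtain ⟨y, hy⟩ := Finset.card_pos.1 hnpos; exact ⟨⟨y, hy⟩⟩
    set cr : (P → L) → J → Finset L := fun w j => Finset.univ.filter (fun y =>
      ∃ q ∈ X, ∃ q' ∈ X, q ∈ cell (fun p => (w p).1) j ∧ q' ∈ cell (fun p => (w p).1) j ∧
        sg q y.1 ≠ sg q' y.1) with hcrd
    obtain ⟨S, hS⟩ := sampling cr s θ hθ0.le hθ1.le hsam
    obtain ⟨T, hTc, hTcov, hTun⟩ := hcell s hs0 (fun z => (S z).1)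
    have hne0 : Nonempty ((P → Fin _) × J) := ⟨(hTcov x0 (hX' hx0)).choose⟩
    choose! f hfT hfc using hTcov
    have hcrT : ∀ τ ∈ T, ((cr (S ∘ τ.1) τ.2).card : ℝ) ≤ θ * n := by
      intro τ hτ
      have := hS τ.1 τ.2 (by
        intro z hz
        simp only [hcrd, Finset.mem_filter, Finset.mem_univ, true_and] at hz
        obtain ⟨q, hq, q', hq', c, c', hne⟩ := hz
        exact hne (hTun τ hτ q hq c q' hq' c' z))
      simpa using this
    have hcb := cells_bound hK f T (fun x hx => hfT x (hX' hx))
      (fun τ => (cr (S ∘ τ.1) τ.2).map (Function.Embedding.subtype _)) (by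
        intro τ hτ y hy hyc x hx hxt x' hx' hxt' he
        refine hE x (hX' hx) x' (hX' hx') y ?_ he
        by_contra hne
        apply hyc
        simp only [Finset.mem_map, Function.Embedding.subtype_apply, hcrd, Finset.mem_filter,
          Finset.mem_univ, true_and]
        exact ⟨⟨y, hy⟩, ⟨x, hX' hx, x', hX' hx', hxt ▸ hfc x (hX' hx), hxt' ▸ hfc x' (hX' hx'), hne⟩, rfl⟩)
    set Xc := fun τ => X'.filter (fun x => f x = τ) with hXc
    set Lc := fun τ : (P → Fin s) × J => L.filter (fun y => y ∈ (cr (S ∘ τ.1) τ.2).map (Function.Embedding.subtype _)) with hLc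
    have hLcc : ∀ τ ∈ T, ((Lc τ).card : ℝ) ≤ θ * n := by
      intro τ hτ
      refine le_trans ?_ (hcrT τ hτ)
      have : (Lc τ).card ≤ ((cr (S ∘ τ.1) τ.2).map (Function.Embedding.subtype _)).card := by
        apply Finset.card_le_card
        intro y hy
        exact (Finset.mem_filter.1 hy).2
      rw [Finset.card_map] at this
      exact_mod_cast this
    have hnp : (0 : ℝ) < n := by exact_mod_cast hnpos
    have hI : ∀ τ ∈ T, (inc E (Xc τ) (Lc τ) : ℝ) ≤
        A * ((θ * n) ^ ((4 : ℝ) / 5 + ε) * ((Xc τ).card : ℝ) ^ ((4 : ℝ) / 5) + n + (Xc τ).card) := by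
      intro τ hτ
      have hlt : (Lc τ).card < n := by
        have : ((Lc τ).card : ℝ) < n := lt_of_le_of_lt (hLcc τ hτ) (by nlinarith)
        exact_mod_cast this
      have hle : (Xc τ).card ≤ k := Finset.card_filter_le _ _
      refine (ih (Xc τ) (Lc τ) ((Finset.filter_subset _ _).trans hX')
        (hK.mono (Finset.filter_subset _ _) (Finset.filter_subset _ _)) (by omega)).trans ?_
      unfold bnd
      have := hLcc τ hτ
      have h' : ((Lc τ).card : ℝ) ≤ n := by exact_mod_cast hlt.le
      gcongr
    have hTD : (T.card : ℝ) ≤ D * (s : ℝ) ^ 4 := by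
      have : (T.card : ℝ) ≤ C * (s : ℝ) ^ 4 := by exact_mod_cast hTc
      have h5 : (0 : ℝ) ≤ (s : ℝ) ^ 4 := by positivity
      rw [hD]; linarith
    have hksum : ∑ τ ∈ T, ((Xc τ).card : ℝ) = k := by
      rw [hk, Finset.card_eq_sum_card_fiberwise (fun x hx => hfT x (hX' hx))]
      push_cast; rfl
    have hsum : ∑ τ ∈ T, (inc E (Xc τ) (Lc τ) : ℝ) ≤ A * (1 / 4 * bnd ε n k + D * (s : ℝ) ^ 4 * n + k) := by
      refine (Finset.sum_le_sum hI).trans ?_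
      rw [← Finset.mul_sum]
      apply mul_le_mul_of_nonneg_left _ (by linarith)
      rw [Finset.sum_add_distrib, Finset.sum_add_distrib, hksum, Finset.sum_const, nsmul_eq_mul, ← Finset.mul_sum]
      have h6 := sum_rpow_le T (fun τ => ((Xc τ).card : ℝ)) (fun _ _ => Nat.cast_nonneg _)
      rw [hksum] at h6
      have h7 : (θ * n) ^ ((4 : ℝ) / 5 + ε) * ∑ τ ∈ T, ((Xc τ).card : ℝ) ^ ((4 : ℝ) / 5) ≤ 1 / 4 * bnd ε n k := by
        calc _ ≤ (θ * n) ^ ((4 : ℝ) / 5 + ε) * ((D * (s : ℝ) ^ 4) ^ ((1 : ℝ) / 5) * (k : ℝ) ^ ((4 : ℝ) / 5)) := by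
              refine mul_le_mul_of_nonneg_left (h6.trans ?_) (by positivity)
              gcongr
          _ = (θ ^ ((4 : ℝ) / 5 + ε) * (D * (s : ℝ) ^ 4) ^ ((1 : ℝ) / 5)) * bnd ε n k := by
              rw [Real.mul_rpow hθ0.le hnn]; unfold bnd; ring
          _ ≤ _ := by gcongr
      have h8 : (T.card : ℝ) * n ≤ D * (s : ℝ) ^ 4 * n := by gcongr
      linarith
    have hfin : (inc E X' L : ℝ) ≤ ∑ τ ∈ T, (inc E (Xc τ) (Lc τ) : ℝ) + M * k + 3 * (T.card : ℝ) * n := by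
      exact_mod_cast hcb
    have hN := n_le_bnd hε h1.le
    have hKK := k_le_bnd hε (D := 6 * D) hnpos (by linarith) h3.le
    have h9 : 3 * (T.card : ℝ) * n ≤ 3 * (D * (s : ℝ) ^ 4) * n := by gcongr
    have hDs : 0 ≤ D * (s : ℝ) ^ 4 := by positivity
    have e1 : 16 * (D * (s : ℝ) ^ 4) * n ≤ bnd ε n k := by
      refine le_trans ?_ hN
      rw [mul_comm (n : ℝ)]
      gcongr
      linarith
    have e2 : (4 : ℝ) * k ≤ bnd ε n k := by
      have : (k : ℝ) * (24 * D) ≤ (k : ℝ) * (n : ℝ) ^ ε := by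
        gcongr
        have : 0 ≤ 16 * D * (s : ℝ) ^ 4 := by positivity
        linarith
      nlinarith
    have e3 : A * (D * (s : ℝ) ^ 4 * n) ≤ A * (bnd ε n k / 16) := by
      gcongr; linarith
    have e4 : (M : ℝ) * k ≤ A * (bnd ε n k / 4) := by
      calc (M : ℝ) * k ≤ A * k := by gcongr; linarith
        _ ≤ _ := by gcongr; linarith
    have e5 : 3 * (D * (s : ℝ) ^ 4) * n ≤ A * (bnd ε n k / 16) := by
      calc 3 * (D * (s : ℝ) ^ 4) * n = 3 * (D * (s : ℝ) ^ 4 * n) := by ring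
        _ ≤ A * (bnd ε n k / 16) := by gcongr; linarith
    have e6 : 0 ≤ A * bnd ε n k := by positivity
    have e7 : 0 ≤ A * n := by positivity
    clear_value A D n k
    linarith
  intro X' L hX' hK
  exact main _ X' L hX' hK (Nat.lt_succ_self _)

end LST

namespace LST
open Polynomial Set Filter Topology

/-- coefficient vectors of polynomials in 4 variables of degree ≤ N in each variable -/
abbrev Co (N : ℕ) := (Fin 4 → Fin (N + 1)) → ℝ
abbrev R4 := Fin 4 → ℝ

def ev {N : ℕ} (c : Co N) (x : R4) : ℝ := ∑ m, c m * ∏ i, x i ^ (m i).val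

/-- coordinates of `x` with coordinate `k` last -/
def pr (k : Fin 4) (x : R4) : (ℝ × ℝ) × ℝ :=
  ((x (Equiv.swap k 3 0), x (Equiv.swap k 3 1)), x (Equiv.swap k 3 2))

def hat {N : ℕ} {W : Type} (k : Fin 4) (co : W → Co N) : A4 W :=
  ∑ m : Fin 4 → Fin (N + 1), C (C (C (C (fun w => co w m) * X ^ (m (Equiv.swap k 3 0)).val) *
    X ^ (m (Equiv.swap k 3 1)).val) * X ^ (m (Equiv.swap k 3 2)).val) * X ^ (m k).val

theorem hat_eval {N : ℕ} {W : Type} (k : Fin 4) (co : W → Co N) (w : W) (x : R4) (t : ℝ) :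
    ((hat k co).map (e3 w (pr k x))).eval t = ev (co w) (Function.update x k t) := by
  have hne : ∀ i : Fin 4, i ≠ 3 → Equiv.swap k 3 i ≠ k := by
    intro i hi h
    apply hi
    have := congrArg (Equiv.swap k 3) h
    simpa using this
  unfold hat ev
  rw [Polynomial.map_sum, eval_finsetSum]
  refine Finset.sum_congr rfl fun m _ => ?_
  rw [← Equiv.prod_comp (Equiv.swap k 3), Fin.prod_univ_four]
  simp only [Equiv.swap_apply_right, Function.update_self, Function.update_of_ne (hne 0 (by decide)),
    Function.update_of_ne (hne 1 (by decide)), Function.update_of_ne (hne 2 (by decide))]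
  simp only [Polynomial.map_mul, Polynomial.map_pow, map_C, map_X, eval_mul, eval_pow, eval_C, eval_X,
    e3, e2, e1, e0, pr, coe_eval₂RingHom, eval₂_mul, eval₂_C, eval₂_pow, eval₂_X, Pi.evalRingHom_apply]
  ring

/-- the chain of leading parts -/
def chain {N : ℕ} (c : Co N) (m0 : Fin 4 → Fin (N + 1)) (k : ℕ) : Co N := fun m =>
  if ∀ l : Fin 4, k ≤ l.val → m l = 0 then c (fun l => if k ≤ l.val then m0 l else m l) else 0

theorem ev_upd {N : ℕ} (c : Co N) (k : Fin 4) (x : R4) (t : ℝ) : ev c (Function.update x k t) =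
    ∑ a : Fin (N + 1), (∑ m : Fin 4 → Fin (N + 1), if m k = a then
      c m * ∏ i ∈ Finset.univ.erase k, x i ^ (m i).val else 0) * t ^ a.val := by
  classical
  unfold ev
  simp only [Finset.sum_mul]
  rw [Finset.sum_comm]
  refine Finset.sum_congr rfl fun m _ => ?_
  simp only [ite_mul, zero_mul]
  rw [Finset.sum_ite_eq]
  simp only [Finset.mem_univ, if_true]
  rw [← Finset.mul_prod_erase Finset.univ _ (Finset.mem_univ k), Function.update_self]
  have : ∏ i ∈ Finset.univ.erase k, (Function.update x k t i) ^ (m i).val =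
      ∏ i ∈ Finset.univ.erase k, x i ^ (m i).val :=
    Finset.prod_congr rfl fun i hi => by rw [Function.update_of_ne (Finset.ne_of_mem_erase hi)]
  rw [this]; ring

theorem chain_step {N : ℕ} (c : Co N) (m0 : Fin 4 → Fin (N + 1)) (k : Fin 4) (x : R4)
    (h : ∀ t, ev (chain c m0 (k + 1)) (Function.update x k t) = 0) : ev (chain c m0 k) x = 0 := by
  classical
  set a : Fin (N + 1) → ℝ := fun a => (∑ m : Fin 4 → Fin (N + 1), if m k = a then
      chain c m0 (k + 1) m * ∏ i ∈ Finset.univ.erase k, x i ^ (m i).val else 0) with ha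
  have h0 : (∑ b : Fin (N + 1), C (a b) * X ^ b.val : ℝ[X]) = 0 := by
    apply Polynomial.funext
    intro t
    have := h t
    rw [ev_upd] at this
    simp only [eval_finsetSum, eval_mul, eval_C, eval_pow, eval_X, eval_zero]
    exact this
  have h1 : a (m0 k) = 0 := by
    have := congrArg (fun p => p.coeff (m0 k).val) h0
    simp only [finsetSum_coeff, coeff_C_mul, coeff_X_pow, coeff_zero] at this
    rw [Finset.sum_eq_single (m0 k)] at this
    · simpa using this
    · intro b _ hb
      rw [if_neg, mul_zero]
      intro hc; exact hb (Fin.ext hc.symm)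
    · simp
  rw [← h1, ha]
  unfold ev
  simp only
  -- bijection m ↦ update m k (m0 k)
  rw [← Finset.sum_filter]
  have hz : ∑ m : Fin 4 → Fin (N + 1), chain c m0 k m * ∏ i, x i ^ (m i).val =
      ∑ m ∈ Finset.univ.filter (fun m : Fin 4 → Fin (N + 1) => m k = 0),
        chain c m0 k m * ∏ i, x i ^ (m i).val := by
    symm
    apply Finset.sum_subset (Finset.filter_subset _ _)
    intro m _ hm
    have : chain c m0 k m = 0 := by
      unfold chain
      rw [if_neg]
      intro hc
      apply hm
      simp [hc k le_rfl]
    rw [this, zero_mul]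
  rw [hz]
  refine Finset.sum_bij' (fun m _ => Function.update m k (m0 k)) (fun m _ => Function.update m k 0) ?_ ?_ ?_ ?_ ?_
  · intro m hm; simp
  · intro m hm; simp
  · intro m hm
    simp only [Finset.mem_filter, Finset.mem_univ, true_and] at hm
    simp only [Function.update_idem]
    rw [← hm, Function.update_eq_self]
  · intro m hm
    simp only [Finset.mem_filter, Finset.mem_univ, true_and] at hm
    simp only [Function.update_idem]
    rw [← hm, Function.update_eq_self]
  · intro m hm
    simp only [Finset.mem_filter, Finset.mem_univ, true_and] at hm
    congr 1
    · unfold chain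
      have e1 : (∀ l : Fin 4, k.val ≤ l.val → m l = 0) ↔
          (∀ l : Fin 4, k.val + 1 ≤ l.val → Function.update m k (m0 k) l = 0) := by
        constructor
        · intro h l hl
          have : l ≠ k := fun h => by rw [h] at hl; omega
          rw [Function.update_of_ne this]; exact h l (by omega)
        · intro h l hl
          by_cases hlk : l = k
          · rw [hlk, hm]
          · have := h l (by have : l.val ≠ k.val := fun h => hlk (Fin.ext h); omega)
            rwa [Function.update_of_ne hlk] at this
      simp only [e1]
      congr 2
      funext l
      by_cases hlk : l = k
      · subst hlk; simp
      · rw [Function.update_of_ne hlk]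
        have : l.val ≠ k.val := fun h => hlk (Fin.ext h)
        have : k.val ≤ l.val ↔ k.val + 1 ≤ l.val := by omega
        simp only [this]
    · rw [← Finset.mul_prod_erase Finset.univ _ (Finset.mem_univ k), hm]
      simp only [Fin.val_zero, pow_zero, one_mul]
      exact Finset.prod_congr rfl fun i hi => by rw [Function.update_of_ne (Finset.ne_of_mem_erase hi)]

theorem chain_exists {N : ℕ} (c : Co N) (hc : c ≠ 0) : ∃ m0 : Fin 4 → Fin (N + 1), ∀ x, ev c x = 0 →
    ∃ k : Fin 4, ev (chain c m0 (k + 1)) x = 0 ∧ ∃ t, ev (chain c m0 (k + 1)) (Function.update x k t) ≠ 0 := by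
  obtain ⟨m0, hm0⟩ := Function.ne_iff.1 hc
  refine ⟨m0, fun x hx => ?_⟩
  by_contra hcon
  push Not at hcon
  have h4 : ev (chain c m0 4) x = 0 := by
    have : chain c m0 4 = c := by
      funext m
      unfold chain
      rw [if_pos (fun l hl => by omega)]
      congr 1
      funext l
      rw [if_neg (by omega)]
    rw [this]; exact hx
  have h3 := chain_step c m0 3 x (hcon 3 h4)
  have h2 := chain_step c m0 2 x (hcon 2 h3)
  have h1 := chain_step c m0 1 x (hcon 1 h2)
  have h0 := chain_step c m0 0 x (hcon 0 h1)
  apply hm0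
  unfold ev at h0
  rw [Finset.sum_eq_single 0] at h0
  · simpa [chain] using h0
  · intro m _ hm
    have : chain c m0 0 m = 0 := by
      unfold chain
      rw [if_neg]
      intro hc
      exact hm (funext fun l => hc l (Nat.zero_le _))
    simp [this]
  · simp

end LST

namespace LST
open Polynomial Set Filter Topology

theorem HasDec.pull {Ω Y Sg Ω' Y' P J : Type} {X : Set Ω} {sg : Ω → Y → Sg} {C t : ℕ}
    (h : HasDec X sg P J C t) (f : Ω' → Ω) (g : Y' → Y) (X' : Set Ω') (hX : ∀ x ∈ X', f x ∈ X) :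
    HasDec X' (fun x y => sg (f x) (g y)) P J C t := by
  obtain ⟨cell, hc⟩ := h
  refine ⟨fun w j => {x | f x ∈ cell (g ∘ w) j}, fun s hs S => ?_⟩
  obtain ⟨T, h1, h2, h3⟩ := hc s hs (g ∘ S)
  exact ⟨T, h1, fun q hq => h2 (f q) (hX q hq), fun τ hτ q hq hqc q' hq' hqc' z =>
    h3 τ hτ (f q) (hX q hq) hqc (f q') (hX q' hq') hqc' z⟩

def Ez {N : ℕ} {Y : Type} (h : Y → Co N) : R4 → Y → Prop := fun x y => ev (h y) x = 0

def lpoly {N : ℕ} (Q : Co N) (k : Fin 4) (x : R4) : ℝ[X] :=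
  (hat k (fun _ : Unit => Q)).map (e3 () (pr k x))

theorem lpoly_eval {N : ℕ} (Q : Co N) (k : Fin 4) (x : R4) (t : ℝ) :
    (lpoly Q k x).eval t = ev Q (Function.update x k t) := hat_eval k _ () x t

theorem lpoly_deg {N : ℕ} (Q : Co N) (k : Fin 4) (x : R4) : (lpoly Q k x).natDegree ≤ N := by
  refine natDegree_map_le.trans ?_
  unfold hat
  refine natDegree_sum_le_of_forall_le _ _ fun m _ => ?_
  exact (natDegree_C_mul_X_pow_le _ _).trans (Nat.lt_succ_iff.1 (m k).2)

set_option maxSynthPendingDepth 10 in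
theorem OI4 {W : Type} (G : Finset (A4 W)) : ∃ H : Finset (A3 W), ∀ α β : A3 W →+* ℝ,
      (∀ h ∈ H, SignType.sign (α h) = SignType.sign (β h)) →
      ∃ φ : ℝ ≃o ℝ, SP φ (fun g : G => g.1.map α) (fun g : G => g.1.map β) := by
  obtain ⟨H, hH⟩ := OI2 (R := A3 W) (RingHom.id (A3 W)) (RingHom.id _) G
  refine ⟨H, fun α β h => ?_⟩
  obtain ⟨φ, hφ, -⟩ := hH α β h
  exact ⟨φ, by simpa only [RingHom.comp_id] using hφ⟩

theorem grp (N M : ℕ) (ε : ℝ) (hε : 0 < ε) (hε1 : ε ≤ 1 / 5) (k : Fin 4) : ∃ A : ℝ, 0 < A ∧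
    ∀ (Y : Type) (h : Y → Co N) (Q : Co N) (X : Finset R4) (L : Finset Y) (a : ℕ),
      (∀ x ∈ X, ev Q x = 0 ∧ (∃ t, ev Q (Function.update x k t) ≠ 0) ∧
        cle (rt (fun _ : Unit => lpoly Q k x)) (x k) = a) →
      KF (Ez h) M X L → (inc (Ez h) X L : ℝ) ≤ A * (bnd ε L.card X.card + L.card + X.card) := by
  classical
  set G : Finset (A4 (Co N × Co N)) := {hat k Prod.fst, hat k Prod.snd} with hG
  obtain ⟨H, hH⟩ := OI4 G
  obtain ⟨P, J, _, _, C, hD⟩ := D3 H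
  obtain ⟨A, hA, hc⟩ := comb P J C M ε hε hε1
  refine ⟨A, hA, ?_⟩
  intro Y h Q X L a hX hK
  refine hc R4 Y _ _ X (Ez h) ((hD (X.image (pr k))).pull (pr k) (fun y => (h y, Q)) X
    (fun x hx => by simpa using ⟨x, hx, rfl⟩)) ?_ X L (Finset.Subset.refl _) hK
  intro x hx x' hx' y hs he
  obtain ⟨φ, hφ⟩ := hH (e3 (h y, Q) (pr k x)) (e3 (h y, Q) (pr k x')) (fun g hg =>
    congrFun hs ⟨g, hg⟩)
  have h1 : ∀ t, SignType.sign (ev (h y) (Function.update x k t)) =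
      SignType.sign (ev (h y) (Function.update x' k (φ t))) := by
    intro t
    have := hφ ⟨hat k Prod.fst, by simp [hG]⟩ t
    simpa only [hat_eval] using this
  have h2 : SP φ (fun _ : Unit => lpoly Q k x) (fun _ : Unit => lpoly Q k x') := by
    intro _ t
    have := hφ ⟨hat k Prod.snd, by simp [hG]⟩ t
    simpa only [hat_eval, lpoly_eval] using this
  have hmem : ∀ x ∈ X, x k ∈ rt (fun _ : Unit => lpoly Q k x) := by
    intro x hx
    obtain ⟨a1, ⟨t, ht⟩, -⟩ := hX x hx
    refine mem_rt.2 ⟨(), ?_, ?_⟩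
    · intro h0
      rw [← lpoly_eval, h0] at ht
      simp at ht
    · rw [lpoly_eval, Function.update_eq_self]; exact a1
  have h3 := h2.cle (x k) (φ (x k)) (by simp)
  rw [(hX x hx).2.2, ← (hX x' hx').2.2] at h3
  have h4 := cle_eq h3
  have h5 := (h4 _ (hmem x' hx')).2 le_rfl
  have h6 := (h4 _ ((h2.mem (x k)).2 (hmem x hx))).1 le_rfl
  have h7 : φ (x k) = x' k := le_antisymm h6 h5
  have h8 := h1 (x k)
  rw [h7, Function.update_eq_self, Function.update_eq_self] at h8
  unfold Ez at he ⊢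
  rw [he, sign_zero] at h8
  exact sign_eq_zero_iff.1 h8.symm

theorem onZ (N M : ℕ) (ε : ℝ) (hε : 0 < ε) (hε1 : ε ≤ 1 / 5) : ∃ A : ℝ, 0 < A ∧
    ∀ (Y : Type) (h : Y → Co N) (c : Co N) (X : Finset R4) (L : Finset Y), c ≠ 0 →
      (∀ x ∈ X, ev c x = 0) → KF (Ez h) M X L →
      (inc (Ez h) X L : ℝ) ≤ A * (bnd ε L.card X.card + L.card + X.card) := by
  classical
  choose A hA hgrp using grp N M ε hε hε1
  refine ⟨∑ g : Fin 4 × Fin (N + 1), A g.1, Finset.sum_pos (fun g _ => hA g.1) ⟨(0, 0), Finset.mem_univ _⟩, ?_⟩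
  intro Y h c X L hc hX hK
  obtain ⟨m0, hm0⟩ := chain_exists c hc
  have : ∀ x ∈ X, ∃ g : Fin 4 × Fin (N + 1), ev (chain c m0 (g.1 + 1)) x = 0 ∧
      (∃ t, ev (chain c m0 (g.1 + 1)) (Function.update x g.1 t) ≠ 0) ∧
        cle (rt (fun _ : Unit => lpoly (chain c m0 (g.1 + 1)) g.1 x)) (x g.1) = g.2.val := by
    intro x hx
    obtain ⟨k, h1, h2⟩ := hm0 x (hX x hx)
    refine ⟨(k, ⟨cle (rt (fun _ : Unit => lpoly (chain c m0 (k + 1)) k x)) (x k), ?_⟩), h1, h2, rfl⟩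
    have := (cle_le (rt (fun _ : Unit => lpoly (chain c m0 (k + 1)) k x)) (x k)).trans
      (rt_card _ (fun _ => N) (fun _ => lpoly_deg _ _ _))
    simp at this
    omega
  choose! f hf using this
  rw [inc_fiber f Finset.univ (fun _ _ => Finset.mem_univ _)]
  push_cast
  rw [Finset.sum_mul]
  refine Finset.sum_le_sum fun g _ => ?_
  have hsub : X.filter (fun x => f x = g) ⊆ X := Finset.filter_subset _ _
  refine (hgrp g.1 Y h (chain c m0 (g.1 + 1)) (X.filter (fun x => f x = g)) L g.2.val ?_
    (hK.mono hsub (Finset.Subset.refl _))).trans ?_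
  · intro x hx
    rw [Finset.mem_filter] at hx
    have := hf x hx.1
    rw [hx.2] at this
    exact this
  · have h1 := Finset.card_le_card hsub
    have h2 : ((X.filter (fun x => f x = g)).card : ℝ) ≤ X.card := by exact_mod_cast h1
    have h3 := bnd_mono hε (le_refl L.card) h1
    have := hA g.1
    gcongr

end LST

namespace LST
open Polynomial Set Filter Topology

section iso
variable {ι : Type} [Fintype ι] [DecidableEq ι]

theorem had (w : ι → EuclideanSpace ℝ ι) : |(EuclideanSpace.basisFun ι ℝ).toBasis.det w| ≤
    (Fintype.card ι).factorial * ∏ i, ‖w i‖ := by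
  rw [Module.Basis.det_apply, Matrix.det_apply]
  refine (Finset.abs_sum_le_sum_abs _ _).trans ?_
  have h : ∀ σ ∈ (Finset.univ : Finset (Equiv.Perm ι)), |Equiv.Perm.sign σ • ∏ i,
      (EuclideanSpace.basisFun ι ℝ).toBasis.toMatrix w (σ i) i| ≤ ∏ i, ‖w i‖ := by
    intro σ _
    have : |Equiv.Perm.sign σ • ∏ i, (EuclideanSpace.basisFun ι ℝ).toBasis.toMatrix w (σ i) i| =
        |∏ i, (EuclideanSpace.basisFun ι ℝ).toBasis.toMatrix w (σ i) i| := by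
      rcases Int.units_eq_one_or (Equiv.Perm.sign σ) with h | h <;> simp [h]
    rw [this, Finset.abs_prod]
    refine Finset.prod_le_prod (fun _ _ => abs_nonneg _) fun i _ => ?_
    rw [Module.Basis.toMatrix_apply]
    simpa using PiLp.norm_apply_le (w i) (σ i)
  refine (Finset.sum_le_sum h).trans ?_
  rw [Finset.sum_const, Finset.card_univ, Fintype.card_perm, nsmul_eq_mul]

theorem greedy [Nonempty ι] {α : Type} [DecidableEq α] (v : α → EuclideanSpace ℝ ι) (X : Finset α) : ∃ (h : ℕ) (X' : Finset α),
    X' ⊆ X ∧ X'.card = h * Fintype.card ι ∧ (∃ g : EuclideanSpace ℝ ι →ₗ[ℝ] ℝ, g ≠ 0 ∧ ∀ x ∈ X \ X', g (v x) = 0) ∧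
    (∀ x ∈ X', v x ≠ 0) ∧ ∃ c : ℝ, 0 < c ∧ ∀ A : EuclideanSpace ℝ ι →ₗ[ℝ] EuclideanSpace ℝ ι,
      c * |LinearMap.det A| ^ h ≤ ∏ x ∈ X', ‖A (v x)‖ := by
  induction X using Finset.strongInduction with
  | H X ih =>
  by_cases hs : Submodule.span ℝ (Set.range (fun x : X => v x)) < ⊤
  · obtain ⟨g, hg, hk⟩ := Submodule.exists_le_ker_of_lt_top _ hs
    refine ⟨0, ∅, by simp, by simp, ⟨g, hg, fun x hx => ?_⟩, by simp, 1, one_pos, by simp⟩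
    have hx : x ∈ X := by simpa using hx
    exact hk (Submodule.subset_span ⟨⟨x, hx⟩, rfl⟩)
  · rw [not_lt_top_iff] at hs
    obtain ⟨κ, a, ha, hsp, hli⟩ := exists_linearIndependent' ℝ (fun x : X => v x)
    rw [hs] at hsp
    let b := Module.Basis.mk hli hsp.ge
    let e : ι ≃ κ := (EuclideanSpace.basisFun ι ℝ).toBasis.indexEquiv b
    set f : ι → α := fun i => (a (e i)).1 with hf
    have hfi : Function.Injective f := fun i j hij => e.injective (ha (Subtype.ext hij))
    set B := Finset.univ.image f with hB
    have hBX : B ⊆ X := by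
      intro x hx
      obtain ⟨i, -, rfl⟩ := Finset.mem_image.1 hx
      exact (a (e i)).2
    have hBc : B.card = Fintype.card ι := by
      rw [hB, Finset.card_image_of_injective _ hfi, Finset.card_univ]
    have hBn : B.Nonempty := by rw [hB]; simp
    obtain ⟨h, X', hX', hc, ⟨g, hg0, hg⟩, hv, c, hc0, hcA⟩ := ih (X \ B) (Finset.sdiff_ssubset hBX hBn)
    have hdis : Disjoint B X' := by
      rw [Finset.disjoint_left]
      intro x hx hx'
      exact (Finset.mem_sdiff.1 (hX' hx')).2 hx
    have hbf : ∀ i, v (f i) = b.reindex e.symm i := by intro i; simp [b, hf]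
    have hd : (EuclideanSpace.basisFun ι ℝ).toBasis.det (fun i => v (f i)) ≠ 0 := by
      have := (EuclideanSpace.basisFun ι ℝ).toBasis.isUnit_det (b.reindex e.symm)
      rw [show (fun i => v (f i)) = b.reindex e.symm from funext hbf]
      exact this.ne_zero
    refine ⟨h + 1, B ∪ X', Finset.union_subset hBX (hX'.trans Finset.sdiff_subset), ?_, ⟨g, hg0, ?_⟩, ?_,
      |(EuclideanSpace.basisFun ι ℝ).toBasis.det (fun i => v (f i))| / (Fintype.card ι).factorial * c,
      by positivity, ?_⟩
    · rw [Finset.card_union_of_disjoint hdis, hc, hBc]; ring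
    · intro x hx
      apply hg
      simp only [Finset.mem_sdiff, Finset.mem_union, not_or] at hx ⊢
      tauto
    · intro x hx
      rcases Finset.mem_union.1 hx with hx | hx
      · obtain ⟨i, -, rfl⟩ := Finset.mem_image.1 hx
        rw [hbf]
        exact Module.Basis.ne_zero _ _
      · exact hv x hx
    · intro A
      rw [Finset.prod_union hdis, pow_succ]
      have h1 : |LinearMap.det A| * |(EuclideanSpace.basisFun ι ℝ).toBasis.det (fun i => v (f i))| ≤
          (Fintype.card ι).factorial * ∏ x ∈ B, ‖A (v x)‖ := by
        rw [← abs_mul, ← Module.Basis.det_comp, hB, Finset.prod_image (fun x _ y _ h => hfi h)]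
        exact had _
      have h2 := hcA A
      have h3 : (0 : ℝ) < (Fintype.card ι).factorial := by positivity
      calc _ = (|LinearMap.det A| * |(EuclideanSpace.basisFun ι ℝ).toBasis.det (fun i => v (f i))| /
            (Fintype.card ι).factorial) * (c * |LinearMap.det A| ^ h) := by ring
        _ ≤ _ := by
          refine mul_le_mul ((div_le_iff₀ h3).2 (by linarith)) h2 (by positivity) ?_
          exact Finset.prod_nonneg fun _ _ => norm_nonneg _

theorem isot_aux {α : Type} (h : ℕ) (hh : 1 ≤ h) (X' : Finset α) (t a b : α → ℝ)
    (ht1 : ∀ x ∈ X', t x ≤ 1) (ha : ∀ x ∈ X', 0 < a x)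
    (hTn : ∀ x ∈ X', b x ^ 2 = a x ^ 2 * (1 - 3 / 4 * t x))
    (h3 : ∏ x ∈ X', a x ≤ 2 * 2 ^ h * ∏ x ∈ X', b x) : ∑ x ∈ X', t x ≤ 4 * (h : ℝ) := by
  have hP : 0 < ∏ x ∈ X', a x := Finset.prod_pos fun x hx => ha x hx
  have h4 : (1 : ℝ) ≤ 4 * 4 ^ h * ∏ x ∈ X', (1 - 3 / 4 * t x) := by
    have h5 := pow_le_pow_left₀ hP.le h3 2
    rw [mul_pow, mul_pow, ← Finset.prod_pow (s := X') (f := b),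
      Finset.prod_congr rfl hTn, Finset.prod_mul_distrib, Finset.prod_pow] at h5
    have h6 : 0 < (∏ x ∈ X', a x) ^ 2 := by positivity
    rw [← pow_mul, mul_comm h 2, pow_mul] at h5
    norm_num at h5
    refine le_of_mul_le_mul_left ?_ h6
    linarith
  have h5 : ∏ x ∈ X', (1 - 3 / 4 * t x) ≤ Real.exp (∑ x ∈ X', (-(3 / 4 * t x))) := by
    rw [Real.exp_sum]
    refine Finset.prod_le_prod (fun x hx => ?_) (fun x hx => ?_)
    · have := ht1 x hx; linarith
    · have := Real.add_one_le_exp (-(3 / 4 * t x)); linarith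
  have h6 : (4 : ℝ) * 4 ^ h ≤ Real.exp (3 * h) := by
    calc (4 : ℝ) * 4 ^ h ≤ 4 ^ h * 4 ^ h := by
          gcongr
          exact le_self_pow₀ (by norm_num) (by omega)
      _ = 16 ^ h := by rw [← mul_pow]; norm_num
      _ ≤ (Real.exp 3) ^ h := by
          gcongr
          have := Real.exp_one_gt_d9
          have h7 : Real.exp 3 = Real.exp 1 ^ 3 := by rw [← Real.exp_nat_mul]; norm_num
          rw [h7]
          calc (16 : ℝ) ≤ 2.7 ^ 3 := by norm_num
            _ ≤ _ := by gcongr; linarith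
      _ = _ := by rw [← Real.exp_nat_mul]; ring_nf
  have h7 : Real.exp 0 ≤ Real.exp (3 * h + ∑ x ∈ X', (-(3 / 4 * t x))) := by
    rw [Real.exp_zero, Real.exp_add]
    refine h4.trans ?_
    gcongr
    · exact Finset.prod_nonneg fun x hx => by have := ht1 x hx; linarith
  have h8 := Real.exp_le_exp.1 h7
  rw [Finset.sum_neg_distrib, ← Finset.mul_sum] at h8
  linarith

theorem isot {α : Type} (v : α → EuclideanSpace ℝ ι) (h : ℕ) (hh : 1 ≤ h) (X' : Finset α)
    (hv : ∀ x ∈ X', v x ≠ 0) (c : ℝ) (hc : 0 < c)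
    (hcA : ∀ A : EuclideanSpace ℝ ι →ₗ[ℝ] EuclideanSpace ℝ ι,
      c * |LinearMap.det A| ^ h ≤ ∏ x ∈ X', ‖A (v x)‖) :
    ∃ A : EuclideanSpace ℝ ι →ₗ[ℝ] EuclideanSpace ℝ ι, (∀ x ∈ X', A (v x) ≠ 0) ∧ ∀ y, ‖y‖ = 1 →
      ∑ x ∈ X', (inner ℝ y (‖A (v x)‖⁻¹ • A (v x))) ^ 2 ≤ 4 * (h : ℝ) := by
  set G : (EuclideanSpace ℝ ι →ₗ[ℝ] EuclideanSpace ℝ ι) → ℝ := fun A =>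
    (∏ x ∈ X', ‖A (v x)‖) / |LinearMap.det A| ^ h with hG
  set S : Set ℝ := {r | ∃ A : EuclideanSpace ℝ ι →ₗ[ℝ] EuclideanSpace ℝ ι, LinearMap.det A ≠ 0 ∧ r = G A} with hS
  have hlow : ∀ A : EuclideanSpace ℝ ι →ₗ[ℝ] EuclideanSpace ℝ ι, LinearMap.det A ≠ 0 → c ≤ G A := by
    intro A hA
    rw [hG]
    have : 0 < |LinearMap.det A| ^ h := by positivity
    exact (le_div_iff₀ this).2 (hcA A)
  have hne : S.Nonempty := ⟨_, LinearMap.id, by simp, rfl⟩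
  have hbd : BddBelow S := ⟨c, by rintro r ⟨A, hA, rfl⟩; exact hlow A hA⟩
  have hinf : c ≤ sInf S := le_csInf hne (by rintro r ⟨A, hA, rfl⟩; exact hlow A hA)
  obtain ⟨_, ⟨A, hA, rfl⟩, hlt⟩ := exists_lt_of_csInf_lt hne (show sInf S < 2 * sInf S by linarith)
  have hA0 : ∀ x ∈ X', A (v x) ≠ 0 := by
    intro x hx h0
    have h1 := (LinearMap.equivOfDetNeZero A hA).map_eq_zero_iff.1 h0
    exact hv x hx h1
  refine ⟨A, hA0, fun y hy => ?_⟩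
  set t : α → ℝ := fun x => (inner ℝ y (‖A (v x)‖⁻¹ • A (v x))) ^ 2 with ht
  have ht1 : ∀ x ∈ X', t x ≤ 1 := by
    intro x hx
    have h1 := abs_real_inner_le_norm y (‖A (v x)‖⁻¹ • A (v x))
    have h2 : ‖‖A (v x)‖⁻¹ • A (v x)‖ = 1 := norm_smul_inv_norm (𝕜 := ℝ) (hA0 x hx)
    rw [hy, h2, one_mul] at h1
    rw [ht]
    exact (sq_le_one_iff_abs_le_one _).2 h1
  set T : EuclideanSpace ℝ ι →ₗ[ℝ] EuclideanSpace ℝ ι :=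
    LinearMap.transvection ((-(1 / 2) : ℝ) • (innerₗ (EuclideanSpace ℝ ι) y)) y with hT
  have hTd : LinearMap.det T = 1 / 2 := by
    rw [hT, LinearMap.transvection.det]
    simp [hy]
    norm_num
  have hTn : ∀ x ∈ X', ‖T (A (v x))‖ ^ 2 = ‖A (v x)‖ ^ 2 * (1 - 3 / 4 * t x) := by
    intro x hx
    have h1 : T (A (v x)) = A (v x) + (-(1 / 2) * inner ℝ y (A (v x))) • y := by
      rw [hT, LinearMap.transvection.apply]; simp
    have h2 : ‖A (v x)‖ ≠ 0 := norm_ne_zero_iff.2 (hA0 x hx)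
    rw [h1, norm_add_sq_real, norm_smul, hy, inner_smul_right, ht]
    simp only [inner_smul_right, Real.norm_eq_abs, mul_one, sq_abs]
    rw [real_inner_comm]
    field_simp
    ring
  have hdet : LinearMap.det (T ∘ₗ A) = 1 / 2 * LinearMap.det A := by rw [LinearMap.det_comp, hTd]
  have h1 : sInf S ≤ G (T ∘ₗ A) := csInf_le hbd ⟨_, by rw [hdet]; positivity, rfl⟩
  have h2 : G A < 2 * G (T ∘ₗ A) := by linarith
  have hd : 0 < |LinearMap.det A| ^ h := by positivity
  have h3 : ∏ x ∈ X', ‖A (v x)‖ ≤ 2 * 2 ^ h * ∏ x ∈ X', ‖T (A (v x))‖ := by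
    simp only [hG, hdet, abs_mul, mul_pow] at h2
    rw [div_lt_iff₀ hd] at h2
    refine h2.le.trans_eq ?_
    simp only [LinearMap.comp_apply]
    have : |(1 / 2 : ℝ)| ^ h = (2 ^ h)⁻¹ := by rw [abs_of_pos (by norm_num)]; simp
    rw [this, mul_comm ((2 ^ h : ℝ)⁻¹), ← div_div, div_inv_eq_mul]
    have h9 : ∀ p d q : ℝ, 0 < d → 2 * (p / d * q) * d = 2 * q * p := by
      intro p d q hd; field_simp
    exact h9 _ _ _ hd
  exact isot_aux h hh X' t (fun x => ‖A (v x)‖) (fun x => ‖T (A (v x))‖) ht1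
    (fun x hx => norm_pos_iff.2 (hA0 x hx)) hTn h3

end iso
end LST

namespace LST
open Polynomial Set Filter Topology MeasureTheory

section sep
variable {ι : Type} [Fintype ι]

theorem hyp_null (w : EuclideanSpace ℝ ι) (hw : w ≠ 0) :
    volume {g : EuclideanSpace ℝ ι | inner ℝ w g = 0} = 0 := by
  have h := Measure.addHaar_submodule (volume : Measure (EuclideanSpace ℝ ι))
    (LinearMap.ker (innerₗ (EuclideanSpace ℝ ι) w)) (by
      intro h
      have : w ∈ LinearMap.ker (innerₗ (EuclideanSpace ℝ ι) w) := by rw [h]; trivial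
      rw [LinearMap.mem_ker] at this
      exact hw (inner_self_eq_zero.1 this))
  refine measure_mono_null ?_ h
  intro g hg
  exact hg

theorem pres (f : EuclideanSpace ℝ ι ≃ₗᵢ[ℝ] EuclideanSpace ℝ ι) (Q : Set (EuclideanSpace ℝ ι)) (hQ : MeasurableSet Q) :
    volume (Metric.ball 0 1 ∩ f ⁻¹' Q) = volume (Metric.ball 0 1 ∩ Q) := by
  rw [← f.measurePreserving.measure_preimage (Metric.isOpen_ball.measurableSet.inter hQ).nullMeasurableSet]
  congr 1
  ext g
  simp

theorem refl_in (u g w : EuclideanSpace ℝ ι) : inner ℝ w ((ℝ ∙ u).reflection g) =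
    2 * (inner ℝ u g / ‖u‖ ^ 2) * inner ℝ w u - inner ℝ w g := by
  rw [Submodule.reflection_singleton_apply, inner_sub_right, two_smul, inner_add_right, inner_smul_right]
  simp
  ring

theorem quarter (e1 e2 : EuclideanSpace ℝ ι) (h1 : ‖e1‖ = 1) (h2 : ‖e2‖ = 1) (h12 : inner ℝ e1 e2 = 0) :
    volume (Metric.ball (0 : EuclideanSpace ℝ ι) 1) ≤ 4 * volume (Metric.ball 0 1 ∩
      {g | inner ℝ e1 g * inner ℝ e2 g < 0 ∧ |inner ℝ e1 g| < |inner ℝ e2 g|}) := by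
  set Q : Set (EuclideanSpace ℝ ι) := {g | inner ℝ e1 g * inner ℝ e2 g < 0 ∧ |inner ℝ e1 g| < |inner ℝ e2 g|} with hQ
  have hQm : MeasurableSet Q := by
    have h1 : IsOpen {g : EuclideanSpace ℝ ι | inner ℝ e1 g * inner ℝ e2 g < 0} := isOpen_lt (by fun_prop) (by fun_prop)
    have h2 : IsOpen {g : EuclideanSpace ℝ ι | |inner ℝ e1 g| < |inner ℝ e2 g|} := isOpen_lt (by fun_prop) (by fun_prop)
    exact (h1.inter h2).measurableSet
  set s : EuclideanSpace ℝ ι ≃ₗᵢ[ℝ] EuclideanSpace ℝ ι := (ℝ ∙ e2).reflection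
  set t : EuclideanSpace ℝ ι ≃ₗᵢ[ℝ] EuclideanSpace ℝ ι := (ℝ ∙ (e1 + e2)).reflection
  have h21 : inner ℝ e2 e1 = 0 := by rw [real_inner_comm]; exact h12
  have h11 : inner ℝ e1 e1 = 1 := by rw [real_inner_self_eq_norm_sq, h1]; norm_num
  have h22 : inner ℝ e2 e2 = 1 := by rw [real_inner_self_eq_norm_sq, h2]; norm_num
  have hn : ‖e1 + e2‖ ^ 2 = 2 := by
    rw [← real_inner_self_eq_norm_sq]; simp only [inner_add_left, inner_add_right, h11, h22, h12, h21]; norm_num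
  have s1 : ∀ g, inner ℝ e1 (s g) = - inner ℝ e1 g := fun g => by
    rw [refl_in, h12]; ring
  have s2 : ∀ g, inner ℝ e2 (s g) = inner ℝ e2 g := fun g => by
    rw [refl_in, h2, h22]; ring
  have t1 : ∀ g, inner ℝ e1 (t g) = inner ℝ e2 g := fun g => by
    rw [refl_in, hn, inner_add_left, inner_add_right, h11, h12]; ring
  have t2 : ∀ g, inner ℝ e2 (t g) = inner ℝ e1 g := fun g => by
    rw [refl_in, hn, inner_add_left, inner_add_right, h22, h21]; ring
  have hne : ∀ w : EuclideanSpace ℝ ι, inner ℝ e1 w ≠ 0 → w ≠ 0 := by rintro w h rfl; simp at h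
  set N : Set (EuclideanSpace ℝ ι) := ({g | inner ℝ e1 g = 0} ∪ {g | inner ℝ e2 g = 0}) ∪
    ({g | inner ℝ (e1 + e2) g = 0} ∪ {g | inner ℝ (e1 - e2) g = 0}) with hN
  have hN0 : volume N = 0 := by
    refine measure_union_null (measure_union_null (hyp_null _ ?_) (hyp_null _ ?_))
      (measure_union_null (hyp_null _ ?_) (hyp_null _ ?_))
    · rintro rfl; simp at h1
    · rintro rfl; simp at h2
    · apply hne; rw [inner_add_right, h11, h12]; norm_num
    · apply hne; rw [inner_sub_right, h11, h12]; norm_num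
  have hsub : Metric.ball (0 : EuclideanSpace ℝ ι) 1 ⊆ N ∪ (((Metric.ball 0 1 ∩ Q) ∪ (Metric.ball 0 1 ∩ s ⁻¹' Q)) ∪
      ((Metric.ball 0 1 ∩ t ⁻¹' Q) ∪ (Metric.ball 0 1 ∩ t ⁻¹' (s ⁻¹' Q)))) := by
    intro g hg
    by_cases hgN : g ∈ N
    · exact Or.inl hgN
    right
    simp only [hN, Set.mem_union, Set.mem_ofPred_eq, not_or, inner_add_left, inner_sub_left] at hgN
    simp only [Set.mem_union, Set.mem_inter_iff, hg, true_and, Set.mem_preimage, hQ, Set.mem_ofPred_eq, s1, s2, t1, t2, abs_neg]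
    generalize inner ℝ e1 g = a at *
    generalize inner ℝ e2 g = b at *
    obtain ⟨⟨ha, hb⟩, hab, hab'⟩ := hgN
    have h3 : |a| ≠ |b| := by
      intro h
      rcases abs_eq_abs.1 h with h | h
      · exact hab' (by linarith)
      · exact hab (by linarith)
    have h4 : a * b ≠ 0 := mul_ne_zero ha hb
    rcases lt_or_gt_of_ne h3 with h5 | h5 <;> rcases lt_or_gt_of_ne h4 with h6 | h6
    · left; left; exact ⟨h6, h5⟩
    · left; right; exact ⟨by linarith, h5⟩
    · right; left; exact ⟨by linarith, h5⟩
    · right; right; exact ⟨by linarith, h5⟩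
  refine (measure_mono hsub).trans ?_
  refine (measure_union_le _ _).trans ?_
  rw [hN0, zero_add]
  refine (measure_union_le _ _).trans ?_
  refine (add_le_add (measure_union_le _ _) (measure_union_le _ _)).trans ?_
  rw [pres t _ hQm, pres s _ hQm, pres t (s ⁻¹' Q) (s.continuous.measurable hQm), pres s _ hQm]
  apply le_of_eq
  ring

theorem sepm (u w : EuclideanSpace ℝ ι) (h1 : ‖u‖ = 1) (h2 : ‖w‖ = 1) (h12 : (inner ℝ u w) ^ 2 ≤ (1 : ℝ) / 2) :
    volume (Metric.ball (0 : EuclideanSpace ℝ ι) 1) ≤ 4 * volume (Metric.ball 0 1 ∩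
      {g : EuclideanSpace ℝ ι | inner ℝ u g * inner ℝ w g < 0}) := by
  set r : ℝ := inner ℝ u w with hr
  set s : ℝ := Real.sqrt (1 - r ^ 2) with hs
  have hs2 : s ^ 2 = 1 - r ^ 2 := Real.sq_sqrt (by linarith)
  have hs0 : 0 < s := Real.sqrt_pos.2 (by linarith)
  have hrs : r ≤ s := by
    apply le_of_abs_le
    rw [← abs_of_pos hs0]
    exact sq_le_sq.1 (by linarith)
  have huu : inner ℝ u u = (1 : ℝ) := by rw [real_inner_self_eq_norm_sq, h1]; norm_num
  have hww : inner ℝ w w = (1 : ℝ) := by rw [real_inner_self_eq_norm_sq, h2]; norm_num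
  have hwu : inner ℝ w u = r := by rw [real_inner_comm]
  have he : ‖s⁻¹ • (w - r • u)‖ = 1 := by
    have : ‖s⁻¹ • (w - r • u)‖ ^ 2 = 1 := by
      rw [← real_inner_self_eq_norm_sq]
      simp only [inner_smul_left, inner_smul_right, inner_sub_left, inner_sub_right, huu, hww, hwu, ← hr]
      simp
      field_simp
      linarith
    exact (pow_eq_one_iff_of_nonneg (norm_nonneg _) two_ne_zero).1 this
  have ho : inner ℝ u (s⁻¹ • (w - r • u)) = 0 := by
    simp only [inner_smul_right, inner_sub_right, huu, ← hr]; ring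
  refine (quarter u _ h1 he ho).trans ?_
  refine mul_le_mul_right (measure_mono (Set.inter_subset_inter_right _ ?_)) _
  intro g hg
  simp only [Set.mem_ofPred_eq, inner_smul_left, inner_sub_left] at hg ⊢
  simp only [conj_trivial] at hg
  generalize inner ℝ u g = a at *
  generalize inner ℝ w g = c at *
  set b := s⁻¹ * (c - r * a) with hb
  have hc : c = r * a + s * b := by rw [hb]; field_simp; ring
  obtain ⟨h3, h4⟩ := hg
  have h5 : a * b = - (|a| * |b|) := by rw [← abs_mul, abs_of_neg h3]; ring
  have h6 : a ^ 2 = |a| * |a| := by rw [← sq, sq_abs]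
  have ha : 0 < |a| := abs_pos.2 (by rintro rfl; simp at h3)
  rw [hc]
  have h7 : a * (r * a + s * b) = r * a ^ 2 + s * (a * b) := by ring
  rw [h7, h5, h6]
  nlinarith [mul_pos ha (mul_pos hs0 (sub_pos.2 h4)), mul_nonneg (mul_nonneg ha.le ha.le) (sub_nonneg.2 hrs)]

end sep
end LST

namespace LST
open Polynomial Set Filter Topology MeasureTheory

section avg
variable {ι : Type} [Fintype ι]

theorem avg {α : Type} (u : α → EuclideanSpace ℝ ι) (X' : Finset α) (hu : ∀ x ∈ X', ‖u x‖ = 1)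
    (P : Finset (α × α)) (hP : ∀ p ∈ P, p.1 ∈ X' ∧ p.2 ∈ X' ∧ (inner ℝ (u p.1) (u p.2)) ^ 2 ≤ (1 : ℝ) / 2) :
    ∃ g : EuclideanSpace ℝ ι, (∀ x ∈ X', inner ℝ (u x) g ≠ (0 : ℝ)) ∧
      P.card ≤ 4 * (P.filter (fun p => inner ℝ (u p.1) g * inner ℝ (u p.2) g < (0 : ℝ))).card := by
  classical
  by_contra hcon
  push Not at hcon
  set B := Metric.ball (0 : EuclideanSpace ℝ ι) 1 with hB
  set μ := (volume : Measure (EuclideanSpace ℝ ι)).restrict B with hμ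
  set S : α × α → Set (EuclideanSpace ℝ ι) := fun p => {g | inner ℝ (u p.1) g * inner ℝ (u p.2) g < (0 : ℝ)} with hS
  have hSo : ∀ p, MeasurableSet (S p) := fun p =>
    (isOpen_lt (by fun_prop) (by fun_prop) : IsOpen {g : EuclideanSpace ℝ ι |
      inner ℝ (u p.1) g * inner ℝ (u p.2) g < (0 : ℝ)}).measurableSet
  have hae : ∀ᵐ g ∂μ, (∑ p ∈ P, 4 * (S p).indicator (fun _ => (1 : ENNReal)) g) + 1 ≤ P.card := by
    have h0 : ∀ᵐ g ∂μ, ∀ x ∈ X', inner ℝ (u x) g ≠ (0 : ℝ) := by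
      refine (ae_restrict_of_ae ?_)
      rw [Filter.eventually_all_finset]
      intro x hx
      exact (compl_mem_ae_iff.2 (hyp_null (u x) (by
        intro h; have := hu x hx; rw [h] at this; simp at this)))
    filter_upwards [h0] with g hg
    have h1 := hcon g hg
    have h2 : ∑ p ∈ P, 4 * (S p).indicator (fun _ => (1 : ENNReal)) g =
        ((4 * (P.filter (fun p => inner ℝ (u p.1) g * inner ℝ (u p.2) g < (0 : ℝ))).card : ℕ) : ENNReal) := by
      rw [← Finset.mul_sum, Nat.cast_mul, Finset.card_filter]
      push_cast
      congr 1
    rw [h2]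
    exact_mod_cast h1
  have h1 := lintegral_mono_ae hae
  rw [lintegral_const, lintegral_add_right _ measurable_const, lintegral_const,
    lintegral_finsetSum _ (fun p _ => (measurable_const.indicator (hSo p)).const_mul 4)] at h1
  have h2 : ∀ p ∈ P, volume B ≤ ∫⁻ g, 4 * (S p).indicator (fun _ => (1 : ENNReal)) g ∂μ := by
    intro p hp
    rw [lintegral_const_mul _ (measurable_const.indicator (hSo p)), lintegral_indicator (hSo p)]
    simp only [lintegral_const, one_mul]
    rw [Measure.restrict_apply_univ, hμ, Measure.restrict_apply (hSo p), Set.inter_comm]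
    obtain ⟨a1, a2, a3⟩ := hP p hp
    exact sepm _ _ (hu _ a1) (hu _ a2) a3
  have h3 := Finset.card_nsmul_le_sum P _ _ h2
  have hμu : μ Set.univ = volume B := by rw [hμ, Measure.restrict_apply_univ]
  rw [hμu, one_mul] at h1
  rw [nsmul_eq_mul] at h3
  have hpos : volume B ≠ 0 := (Metric.measure_ball_pos _ _ one_pos).ne'
  have hfin : volume B ≠ ⊤ := measure_ball_lt_top.ne
  have h4 := (add_le_add_left h3 (volume B)).trans h1
  have h5 : (P.card : ENNReal) * volume B ≠ ⊤ := ENNReal.mul_ne_top (by simp) hfin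
  exact absurd h4 (not_le.2 (ENNReal.lt_add_right h5 hpos))

theorem avgl {α : Type} (u : α → EuclideanSpace ℝ ι) (X' : Finset α) (hu : ∀ x ∈ X', ‖u x‖ = 1) (l : ℕ) :
    ∀ (P : Finset (α × α)), (∀ p ∈ P, p.1 ∈ X' ∧ p.2 ∈ X' ∧ (inner ℝ (u p.1) (u p.2)) ^ 2 ≤ (1 : ℝ) / 2) →
    ∃ g : Fin l → EuclideanSpace ℝ ι, (∀ j, ∀ x ∈ X', inner ℝ (u x) (g j) ≠ (0 : ℝ)) ∧
      4 ^ l * (P.filter (fun p => ∀ j, ¬ inner ℝ (u p.1) (g j) * inner ℝ (u p.2) (g j) < (0 : ℝ))).card ≤ 3 ^ l * P.card := by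
  classical
  induction l with
  | zero => 
    intro P hP
    exact ⟨fun j => j.elim0, fun j => j.elim0, by simp [Finset.card_filter_le]⟩
  | succ l ih =>
    intro P hP
    obtain ⟨g0, h0, h1⟩ := avg u X' hu P hP
    obtain ⟨g, h2, h3⟩ := ih (P.filter (fun p => ¬ inner ℝ (u p.1) g0 * inner ℝ (u p.2) g0 < (0 : ℝ)))
      (fun p hp => hP p (Finset.mem_filter.1 hp).1)
    refine ⟨Fin.cons g0 g, fun j => ?_, ?_⟩
    · refine Fin.cases ?_ (fun j => ?_) j
      · simpa using h0
      · simpa using h2 j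
    · have h4 := Finset.card_filter_add_card_filter_not (s := P) (fun p => inner ℝ (u p.1) g0 * inner ℝ (u p.2) g0 < (0 : ℝ))
      rw [Finset.filter_filter] at h3
      simp only [Fin.forall_fin_succ, Fin.cons_zero, Fin.cons_succ]
      have h5 : 4 * (P.filter (fun p => ¬ inner ℝ (u p.1) g0 * inner ℝ (u p.2) g0 < (0 : ℝ))).card ≤ 3 * P.card := by omega
      calc _ = 4 * (4 ^ l * _) := by rw [pow_succ]; ring
        _ ≤ 4 * (3 ^ l * _) := Nat.mul_le_mul_left _ h3
        _ = 3 ^ l * (4 * _) := by ring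
        _ ≤ 3 ^ l * (3 * P.card) := Nat.mul_le_mul_left _ h5
        _ = _ := by rw [pow_succ]; ring

end avg

def vec {D : ℕ} (x : R4) : EuclideanSpace ℝ (Fin 4 → Fin (D + 1)) := WithLp.toLp 2 (fun m => ∏ i, x i ^ (m i).val)

theorem ev_vec {D : ℕ} (w : EuclideanSpace ℝ (Fin 4 → Fin (D + 1))) (x : R4) : ev (fun m => w m) x = inner ℝ (vec x) w := by
  rw [PiLp.inner_apply]
  unfold ev vec
  refine Finset.sum_congr rfl fun m _ => ?_
  simp

theorem parti (D l : ℕ) (X : Finset R4) : ∃ X' ⊆ X, (∃ g : Co D, g ≠ 0 ∧ ∀ x ∈ X \ X', ev g x = 0) ∧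
    ∃ c : Fin l → Co D, (∀ j, ∀ x ∈ X', ev (c j) x ≠ 0) ∧
    (((X' ×ˢ X').filter (fun p => ∀ j, SignType.sign (ev (c j) p.1) = SignType.sign (ev (c j) p.2))).card : ℝ) ≤
      (8 / (D + 1) ^ 4 + (3 / 4) ^ l) * (X'.card : ℝ) ^ 2 := by
  classical
  obtain ⟨h, X', hX', hc, ⟨g, hg0, hg⟩, hv, c, hc0, hcA⟩ := greedy (vec (D := D)) X
  have hcard : Fintype.card (Fin 4 → Fin (D + 1)) = (D + 1) ^ 4 := by simp
  rw [hcard] at hc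
  refine ⟨X', hX', ?_, ?_⟩
  · set w := (InnerProductSpace.toDual ℝ (EuclideanSpace ℝ (Fin 4 → Fin (D + 1)))).symm (LinearMap.toContinuousLinearMap g) with hw
    have hgw : ∀ y, inner ℝ w y = g y := by
      intro y; rw [hw, InnerProductSpace.toDual_symm_apply]; rfl
    refine ⟨fun m => w m, ?_, fun x hx => ?_⟩
    · intro h0
      apply hg0
      ext y
      rw [← hgw]
      have : w = 0 := by ext m; exact congrFun h0 m
      simp [this]
    · rw [ev_vec, real_inner_comm, hgw, hg x hx]
  rcases Nat.eq_zero_or_pos h with rfl | hh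
  · have : X' = ∅ := by simpa using hc
    subst this
    exact ⟨fun _ => 0, by simp, by simp⟩
  obtain ⟨A, hA0, hA⟩ := isot (vec (D := D)) h hh X' hv c hc0 hcA
  set u : R4 → EuclideanSpace ℝ (Fin 4 → Fin (D + 1)) := fun x => ‖A (vec x)‖⁻¹ • A (vec x) with hu
  have hu1 : ∀ x ∈ X', ‖u x‖ = 1 := fun x hx => norm_smul_inv_norm (𝕜 := ℝ) (hA0 x hx)
  set P := (X' ×ˢ X').filter (fun p => (inner ℝ (u p.1) (u p.2)) ^ 2 ≤ (1 : ℝ) / 2) with hP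
  set P2 := (X' ×ˢ X').filter (fun p => ¬ (inner ℝ (u p.1) (u p.2)) ^ 2 ≤ (1 : ℝ) / 2) with hP2
  obtain ⟨G, hG0, hG⟩ := avgl u X' hu1 l P (by
    intro p hp
    rw [hP, Finset.mem_filter, Finset.mem_product] at hp
    exact ⟨hp.1.1, hp.1.2, hp.2⟩)
  set cc : Fin l → Co D := fun j m => (LinearMap.adjoint A (G j)) m with hcc
  have hcv : ∀ j x, ev (cc j) x = inner ℝ (A (vec x)) (G j) := by
    intro j x
    rw [hcc, ev_vec, LinearMap.adjoint_inner_right]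
  have hcu : ∀ j x, inner ℝ (u x) (G j) = ‖A (vec x)‖⁻¹ * ev (cc j) x := by
    intro j x
    rw [hcv, hu]
    simp [inner_smul_left]
  refine ⟨cc, fun j x hx h0 => hG0 j x hx (by rw [hcu, h0, mul_zero]), ?_⟩
  have hP2c : (P2.card : ℝ) ≤ 8 * h * X'.card := by
    have h1 : (P2.card : ℝ) * (1 / 2) ≤ ∑ p ∈ X' ×ˢ X', (inner ℝ (u p.1) (u p.2)) ^ 2 := by
      refine le_trans ?_ (Finset.sum_le_sum_of_subset_of_nonneg (Finset.filter_subset (fun p => ¬ (inner ℝ (u p.1) (u p.2)) ^ 2 ≤ (1 : ℝ) / 2) _)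
        (fun _ _ _ => sq_nonneg _))
      rw [← nsmul_eq_mul]
      refine Finset.card_nsmul_le_sum _ _ _ ?_
      intro p hp
      exact (not_le.1 (Finset.mem_filter.1 hp).2).le
    rw [Finset.sum_product] at h1
    have h2 : ∑ x ∈ X', ∑ y ∈ X', (inner ℝ (u x) (u y)) ^ 2 ≤ ∑ x ∈ X', 4 * (h : ℝ) :=
      Finset.sum_le_sum fun x hx => hA (u x) (hu1 x hx)
    rw [Finset.sum_const, nsmul_eq_mul] at h2
    linarith
  have hsub : (X' ×ˢ X').filter (fun p => ∀ j, SignType.sign (ev (cc j) p.1) = SignType.sign (ev (cc j) p.2)) ⊆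
      P2 ∪ P.filter (fun p => ∀ j, ¬ inner ℝ (u p.1) (G j) * inner ℝ (u p.2) (G j) < (0 : ℝ)) := by
    intro p hp
    rw [Finset.mem_filter] at hp
    rw [Finset.mem_union]
    by_cases hq : (inner ℝ (u p.1) (u p.2)) ^ 2 ≤ (1 : ℝ) / 2
    · right
      refine Finset.mem_filter.2 ⟨Finset.mem_filter.2 ⟨hp.1, hq⟩, fun j hj => ?_⟩
      rw [hcu, hcu] at hj
      have h3 : ev (cc j) p.1 * ev (cc j) p.2 < 0 := by
        by_contra h4
        push Not at h4
        have : 0 ≤ ‖A (vec p.1)‖⁻¹ * ‖A (vec p.2)‖⁻¹ * (ev (cc j) p.1 * ev (cc j) p.2) := by positivity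
        linarith
      have h4 := sign_neg h3
      rw [sign_mul, hp.2 j] at h4
      generalize SignType.sign (ev (cc j) p.2) = s at h4
      revert s; decide
    · left; exact Finset.mem_filter.2 ⟨hp.1, hq⟩
  have h1 := (Finset.card_le_card hsub).trans (Finset.card_union_le _ _)
  have h2 : ((X' ×ˢ X').filter (fun p => ∀ j, SignType.sign (ev (cc j) p.1) = SignType.sign (ev (cc j) p.2))).card ≤
      (P2.card : ℝ) + (P.filter (fun p => ∀ j, ¬ inner ℝ (u p.1) (G j) * inner ℝ (u p.2) (G j) < (0 : ℝ))).card := by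
    exact_mod_cast h1
  have h3 : (P.card : ℝ) ≤ (X'.card : ℝ) ^ 2 := by
    have := Finset.card_le_card (Finset.filter_subset (fun p => (inner ℝ (u p.1) (u p.2)) ^ 2 ≤ (1 : ℝ) / 2) (X' ×ˢ X'))
    rw [Finset.card_product, ← sq] at this
    exact_mod_cast this
  have h4 : (4 : ℝ) ^ l * (P.filter (fun p => ∀ j, ¬ inner ℝ (u p.1) (G j) * inner ℝ (u p.2) (G j) < (0 : ℝ))).card ≤ 3 ^ l * P.card := by
    exact_mod_cast hG
  have h5 : ((P.filter (fun p => ∀ j, ¬ inner ℝ (u p.1) (G j) * inner ℝ (u p.2) (G j) < (0 : ℝ))).card : ℝ) ≤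
      (3 / 4) ^ l * (X'.card : ℝ) ^ 2 := by
    rw [div_pow, div_mul_eq_mul_div, le_div_iff₀ (by positivity)]
    calc _ ≤ (3 : ℝ) ^ l * P.card := by linarith
      _ ≤ _ := by gcongr
  have h6 : (X'.card : ℝ) = h * ((D : ℝ) + 1) ^ 4 := by rw [hc]; push_cast; ring
  have h7 : (8 : ℝ) * h * X'.card = 8 / (D + 1) ^ 4 * (X'.card : ℝ) ^ 2 := by
    rw [h6]; field_simp
  rw [add_mul]
  linarith

end LST

namespace LST
open Set Filter Topology
open MvPolynomial in
theorem degreeOf_pd (p : MvPolynomial (Fin 3) ℝ) (i j : Fin 3) : degreeOf j (pderiv i p) ≤ degreeOf j p := by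
  rw [degreeOf_eq_sup]
  refine Finset.sup_le fun m hm => ?_
  rw [mem_support_iff, coeff_pderiv] at hm
  have := monomial_le_degreeOf j (mem_support_iff.2 (left_ne_zero_of_mul hm))
  simp at this
  omega

open MvPolynomial in
theorem deriv_pd (p : MvPolynomial (Fin 3) ℝ) (i : Fin 3) (x : Fin 3 → ℝ) (t : ℝ) :
    HasDerivAt (fun s => eval (Function.update x i s) p) (eval (Function.update x i t) (pderiv i p)) t := by
  induction p using MvPolynomial.induction_on with
  | C a => simpa using hasDerivAt_const t a
  | add p q hp hq =>
    simp only [map_add]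
    exact hp.add hq
  | mul_X p j hp =>
    rw [pderiv_mul]
    simp only [map_mul, map_add, eval_X]
    refine hp.mul (d := fun s => Function.update x i s j) ?_
    by_cases h : j = i
    · subst h
      simp only [Function.update_self, pderiv_X_self, map_one]
      exact hasDerivAt_id t
    · simp only [Function.update_of_ne h, pderiv_X_of_ne h, map_zero]
      exact hasDerivAt_const t _

open MvPolynomial in
theorem dep (d B : ℕ) (hB : B = (3 * d + 1) ^ 3) (g : Fin 3 → MvPolynomial (Fin 3) ℝ)
    (hg : ∀ i j, degreeOf j (g i) ≤ d) (ℓ : MvPolynomial (Fin 3) ℝ) (hl : ∀ j, degreeOf j ℓ ≤ 1) :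
    ∃ G : Fin (B + 1) → MvPolynomial (Fin 3) ℝ, G ≠ 0 ∧ ∀ x : Fin 3 → ℝ,
      ∑ b, eval (fun i => eval x (g i)) (G b) * (eval x ℓ) ^ b.val = 0 := by
  classical
  set m := 3 * B * d + B with hm
  set T := (Fin 3 → Fin (B + 1)) × Fin (B + 1) with hT
  set pol : T → MvPolynomial (Fin 3) ℝ := fun t => (∏ i, g i ^ (t.1 i).val) * ℓ ^ t.2.val with hpol
  have hpd : ∀ t j, degreeOf j (pol t) ≤ m := by
    intro t j
    refine (degreeOf_mul_le _ _ _).trans ?_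
    refine add_le_add ((degreeOf_prod_le _ _ _).trans ?_) ((degreeOf_pow_le _ _ _).trans ?_)
    · calc ∑ i, degreeOf j (g i ^ (t.1 i).val) ≤ ∑ i : Fin 3, B * d := by
            refine Finset.sum_le_sum fun i _ => (degreeOf_pow_le _ _ _).trans ?_
            exact Nat.mul_le_mul (Nat.lt_succ_iff.1 (t.1 i).2) (hg i j)
        _ = _ := by simp; ring
    · calc t.2.val * degreeOf j ℓ ≤ B * 1 := Nat.mul_le_mul (Nat.lt_succ_iff.1 t.2.2) (hl j)
        _ = B := by ring
  let ψ : (T → ℝ) →ₗ[ℝ] ((Fin 3 → Fin (m + 1)) → ℝ) :=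
    { toFun := fun F e => ∑ t, F t * coeff (Finsupp.equivFunOnFinite.symm (fun i => (e i).val)) (pol t)
      map_add' := fun F F' => by ext e; simp [add_mul, Finset.sum_add_distrib]
      map_smul' := fun a F => by ext e; simp [Finset.mul_sum, mul_assoc] }
  have hker : LinearMap.ker ψ ≠ ⊥ := by
    apply LinearMap.ker_ne_bot_of_finrank_lt
    rw [Module.finrank_pi, Module.finrank_pi]
    simp only [hT, Fintype.card_prod, Fintype.card_fun, Fintype.card_fin]
    have h1 : m + 1 ≤ (B + 1) * (3 * d + 1) := by rw [hm]; nlinarith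
    calc (m + 1) ^ 3 ≤ ((B + 1) * (3 * d + 1)) ^ 3 := Nat.pow_le_pow_left h1 3
      _ = (B + 1) ^ 3 * B := by rw [mul_pow, ← hB]
      _ < (B + 1) ^ 3 * (B + 1) := by
        apply Nat.mul_lt_mul_of_pos_left (Nat.lt_succ_self B) (by positivity)
  obtain ⟨F, hF, hF0⟩ := Submodule.exists_mem_ne_zero_of_ne_bot hker
  have hz : ∑ t, C (F t) * pol t = 0 := by
    ext e
    rw [coeff_zero]
    by_cases he : ∀ i, e i ≤ m
    · have h1 := congrFun (LinearMap.mem_ker.1 hF) (fun i => ⟨e i, Nat.lt_succ_iff.2 (he i)⟩)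
      have h2 : (Finsupp.equivFunOnFinite.symm (fun i => e i)) = e := by ext i; simp
      simp only [ψ, LinearMap.coe_mk, AddHom.coe_mk, Pi.zero_apply, h2] at h1
      rw [← h1, coeff_sum]
      simp
    · push Not at he
      obtain ⟨i, hi⟩ := he
      by_contra hne
      have h3 := monomial_le_degreeOf i (mem_support_iff.2 hne)
      have h4 : degreeOf i (∑ t, C (F t) * pol t) ≤ m := by
        refine (degreeOf_sum_le _ _ _).trans (Finset.sup_le fun t _ => ?_)
        exact (degreeOf_C_mul_le _ _ _).trans (hpd t i)
      omega
  refine ⟨fun b => ∑ α : Fin 3 → Fin (B + 1), monomial (Finsupp.equivFunOnFinite.symm (fun i => (α i).val)) (F (α, b)), ?_, ?_⟩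
  · intro h0
    apply hF0
    ext ⟨α, b⟩
    have h1 := congrArg (coeff (Finsupp.equivFunOnFinite.symm (fun i => (α i).val))) (congrFun h0 b)
    simp only [coeff_sum, coeff_monomial, Pi.zero_apply, coeff_zero] at h1
    rw [Finset.sum_eq_single α] at h1
    · simpa using h1
    · intro α' _ hne
      rw [if_neg]
      intro h
      apply hne
      have := Finsupp.equivFunOnFinite.symm.injective h
      ext i
      exact congrFun this i
    · simp
  · intro x
    have h1 := congrArg (eval x) hz
    simp only [map_sum, map_mul, eval_C, map_zero, hpol, map_prod, map_pow] at h1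
    rw [← h1, Fintype.sum_prod_type_right]
    refine Finset.sum_congr rfl fun b _ => ?_
    rw [map_sum, Finset.sum_mul]
    refine Finset.sum_congr rfl fun α _ => ?_
    rw [eval_monomial, Finsupp.prod_fintype _ _ (by simp)]
    simp
    ring

end LST

namespace LST
open Set Filter Topology

open MvPolynomial in
/-- the bump polynomial -/
def Phi {l : ℕ} (Q : Fin l → MvPolynomial (Fin 3) ℝ) (R : ℝ) : MvPolynomial (Fin 3) ℝ :=
  (∏ k, Q k) ^ 2 * (C R - ∑ i, X i ^ 2)

open MvPolynomial in
theorem Phi_eval {l : ℕ} (Q : Fin l → MvPolynomial (Fin 3) ℝ) (R : ℝ) (x : Fin 3 → ℝ) :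
    eval x (Phi Q R) = (∏ k, eval x (Q k)) ^ 2 * (R - ∑ i, x i ^ 2) := by
  simp [Phi, map_prod]

open MvPolynomial in
theorem Phi_deg {l : ℕ} (Q : Fin l → MvPolynomial (Fin 3) ℝ) (R : ℝ) (e : ℕ) (hQ : ∀ k j, degreeOf j (Q k) ≤ e)
    (j : Fin 3) : degreeOf j (Phi Q R) ≤ 2 * (l * e) + 2 := by
  refine (degreeOf_mul_le _ _ _).trans (add_le_add ((degreeOf_pow_le _ _ _).trans ?_) ?_)
  · refine Nat.mul_le_mul_left _ ((degreeOf_prod_le _ _ _).trans ?_)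
    calc _ ≤ ∑ k : Fin l, e := Finset.sum_le_sum fun k _ => hQ k j
      _ = _ := by simp
  · refine (degreeOf_sub_le _ _ _).trans (max_le (by simp) ((degreeOf_sum_le _ _ _).trans (Finset.sup_le fun i _ => ?_)))
    refine (degreeOf_pow_le _ _ _).trans ?_
    rw [degreeOf_X]
    split_ifs <;> simp

open MvPolynomial in
theorem intmax {l : ℕ} (Q : Fin l → MvPolynomial (Fin 3) ℝ) (R δ : ℝ) (hR : 1 ≤ R) (a p : Fin 3 → ℝ)
    (ha : ∀ i, |a i| ≤ δ) (hp : ∑ i, p i ^ 2 ≤ R) (hδ : 6 * δ * R < eval p (Phi Q R)) :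
    ∃ x : Fin 3 → ℝ, (∀ k, SignType.sign (eval x (Q k)) = SignType.sign (eval p (Q k))) ∧
      ∀ i, eval x (pderiv i (Phi Q R)) = - a i := by
  have hδ0 : 0 ≤ δ := (abs_nonneg _).trans (ha 0)
  have hpQ : ∀ k, eval p (Q k) ≠ 0 := by
    intro k h0
    rw [Phi_eval, Finset.prod_eq_zero (Finset.mem_univ k) h0] at hδ
    have : 0 ≤ 6 * δ * R := by positivity
    simp at hδ
    linarith
  set Ψ := Phi Q R + ∑ i, C (a i) * X i with hΨ
  have hΨe : ∀ x, eval x Ψ = eval x (Phi Q R) + ∑ i, a i * x i := by intro x; simp [hΨ]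
  set K : Set (Fin 3 → ℝ) := {x | (∀ k, 0 ≤ eval x (Q k) * eval p (Q k)) ∧ ∑ i, x i ^ 2 ≤ R} with hK
  set U : Set (Fin 3 → ℝ) := {x | (∀ k, 0 < eval x (Q k) * eval p (Q k)) ∧ ∑ i, x i ^ 2 < R} with hU
  have hbx : ∀ x : Fin 3 → ℝ, ∑ i, x i ^ 2 ≤ R → ∀ i, |x i| ≤ R := by
    intro x hx i
    have h1 : x i ^ 2 ≤ R := (Finset.single_le_sum (f := fun i => x i ^ 2) (fun _ _ => sq_nonneg _) (Finset.mem_univ i)).trans hx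
    exact abs_le_of_sq_le_sq (by nlinarith) (by linarith)
  have hlin : ∀ x : Fin 3 → ℝ, ∑ i, x i ^ 2 ≤ R → |∑ i, a i * x i| ≤ 3 * δ * R := by
    intro x hx
    refine (Finset.abs_sum_le_sum_abs _ _).trans ?_
    calc _ ≤ ∑ i : Fin 3, δ * R := Finset.sum_le_sum fun i _ => by
            rw [abs_mul]; exact mul_le_mul (ha i) (hbx x hx i) (abs_nonneg _) hδ0
      _ = _ := by simp; ring
  have hKc : IsCompact K := by
    refine IsCompact.of_isClosed_subset (isCompact_univ_pi (fun _ : Fin 3 => isCompact_Icc (a := -R) (b := R))) ?_ ?_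
    · have h1 : IsClosed {x : Fin 3 → ℝ | ∀ k, 0 ≤ eval x (Q k) * eval p (Q k)} := by
        have : {x : Fin 3 → ℝ | ∀ k, 0 ≤ eval x (Q k) * eval p (Q k)} = ⋂ k, {x | 0 ≤ eval x (Q k) * eval p (Q k)} := by
          ext x; simp
        rw [this]
        exact isClosed_iInter fun k => isClosed_le continuous_const ((continuous_eval (Q k)).mul continuous_const)
      have h2 : IsClosed {x : Fin 3 → ℝ | ∑ i, x i ^ 2 ≤ R} := isClosed_le (by fun_prop) continuous_const
      exact h1.inter h2
    · intro x hx i _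
      exact abs_le.1 (hbx x hx.2 i)
  have hUo : IsOpen U := by
    have h1 : IsOpen {x : Fin 3 → ℝ | ∀ k, 0 < eval x (Q k) * eval p (Q k)} := by
      have : {x : Fin 3 → ℝ | ∀ k, 0 < eval x (Q k) * eval p (Q k)} = ⋂ k, {x | 0 < eval x (Q k) * eval p (Q k)} := by
        ext x; simp
      rw [this]
      exact isOpen_iInter_of_finite fun k => isOpen_lt continuous_const ((continuous_eval (Q k)).mul continuous_const)
    have h2 : IsOpen {x : Fin 3 → ℝ | ∑ i, x i ^ 2 < R} := isOpen_lt (by fun_prop) continuous_const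
    exact h1.inter h2
  have hUK : U ⊆ K := fun x hx => ⟨fun k => (hx.1 k).le, hx.2.le⟩
  have hpK : p ∈ K := ⟨fun k => mul_self_nonneg _, hp⟩
  obtain ⟨x, hxK, hmax⟩ := hKc.exists_isMaxOn ⟨p, hpK⟩ (continuous_eval Ψ).continuousOn
  have h1 : eval p Ψ ≤ eval x Ψ := hmax hpK
  rw [hΨe, hΨe] at h1
  have h2 := abs_le.1 (hlin p hp)
  have h3 := abs_le.1 (hlin x hxK.2)
  have h4 : eval x (Phi Q R) ≠ 0 := by intro h0; linarith [h2.1, h3.2]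
  rw [Phi_eval] at h4
  have h5 : ∀ k, eval x (Q k) ≠ 0 := fun k h0 => h4 (by
    rw [Finset.prod_eq_zero (Finset.mem_univ k) h0]; simp)
  have hxU : x ∈ U := by
    refine ⟨fun k => lt_of_le_of_ne (hxK.1 k) (mul_ne_zero (h5 k) (hpQ k)).symm, lt_of_le_of_ne hxK.2 ?_⟩
    intro h0
    exact h4 (by rw [h0]; simp)
  refine ⟨x, fun k => ?_, fun i => ?_⟩
  · have := hxU.1 k
    rcases pos_and_pos_or_neg_and_neg_of_mul_pos this with ⟨a, b⟩ | ⟨a, b⟩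
    · rw [sign_pos a, sign_pos b]
    · rw [sign_neg a, sign_neg b]
  · have h6 := deriv_pd Ψ i x (x i)
    have h7 : IsLocalMax (fun s => eval (Function.update x i s) Ψ) (x i) := by
      have hc : ContinuousAt (fun s => Function.update x i s) (x i) := by fun_prop
      have : ∀ᶠ s in 𝓝 (x i), Function.update x i s ∈ U :=
        hc.eventually (by simpa using hUo.mem_nhds hxU)
      filter_upwards [this] with s hs
      have := hmax (hUK hs)
      simpa using this
    have h8 := h7.hasDerivAt_eq_zero h6
    rw [Function.update_eq_self, hΨ] at h8
    simp only [map_add, map_sum, pderiv_C_mul, pderiv_X, map_mul, eval_C] at h8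
    rw [Finset.sum_eq_single i] at h8
    · simp at h8; linarith
    · intro j _ hj; simp [hj]
    · simp

open MvPolynomial in
theorem warren {l : ℕ} (Q : Fin l → MvPolynomial (Fin 3) ℝ) (e : ℕ) (hQ : ∀ k j, degreeOf j (Q k) ≤ e)
    (pts : Finset (Fin 3 → ℝ)) (h0 : ∀ p ∈ pts, ∀ k, eval p (Q k) ≠ 0)
    (hinj : ∀ p ∈ pts, ∀ q ∈ pts, (∀ k, SignType.sign (eval p (Q k)) = SignType.sign (eval q (Q k))) → p = q) :
    pts.card ≤ (3 * (2 * (l * e) + 2) + 1) ^ 3 := by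
  classical
  rcases pts.eq_empty_or_nonempty with rfl | hne
  · simp
  set d := 2 * (l * e) + 2 with hd
  set R : ℝ := 1 + ∑ p ∈ pts, ∑ i, p i ^ 2 with hR
  have hR1 : 1 ≤ R := by
    have : 0 ≤ ∑ p ∈ pts, ∑ i, p i ^ 2 := by positivity
    linarith
  have hpR : ∀ p ∈ pts, ∑ i, p i ^ 2 < R := by
    intro p hp
    have := Finset.single_le_sum (f := fun p : Fin 3 → ℝ => ∑ i, p i ^ 2) (fun _ _ => by positivity) hp
    linarith
  obtain ⟨p0, hp0, hmin⟩ := Finset.exists_min_image pts (fun p => eval p (Phi Q R)) hne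
  have hpos : 0 < eval p0 (Phi Q R) := by
    rw [Phi_eval]
    have h1 := hpR p0 hp0
    have h2 : ∏ k, eval p0 (Q k) ≠ 0 := Finset.prod_ne_zero_iff.2 fun k _ => h0 p0 hp0 k
    have : 0 < R - ∑ i, p0 i ^ 2 := by linarith
    positivity
  set δ := eval p0 (Phi Q R) / (7 * R) with hδ
  have hδ0 : 0 < δ := by positivity
  have hδ1 : 6 * δ * R < eval p0 (Phi Q R) := by
    have : 7 * δ * R = eval p0 (Phi Q R) := by rw [hδ]; field_simp
    have : 0 < δ * R := by positivity
    linarith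
  set B := (3 * d + 1) ^ 3 with hB
  have hdep := fun τ : ℕ => dep d B hB (fun i => pderiv i (Phi Q R))
    (fun i j => (degreeOf_pd _ _ _).trans (Phi_deg Q R e hQ j))
    (X 0 + C (τ : ℝ) * X 1 + C ((τ : ℝ) ^ 2) * X 2) (by
      intro j
      refine (degreeOf_add_le _ _ _).trans (max_le ((degreeOf_add_le _ _ _).trans (max_le ?_ ?_)) ?_)
      · rw [degreeOf_X]; split_ifs <;> simp
      · refine (degreeOf_C_mul_le _ _ _).trans ?_
        rw [degreeOf_X]; split_ifs <;> simp
      · refine (degreeOf_C_mul_le _ _ _).trans ?_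
        rw [degreeOf_X]; split_ifs <;> simp)
  choose G hG0 hG using hdep
  have hb : ∀ τ, ∃ b, G τ b ≠ 0 := fun τ => by
    by_contra h; push Not at h; exact hG0 τ (funext h)
  choose b hb using hb
  set N := pts.card with hN
  set T := Finset.range (2 * (N * N) + 1) with hT
  have hH : ∏ τ ∈ T, G τ (b τ) ≠ 0 := Finset.prod_ne_zero_iff.2 fun τ _ => hb τ
  obtain ⟨y, hy, hyH⟩ : ∃ y : Fin 3 → ℝ, (∀ i, |y i| ≤ δ) ∧ eval y (∏ τ ∈ T, G τ (b τ)) ≠ 0 := by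
    by_contra hcon
    push Not at hcon
    apply hH
    refine funext_set (fun _ => Set.Icc (-δ) δ) (fun _ => Set.Icc_infinite (by linarith)) ?_
    intro x hx
    rw [hcon x (fun i => abs_le.2 (hx i (Set.mem_univ i))), map_zero]
  rw [map_prod, Finset.prod_ne_zero_iff] at hyH
  have hx : ∀ p ∈ pts, ∃ x : Fin 3 → ℝ, (∀ k, SignType.sign (eval x (Q k)) = SignType.sign (eval p (Q k))) ∧
      ∀ i, eval x (pderiv i (Phi Q R)) = y i := by
    intro p hp
    obtain ⟨x, h1, h2⟩ := intmax Q R δ hR1 (fun i => - y i) p (by simpa using hy) (hpR p hp).le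
      (hδ1.trans_le (hmin p hp))
    exact ⟨x, h1, by simpa using h2⟩
  choose! x hx1 hx2 using hx
  have hxi : ∀ p ∈ pts, ∀ q ∈ pts, x p = x q → p = q := by
    intro p hp q hq h
    refine hinj p hp q hq fun k => ?_
    rw [← hx1 p hp, ← hx1 q hq, h]
  -- choose τ
  set w : (Fin 3 → ℝ) × (Fin 3 → ℝ) → Polynomial ℝ := fun r =>
    Polynomial.C (x r.1 0 - x r.2 0) + Polynomial.C (x r.1 1 - x r.2 1) * Polynomial.X + Polynomial.C (x r.1 2 - x r.2 2) * Polynomial.X ^ 2 with hw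
  have hwd : ∀ r, (w r).natDegree ≤ 2 := by
    intro r; rw [hw]; simp only; compute_degree
  have hw0 : ∀ r ∈ pts.offDiag, w r ≠ 0 := by
    intro r hr h
    rw [Finset.mem_offDiag] at hr
    apply hr.2.2
    apply hxi _ hr.1 _ hr.2.1
    have c0 := congrArg (fun p => p.coeff 0) h
    have c1 := congrArg (fun p => p.coeff 1) h
    have c2 := congrArg (fun p => p.coeff 2) h
    simp only [hw, Polynomial.coeff_add, Polynomial.coeff_C_mul, Polynomial.coeff_X_pow, Polynomial.coeff_C, Polynomial.coeff_X, Polynomial.coeff_zero] at c0 c1 c2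
    norm_num at c0 c1 c2
    ext i
    fin_cases i
    · simpa using sub_eq_zero.1 c0
    · simpa using sub_eq_zero.1 c1
    · simpa using sub_eq_zero.1 c2
  obtain ⟨τ, hτT, hτ⟩ : ∃ τ ∈ T, ∀ r ∈ pts.offDiag, (w r).eval (τ : ℝ) ≠ 0 := by
    by_contra hcon
    push Not at hcon
    have hW : ∏ r ∈ pts.offDiag, w r ≠ 0 := Finset.prod_ne_zero_iff.2 hw0
    apply hW
    refine Polynomial.eq_zero_of_natDegree_lt_card_of_eval_eq_zero' _ (T.image (fun τ : ℕ => (τ : ℝ))) ?_ ?_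
    · intro t ht
      obtain ⟨τ, hτ, rfl⟩ := Finset.mem_image.1 ht
      obtain ⟨r, hr, h⟩ := hcon τ hτ
      rw [Polynomial.eval_prod]
      exact Finset.prod_eq_zero hr h
    · rw [Finset.card_image_of_injective _ Nat.cast_injective, hT, Finset.card_range]
      refine lt_of_le_of_lt (Polynomial.natDegree_prod_le _ _) ?_
      refine lt_of_le_of_lt (Finset.sum_le_sum fun r _ => hwd r) ?_
      rw [Finset.sum_const, Finset.offDiag_card, smul_eq_mul]
      have : pts.card * pts.card - pts.card ≤ N * N := by rw [hN]; omega
      omega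
  set ℓ : (Fin 3 → ℝ) → ℝ := fun z => z 0 + τ * z 1 + τ ^ 2 * z 2 with hℓ
  have hℓi : Set.InjOn (fun p => ℓ (x p)) pts := by
    intro p hp q hq h
    by_contra hpq
    apply hτ (p, q) (Finset.mem_offDiag.2 ⟨hp, hq, hpq⟩)
    simp only [hℓ] at h
    simp [hw]
    linarith
  by_contra hlt
  push Not at hlt
  have hP0 : (∑ b : Fin (B + 1), Polynomial.C (eval y (G τ b)) * Polynomial.X ^ b.val) = 0 := by
    refine Polynomial.eq_zero_of_natDegree_lt_card_of_eval_eq_zero' _ (pts.image (fun p => ℓ (x p))) ?_ ?_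
    · intro t ht
      obtain ⟨p, hp, rfl⟩ := Finset.mem_image.1 ht
      have h1 := hG τ (x p)
      rw [show (fun i => eval (x p) (pderiv i (Phi Q R))) = y from funext (hx2 p hp)] at h1
      rw [Polynomial.eval_finsetSum, ← h1]
      refine Finset.sum_congr rfl fun b _ => ?_
      simp [hℓ]
    · rw [Finset.card_image_of_injOn hℓi]
      refine lt_of_le_of_lt (Polynomial.natDegree_sum_le_of_forall_le _ _ (n := B) fun b _ => ?_) hlt
      exact (Polynomial.natDegree_C_mul_X_pow_le _ _).trans (Nat.lt_succ_iff.1 b.2)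
  apply hyH τ hτT
  have := congrArg (fun p => p.coeff (b τ).val) hP0
  simp only [Polynomial.finsetSum_coeff, Polynomial.coeff_C_mul, Polynomial.coeff_X_pow, Polynomial.coeff_zero] at this
  rw [Finset.sum_eq_single (b τ)] at this
  · simpa using this
  · intro b' _ hb'
    rw [if_neg, mul_zero]
    intro hc; exact hb' (Fin.ext hc.symm)
  · simp

end LST

namespace LST
open Set Filter Topology

theorem params2 (ε : ℝ) (hε : 0 < ε) (hε1 : ε ≤ 1 / 5) : ∃ D l : ℕ, 2 ≤ D ∧
    (3 / 4 : ℝ) ^ l ≤ 1 / ((D : ℝ) + 1) ^ 4 ∧ 90 < ((D : ℝ) + 1) ^ 4 ∧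
    (((3 * (2 * (l * (3 * D)) + 2) + 1) ^ 3 : ℕ) : ℝ) ^ ((4 : ℝ) / 5 + ε) *
      (90 / ((D : ℝ) + 1) ^ 4) ^ ((3 : ℝ) / 5 + ε) ≤ 1 / 4 := by
  have hr : |(2 : ℝ) ^ (-ε)| < 1 := by
    rw [abs_of_pos (by positivity)]
    exact Real.rpow_lt_one_of_one_lt_of_neg (by norm_num) (by linarith)
  have ht := (tendsto_pow_const_mul_const_pow_of_abs_lt_one 3 hr).const_mul (90 * 300 ^ 3 : ℝ)
  rw [mul_zero] at ht
  obtain ⟨a, ha, ha2⟩ := ((ht.eventually (ge_mem_nhds (show (0 : ℝ) < 1 / 4 by norm_num))).and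
    (eventually_ge_atTop 2)).exists
  have hpow : 4 ≤ 2 ^ a := by
    calc 4 = 2 ^ 2 := by norm_num
      _ ≤ 2 ^ a := Nat.pow_le_pow_right (by norm_num) ha2
  have hD : ((2 ^ a - 1 : ℕ) : ℝ) + 1 = 2 ^ a := by
    have : 2 ^ a - 1 + 1 = 2 ^ a := by omega
    exact_mod_cast this
  have hp4 : (4 : ℝ) ≤ 2 ^ a := by exact_mod_cast hpow
  refine ⟨2 ^ a - 1, 12 * a, by omega, ?_, ?_, ?_⟩
  · rw [hD, pow_mul (3 / 4 : ℝ), ← pow_mul (2 : ℝ), mul_comm a 4, pow_mul 2 4 a, one_div, ← inv_pow]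
    gcongr
    norm_num
  · rw [hD]
    calc (90 : ℝ) < 4 ^ 4 := by norm_num
      _ ≤ (2 ^ a) ^ 4 := by gcongr
  · rw [hD]
    have hchi : (((3 * (2 * (12 * a * (3 * (2 ^ a - 1))) + 2) + 1) ^ 3 : ℕ) : ℝ) ≤ ((300 * a) * 2 ^ a) ^ 3 := by
      have h1 : (((2 ^ a - 1 : ℕ)) : ℝ) = 2 ^ a - 1 := by linarith
      push_cast
      rw [h1]
      have ha' : (2 : ℝ) ≤ a := by exact_mod_cast ha2
      refine pow_le_pow_left₀ ?_ ?_ 3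
      · have : (0:ℝ) ≤ 2 ^ a - 1 := by linarith
        positivity
      · nlinarith
    have ha1 : (1 : ℝ) ≤ 300 * a := by
      have ha' : (2 : ℝ) ≤ a := by exact_mod_cast ha2
      linarith
    have ha0 : (0 : ℝ) ≤ a := by positivity
    calc _ ≤ (((300 * a) * 2 ^ a) ^ 3 : ℝ) ^ ((4 : ℝ) / 5 + ε) * (90 / (2 ^ a) ^ 4) ^ ((3 : ℝ) / 5 + ε) := by
          gcongr
      _ = (((300 * a) ^ 3 : ℝ) ^ ((4 : ℝ) / 5 + ε) * 90 ^ ((3 : ℝ) / 5 + ε)) *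
          ((((2 : ℝ) ^ a) ^ 3) ^ ((4 : ℝ) / 5 + ε) / (((2 : ℝ) ^ a) ^ 4) ^ ((3 : ℝ) / 5 + ε)) := by
          rw [mul_pow, Real.mul_rpow (by positivity) (by positivity), Real.div_rpow (by positivity) (by positivity)]
          ring
      _ = (((300 * a) ^ 3 : ℝ) ^ ((4 : ℝ) / 5 + ε) * 90 ^ ((3 : ℝ) / 5 + ε)) * ((2 : ℝ) ^ (-ε)) ^ a := by
          congr 1
          rw [← pow_mul, ← pow_mul, ← Real.rpow_natCast 2, ← Real.rpow_natCast 2, ← Real.rpow_natCast (2 ^ (-ε)),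
            ← Real.rpow_mul (by norm_num), ← Real.rpow_mul (by norm_num), ← Real.rpow_mul (by norm_num),
            ← Real.rpow_sub (by norm_num)]
          congr 1
          push_cast
          ring
      _ ≤ ((300 * a) ^ 3 * 90) * ((2 : ℝ) ^ (-ε)) ^ a := by
          gcongr
          · exact (Real.rpow_le_rpow_of_exponent_le (one_le_pow₀ ha1) (by linarith)).trans_eq (Real.rpow_one _)
          · exact (Real.rpow_le_rpow_of_exponent_le (by norm_num) (by linarith)).trans_eq (Real.rpow_one _)
      _ = _ := by ring
      _ ≤ _ := ha

theorem holder1 {T : Type} (S : Finset T) (f g : T → ℝ) (α F G : ℝ) (h0 : 0 < α) (h1 : α ≤ 1)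
    (hf : ∀ i ∈ S, 0 ≤ f i) (hg : ∀ i ∈ S, 0 ≤ g i) (hF : ∑ i ∈ S, f i ≤ F) (hG : ∑ i ∈ S, g i ≤ G) :
    ∑ i ∈ S, f i ^ α * g i ^ (1 - α) ≤ F ^ α * G ^ (1 - α) := by
  have hF0 : 0 ≤ F := (Finset.sum_nonneg hf).trans hF
  have hG0 : 0 ≤ G := (Finset.sum_nonneg hg).trans hG
  rcases eq_or_lt_of_le h1 with rfl | h1
  · simpa using hF
  have hc : (1 / α).HolderConjugate (1 / (1 - α)) := by
    have : (1 - α) > 0 := by linarith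
    rw [Real.holderConjugate_iff]
    constructor
    · rw [lt_div_iff₀ h0]; linarith
    · simp
  have := Real.inner_le_Lp_mul_Lq_of_nonneg S hc (f := fun i => f i ^ α) (g := fun i => g i ^ (1 - α))
    (fun i hi => Real.rpow_nonneg (hf i hi) _) (fun i hi => Real.rpow_nonneg (hg i hi) _)
  refine this.trans ?_
  have e1 : ∑ i ∈ S, (f i ^ α) ^ (1 / α) = ∑ i ∈ S, f i := Finset.sum_congr rfl fun i hi => by
    rw [← Real.rpow_mul (hf i hi), mul_one_div_cancel h0.ne', Real.rpow_one]
  have e2 : ∑ i ∈ S, (g i ^ (1 - α)) ^ (1 / (1 - α)) = ∑ i ∈ S, g i := Finset.sum_congr rfl fun i hi => by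
    rw [← Real.rpow_mul (hg i hi), mul_one_div_cancel (by linarith), Real.rpow_one]
  rw [e1, e2, one_div_one_div, one_div_one_div]
  have := Finset.sum_nonneg hf
  have := Finset.sum_nonneg hg
  gcongr

theorem holder2 {T : Type} (S : Finset T) (f g : T → ℕ) (ε : ℝ) (hε : 0 < ε) (hε1 : ε ≤ 1 / 5) (χ n k : ℕ)
    (m : ℝ) (hm : 0 < m)
    (hF : ∑ i ∈ S, f i ≤ χ * n) (hG : ∑ i ∈ S, g i ≤ k) (hg : ∀ i ∈ S, (g i : ℝ) ≤ 90 / m * k)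
    (hp : (χ : ℝ) ^ ((4 : ℝ) / 5 + ε) * (90 / m) ^ ((3 : ℝ) / 5 + ε) ≤ 1 / 4) :
    ∑ i ∈ S, bnd ε (f i) (g i) ≤ 1 / 4 * bnd ε n k := by
  unfold bnd
  have hsp : ∀ x : ℝ, 0 ≤ x → x ^ ((4 : ℝ) / 5) = x ^ (1 - ((4 : ℝ) / 5 + ε)) * x ^ ((3 : ℝ) / 5 + ε) := by
    intro x hx
    rw [← Real.rpow_add_of_nonneg hx (by linarith) (by linarith)]
    congr 1; ring
  have hk : (0 : ℝ) ≤ k := by positivity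
  calc ∑ i ∈ S, (f i : ℝ) ^ ((4 : ℝ) / 5 + ε) * (g i : ℝ) ^ ((4 : ℝ) / 5)
      ≤ ∑ i ∈ S, ((f i : ℝ) ^ ((4 : ℝ) / 5 + ε) * (g i : ℝ) ^ (1 - ((4 : ℝ) / 5 + ε))) * (90 / m * k) ^ ((3 : ℝ) / 5 + ε) := by
        refine Finset.sum_le_sum fun i hi => ?_
        rw [hsp _ (Nat.cast_nonneg _), ← mul_assoc]
        have := hg i hi
        gcongr
    _ = (∑ i ∈ S, (f i : ℝ) ^ ((4 : ℝ) / 5 + ε) * (g i : ℝ) ^ (1 - ((4 : ℝ) / 5 + ε))) * (90 / m * k) ^ ((3 : ℝ) / 5 + ε) := by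
        rw [Finset.sum_mul]
    _ ≤ ((χ * n : ℝ) ^ ((4 : ℝ) / 5 + ε) * (k : ℝ) ^ (1 - ((4 : ℝ) / 5 + ε))) * (90 / m * k) ^ ((3 : ℝ) / 5 + ε) := by
        gcongr
        exact holder1 S _ _ _ _ _ (by linarith) (by linarith) (fun _ _ => Nat.cast_nonneg _)
          (fun _ _ => Nat.cast_nonneg _) (by exact_mod_cast hF) (by exact_mod_cast hG)
    _ = ((χ : ℝ) ^ ((4 : ℝ) / 5 + ε) * (90 / m) ^ ((3 : ℝ) / 5 + ε)) *
          ((n : ℝ) ^ ((4 : ℝ) / 5 + ε) * (k : ℝ) ^ ((4 : ℝ) / 5)) := by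
        rw [Real.mul_rpow (by positivity) (by positivity), Real.mul_rpow (by positivity) (by positivity),
          hsp k hk]
        ring
    _ ≤ _ := by gcongr
end LST

namespace LST
open Set Filter Topology

open MvPolynomial in
def subst {D : ℕ} (c : Co D) (q : MvPolynomial (Fin 3) ℝ) : MvPolynomial (Fin 3) ℝ :=
  ∑ m, C (c m) * ((∏ i : Fin 3, X i ^ (m i.castSucc).val) * q ^ (m (Fin.last 3)).val)

open MvPolynomial in
theorem subst_eval {D : ℕ} (c : Co D) (q : MvPolynomial (Fin 3) ℝ) (x : R4)
    (hx : x (Fin.last 3) = eval (fun i : Fin 3 => x i.castSucc) q) :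
    eval (fun i : Fin 3 => x i.castSucc) (subst c q) = ev c x := by
  unfold subst ev
  simp only [map_sum, map_mul, map_prod, map_pow, eval_C, eval_X, Fin.prod_univ_castSucc (n := 3), hx]

open MvPolynomial in
theorem subst_deg {D : ℕ} (c : Co D) (q : MvPolynomial (Fin 3) ℝ) (hq : ∀ j, degreeOf j q ≤ 2) (j : Fin 3) :
    degreeOf j (subst c q) ≤ 3 * D := by
  unfold subst
  refine (degreeOf_sum_le _ _ _).trans (Finset.sup_le fun m _ => ?_)
  refine (degreeOf_C_mul_le _ _ _).trans ((degreeOf_mul_le _ _ _).trans ?_)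
  have h1 : degreeOf j (∏ i : Fin 3, (X i : MvPolynomial (Fin 3) ℝ) ^ (m i.castSucc).val) ≤ D := by
    refine (degreeOf_prod_le _ _ _).trans ?_
    calc _ ≤ ∑ i : Fin 3, if i = j then D else 0 := by
          refine Finset.sum_le_sum fun i _ => (degreeOf_pow_le _ _ _).trans ?_
          rw [degreeOf_X]
          have := (m i.castSucc).2
          by_cases h : j = i
          · rw [if_pos h, if_pos h.symm]; omega
          · rw [if_neg h]; simp
      _ = D := by simp
  have h2 : degreeOf j (q ^ (m (Fin.last 3)).val) ≤ D * 2 := by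
    refine (degreeOf_pow_le _ _ _).trans ?_
    have := (m (Fin.last 3)).2
    exact Nat.mul_le_mul (by omega) (hq j)
  omega

open MvPolynomial in
open Classical in
theorem crossing {D l : ℕ} (c : Fin l → Co D) (q : MvPolynomial (Fin 3) ℝ) (hq : ∀ j, degreeOf j q ≤ 2)
    (Z : Finset R4) (hc : ∀ j, ∀ x ∈ Z, ev (c j) x ≠ 0)
    (hx : ∀ x ∈ Z, x (Fin.last 3) = eval (fun i : Fin 3 => x i.castSucc) q) :
    (Z.image (fun x => fun j => SignType.sign (ev (c j) x))).card ≤ (3 * (2 * (l * (3 * D)) + 2) + 1) ^ 3 := by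
  set S := Z.image (fun x => fun j => SignType.sign (ev (c j) x)) with hS
  have hrep : ∀ σ ∈ S, ∃ x ∈ Z, (fun j => SignType.sign (ev (c j) x)) = σ := by
    intro σ hσ
    simpa [hS] using hσ
  choose! r hrZ hr using hrep
  have hinj : ∀ σ ∈ S, ∀ τ ∈ S, (∀ k, SignType.sign (eval (fun i : Fin 3 => r σ i.castSucc) (subst (c k) q)) =
      SignType.sign (eval (fun i : Fin 3 => r τ i.castSucc) (subst (c k) q))) → σ = τ := by
    intro σ hσ τ hτ h
    rw [← hr σ hσ, ← hr τ hτ]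
    funext k
    rw [← subst_eval (c k) q _ (hx _ (hrZ σ hσ)), ← subst_eval (c k) q _ (hx _ (hrZ τ hτ))]
    exact h k
  have := warren (fun k => subst (c k) q) (3 * D) (fun k j => subst_deg _ _ hq j)
    (S.image (fun σ => fun i : Fin 3 => r σ i.castSucc)) ?_ ?_
  · refine le_trans (le_of_eq (Finset.card_image_of_injOn ?_).symm) this
    intro σ hσ τ hτ h
    refine hinj σ hσ τ hτ fun k => ?_
    simp only at h
    rw [h]
  · intro p hp k
    obtain ⟨σ, hσ, rfl⟩ := Finset.mem_image.1 hp
    rw [subst_eval (c k) q _ (hx _ (hrZ σ hσ))]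
    exact hc k _ (hrZ σ hσ)
  · intro p hp p' hp' h
    obtain ⟨σ, hσ, rfl⟩ := Finset.mem_image.1 hp
    obtain ⟨τ, hτ, rfl⟩ := Finset.mem_image.1 hp'
    rw [hinj σ hσ τ hτ h]
end LST

namespace LST
open Set Filter Topology

open MvPolynomial in
theorem cells {D l : ℕ} {Y : Type} (h : Y → Co D) (q : Y → MvPolynomial (Fin 3) ℝ)
    (hq : ∀ y j, degreeOf j (q y) ≤ 2)
    (hE : ∀ x y, Ez h x y → x (Fin.last 3) = eval (fun i : Fin 3 => x i.castSucc) (q y))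
    (c : Fin l → Co D) (X : Finset R4) (L : Finset Y) (hc : ∀ j, ∀ x ∈ X, ev (c j) x ≠ 0) (m : ℝ) (hm : 0 < m)
    (hsq : ∀ s : R4 → Fin l → SignType, (∀ x, s x = fun j => SignType.sign (ev (c j) x)) →
      ∑ x ∈ X, ((X.filter (fun x' => s x' = s x)).card : ℝ) ≤ 9 / m * (X.card : ℝ) ^ 2) :
    ∃ (I : Finset (Fin l → SignType)) (B : Finset R4) (Xc : (Fin l → SignType) → Finset R4)
      (Lc : (Fin l → SignType) → Finset Y), B ⊆ X ∧ 10 * B.card ≤ X.card ∧ (∀ τ, Xc τ ⊆ X) ∧ (∀ τ, Lc τ ⊆ L) ∧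
      (∀ τ ∈ I, ((Xc τ).card : ℝ) ≤ 90 / m * X.card) ∧ ∑ τ ∈ I, (Xc τ).card + B.card = X.card ∧
      ∑ τ ∈ I, (Lc τ).card ≤ (3 * (2 * (l * (3 * D)) + 2) + 1) ^ 3 * L.card ∧
      inc (Ez h) X L = ∑ τ ∈ I, inc (Ez h) (Xc τ) (Lc τ) + inc (Ez h) B L := by
  classical
  set s : R4 → Fin l → SignType := fun x j => SignType.sign (ev (c j) x) with hs
  have hsq := hsq s (fun x => rfl)
  set good : (Fin l → SignType) → Prop := fun τ => ((X.filter (fun x => s x = τ)).card : ℝ) ≤ 90 / m * X.card with hgood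
  set Xc : (Fin l → SignType) → Finset R4 := fun τ => (X.filter (fun x => good (s x))).filter (fun x => s x = τ) with hXc
  set Lc : (Fin l → SignType) → Finset Y := fun τ => L.filter (fun y => ∃ x ∈ Xc τ, Ez h x y) with hLc
  have hmaps : ∀ x ∈ X.filter (fun x => good (s x)), s x ∈ Finset.univ.filter good := by
    intro x hx
    simpa using (Finset.mem_filter.1 hx).2
  have hsub : ∀ τ, Xc τ ⊆ X := fun τ => (Finset.filter_subset _ _).trans (Finset.filter_subset _ _)
  refine ⟨Finset.univ.filter good, X.filter (fun x => ¬ good (s x)), Xc, Lc, Finset.filter_subset _ _, ?_,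
    hsub, fun τ => Finset.filter_subset _ _, ?_, ?_, ?_, ?_⟩
  · rcases Nat.eq_zero_or_pos X.card with h0 | h0
    · have := Finset.card_le_card (Finset.filter_subset (fun x => ¬ good (s x)) X)
      omega
    have h0' : (0 : ℝ) < X.card := by exact_mod_cast h0
    have h1 : ((X.filter (fun x => ¬ good (s x))).card : ℝ) * (90 / m * X.card) ≤ 9 / m * (X.card : ℝ) ^ 2 := by
      refine le_trans ?_ hsq
      rw [← nsmul_eq_mul, ← Finset.sum_const]
      refine (Finset.sum_le_sum fun x hx => ?_).trans
        (Finset.sum_le_sum_of_subset_of_nonneg (Finset.filter_subset _ _) (fun _ _ _ => by positivity))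
      have := (Finset.mem_filter.1 hx).2
      simp only [hgood, not_le] at this
      exact this.le
    have h2 : (10 * ((X.filter (fun x => ¬ good (s x))).card : ℝ)) ≤ X.card := by
      have h3 : (10 * ((X.filter (fun x => ¬ good (s x))).card : ℝ)) * (9 / m * X.card) ≤ X.card * (9 / m * X.card) := by
        calc _ = ((X.filter (fun x => ¬ good (s x))).card : ℝ) * (90 / m * X.card) := by ring
          _ ≤ _ := h1
          _ = _ := by ring
      exact le_of_mul_le_mul_right h3 (by positivity)
    exact_mod_cast h2
  · intro τ hτ
    refine le_trans ?_ (Finset.mem_filter.1 hτ).2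
    gcongr
    exact Finset.filter_subset_filter _ (Finset.filter_subset _ _)
  · rw [← Finset.card_eq_sum_card_fiberwise hmaps, Finset.card_filter_add_card_filter_not]
  · have : ∑ τ ∈ Finset.univ.filter good, (Lc τ).card ≤ ∑ τ, (Lc τ).card :=
      Finset.sum_le_sum_of_subset (Finset.filter_subset _ _)
    refine this.trans ?_
    simp only [hLc, Finset.card_filter]
    rw [Finset.sum_comm, mul_comm, ← smul_eq_mul]
    refine Finset.sum_le_card_nsmul _ _ _ fun y _ => ?_
    rw [← Finset.card_filter]
    refine le_trans (Finset.card_le_card ?_) (crossing c (q y) (hq y) (X.filter (fun x => Ez h x y)) (fun j x hx => hc j x (Finset.mem_filter.1 hx).1)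
      (fun x hx => hE x y (Finset.mem_filter.1 hx).2))
    intro τ hτ
    obtain ⟨x, hx, hxy⟩ := (Finset.mem_filter.1 hτ).2
    exact Finset.mem_image.2 ⟨x, Finset.mem_filter.2 ⟨hsub τ hx, hxy⟩, (Finset.mem_filter.1 hx).2⟩
  · rw [inc_splitX (fun x => good (s x)), inc_fiber s (Finset.univ.filter good) hmaps]
    congr 1
    refine Finset.sum_congr rfl fun τ _ => ?_
    unfold inc
    refine Finset.sum_congr rfl fun x hx => ?_
    congr 1
    ext y
    simp only [Finset.mem_filter, hLc]
    constructor
    · rintro ⟨h1, h2⟩; exact ⟨⟨h1, x, hx, h2⟩, h2⟩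
    · rintro ⟨⟨h1, -⟩, h2⟩; exact ⟨h1, h2⟩
end LST

namespace LST
open Set Filter Topology

theorem bnd_tenth {ε : ℝ} {n k b : ℕ} (h : 10 * b ≤ k) : bnd ε n b ≤ 1 / 4 * bnd ε n k := by
  unfold bnd
  have h1 : ((1 : ℝ) / 10) ^ ((4 : ℝ) / 5) ≤ 1 / 4 := by
    rw [show ((4 : ℝ) / 5) = (4 : ℕ) * (1 / 5 : ℝ) by norm_num, Real.rpow_mul (by norm_num), Real.rpow_natCast]
    calc (((1 : ℝ) / 10) ^ 4) ^ ((1 : ℝ) / 5) ≤ ((1 / 4 : ℝ) ^ 5) ^ ((1 : ℝ) / 5) := by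
          gcongr; norm_num
      _ = 1 / 4 := by
          rw [← Real.rpow_natCast, ← Real.rpow_mul (by norm_num)]; norm_num
  have h2 : (b : ℝ) ≤ 1 / 10 * k := by
    have : (10 * b : ℝ) ≤ k := by exact_mod_cast h
    linarith
  calc (n : ℝ) ^ ((4 : ℝ) / 5 + ε) * (b : ℝ) ^ ((4 : ℝ) / 5)
      ≤ (n : ℝ) ^ ((4 : ℝ) / 5 + ε) * (1 / 10 * k : ℝ) ^ ((4 : ℝ) / 5) := by gcongr
    _ = (1 / 10 : ℝ) ^ ((4 : ℝ) / 5) * ((n : ℝ) ^ ((4 : ℝ) / 5 + ε) * (k : ℝ) ^ ((4 : ℝ) / 5)) := by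
        rw [Real.mul_rpow (by norm_num) (by positivity)]; ring
    _ ≤ _ := by gcongr

theorem arith {A b n d w B χ z1 z2 z3 : ℝ} (hz : z1 ≤ A / 4 * (b + n + d))
    (hbad : z2 ≤ A * (1 / 4 * b + n + B)) (hcell : z3 ≤ A * (1 / 4 * b + χ * n + w))
    (hAn : A * ((χ + 2) * n) ≤ A * (1 / 4 * b)) (h1 : 0 ≤ A * d) (h2 : 0 ≤ A * n) (h3 : 0 ≤ A * b) :
    z3 + z2 + z1 ≤ A * (b + n + (d + (w + B))) := by
  ring_nf at *
  linarith

set_option maxHeartbeats 1000000 in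
open MvPolynomial in
theorem recur (M : ℕ) (ε : ℝ) (hε : 0 < ε) (hε1 : ε ≤ 1 / 5) : ∃ D : ℕ, 2 ≤ D ∧ ∃ A : ℝ, 0 < A ∧
    ∀ (Y : Type) (h : Y → Co D) (q : Y → MvPolynomial (Fin 3) ℝ), (∀ y j, degreeOf j (q y) ≤ 2) →
    (∀ x y, Ez h x y → x (Fin.last 3) = eval (fun i : Fin 3 => x i.castSucc) (q y)) →
    ∀ (X : Finset R4) (L : Finset Y), KF (Ez h) M X L →
      (inc (Ez h) X L : ℝ) ≤ A * (bnd ε L.card X.card + L.card + X.card) := by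
  classical
  obtain ⟨D, l, hD2, hl, hm, hp⟩ := params2 ε hε hε1
  set m : ℝ := ((D : ℝ) + 1) ^ 4 with hmdef
  set χ : ℕ := (3 * (2 * (l * (3 * D)) + 2) + 1) ^ 3 with hχ
  obtain ⟨A3, hA3, hZ⟩ := onZ D M ε hε hε1
  have ht : Tendsto (fun n : ℕ => (n : ℝ) ^ ε) atTop atTop :=
    (tendsto_rpow_atTop hε).comp tendsto_natCast_atTop_atTop
  obtain ⟨n0, hn0⟩ := (ht.eventually_ge_atTop (4 * ((χ : ℝ) + 2))).exists_forall_of_atTop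
  refine ⟨D, hD2, 4 * A3 + 3 + M + n0, by positivity, ?_⟩
  intro Y h q hq hE
  set A : ℝ := 4 * A3 + 3 + M + n0 with hA
  have hM0 : (0 : ℝ) ≤ M := Nat.cast_nonneg _
  have hn00 : (0 : ℝ) ≤ n0 := Nat.cast_nonneg _
  have hA0 : 0 < A := by positivity
  have key : ∀ K : ℕ, ∀ (X : Finset R4) (L : Finset Y), X.card < K → KF (Ez h) M X L →
      (inc (Ez h) X L : ℝ) ≤ A * (bnd ε L.card X.card + L.card + X.card) := by
    intro K
    induction K with
    | zero => intro X L h; omega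
    | succ K ih =>
    intro X L hXK hK
    have hb := bnd_nonneg ε L.card X.card
    have hL0 : (0 : ℝ) ≤ L.card := Nat.cast_nonneg _
    have hX0 : (0 : ℝ) ≤ X.card := Nat.cast_nonneg _
    by_cases hc1 : X.card ^ 4 ≤ L.card
    · have h1 : (inc (Ez h) X L : ℝ) ≤ 3 * L.card + M * X.card ^ 4 := by exact_mod_cast KST hK
      have h2 : (X.card : ℝ) ^ 4 ≤ L.card := by exact_mod_cast hc1
      have h3 : (M : ℝ) * X.card ^ 4 ≤ M * L.card := by gcongr
      have h4 : (3 + M : ℝ) * L.card ≤ A * L.card := by gcongr; linarith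
      have : 0 ≤ A * bnd ε L.card X.card := by positivity
      have : 0 ≤ A * X.card := by positivity
      linarith
    by_cases hc2 : L.card ≤ n0
    · have h1 : (inc (Ez h) X L : ℝ) ≤ X.card * L.card := by
        have := inc_le (E := Ez h) (X := X) (L := L)
        exact_mod_cast this
      have h2 : (L.card : ℝ) ≤ A := by
        have : (L.card : ℝ) ≤ n0 := by exact_mod_cast hc2
        linarith
      have h3 : (X.card : ℝ) * L.card ≤ X.card * A := by gcongr
      have : 0 ≤ A * bnd ε L.card X.card := by positivity
      have : 0 ≤ A * L.card := by positivity
      linarith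
    push Not at hc1 hc2
    have hXpos : 0 < X.card := by
      by_contra h0
      have : X.card = 0 := by omega
      rw [this] at hc1
      simp at hc1
    obtain ⟨X', hX', ⟨g, hg0, hg⟩, c, hc, hpairs⟩ := parti D l X
    have hnb : ((χ : ℝ) + 2) * L.card ≤ 1 / 4 * bnd ε L.card X.card := by
      have h1 := n_le_bnd hε hc1.le
      have h2 := hn0 L.card hc2.le
      have h3 : (L.card : ℝ) * (4 * ((χ : ℝ) + 2)) ≤ L.card * (L.card : ℝ) ^ ε := by gcongr
      linarith
    obtain ⟨I, B, Xc, Lc, hB, hB10, hXc, hLc, hgood, hsumX, hsumL, hinc⟩ :=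
      cells h q hq hE c X' L hc m (by linarith) (by
        intro s hs
        have e1 : (((X' ×ˢ X').filter (fun p => ∀ j, SignType.sign (ev (c j) p.1) = SignType.sign (ev (c j) p.2))).card : ℝ)
            = ∑ x ∈ X', ((X'.filter (fun x' => s x' = s x)).card : ℝ) := by
          rw [Finset.card_filter, Finset.sum_product]
          push_cast
          refine Finset.sum_congr rfl fun x _ => ?_
          rw [Finset.card_filter]
          push_cast
          refine Finset.sum_congr rfl fun x' _ => ?_
          congr 1
          rw [eq_iff_iff, hs, hs]
          exact ⟨fun H => funext fun j => (H j).symm, fun H j => (congrFun H j).symm⟩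
        rw [← e1]
        refine hpairs.trans ?_
        gcongr
        calc 8 / m + (3 / 4 : ℝ) ^ l ≤ 8 / m + 1 / m := by gcongr
          _ = 9 / m := by ring)
    have hX'le : X'.card ≤ X.card := Finset.card_le_card hX'
    have hXdiff : (X \ X').card + X'.card = X.card := Finset.card_sdiff_add_card_eq_card hX'
    -- on the zero set
    have hz : (inc (Ez h) (X \ X') L : ℝ) ≤ A / 4 * (bnd ε L.card X.card + L.card + (X \ X').card) := by
      have h1 := hZ Y h g (X \ X') L hg0 hg (hK.mono Finset.sdiff_subset (Finset.Subset.refl _))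
      have h2 := bnd_mono hε (le_refl L.card) (show (X \ X').card ≤ X.card by omega)
      refine h1.trans ?_
      have : A3 ≤ A / 4 := by linarith
      have := bnd_nonneg ε L.card (X \ X').card
      gcongr
    have hbad : (inc (Ez h) B L : ℝ) ≤ A * (1 / 4 * bnd ε L.card X.card + L.card + B.card) := by
      refine (ih B L (by omega) (hK.mono (hB.trans hX') (Finset.Subset.refl _))).trans ?_
      gcongr
      exact bnd_tenth (by omega)
    have hcell : ∑ τ ∈ I, (inc (Ez h) (Xc τ) (Lc τ) : ℝ) ≤
        A * (1 / 4 * bnd ε L.card X.card + χ * L.card + ∑ τ ∈ I, ((Xc τ).card : ℝ)) := by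
      have hcard : ∀ τ ∈ I, ((Xc τ).card : ℝ) ≤ 90 / m * X.card := fun τ hτ => (hgood τ hτ).trans (by
        have : 0 ≤ 90 / m := by positivity
        gcongr)
      calc ∑ τ ∈ I, (inc (Ez h) (Xc τ) (Lc τ) : ℝ)
          ≤ ∑ τ ∈ I, A * (bnd ε (Lc τ).card (Xc τ).card + (Lc τ).card + (Xc τ).card) := by
            refine Finset.sum_le_sum fun τ hτ => ih _ _ ?_ (hK.mono ((hXc τ).trans hX') (hLc τ))
            have h1 : ((Xc τ).card : ℝ) < X.card := by
              refine (hcard τ hτ).trans_lt ?_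
              have : 90 / m < 1 := by rw [div_lt_one (by linarith)]; exact hm
              have : (0 : ℝ) < X.card := by exact_mod_cast hXpos
              nlinarith
            have : (Xc τ).card < X.card := by exact_mod_cast h1
            omega
        _ = A * (∑ τ ∈ I, bnd ε (Lc τ).card (Xc τ).card + ∑ τ ∈ I, ((Lc τ).card : ℝ) + ∑ τ ∈ I, ((Xc τ).card : ℝ)) := by
            rw [← Finset.mul_sum, Finset.sum_add_distrib, Finset.sum_add_distrib]
        _ ≤ _ := by
            gcongr
            · exact holder2 I _ _ ε hε hε1 χ L.card X.card m (by linarith) hsumL (by omega) hcard hp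
            · exact_mod_cast hsumL
    have hsplit : inc (Ez h) X L = inc (Ez h) X' L + inc (Ez h) (X \ X') L := by
      unfold inc
      rw [add_comm, Finset.sum_sdiff hX']
    have e : (inc (Ez h) X L : ℝ) = ∑ τ ∈ I, (inc (Ez h) (Xc τ) (Lc τ) : ℝ) + inc (Ez h) B L + inc (Ez h) (X \ X') L := by
      rw [hsplit, hinc]; push_cast; ring
    have hk : (X.card : ℝ) = (X \ X').card + (∑ τ ∈ I, ((Xc τ).card : ℝ) + B.card) := by
      have : X.card = (X \ X').card + (∑ τ ∈ I, (Xc τ).card + B.card) := by omega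
      exact_mod_cast this
    have hd0 : (0 : ℝ) ≤ (X \ X').card := Nat.cast_nonneg _
    set d : ℝ := ((X \ X').card : ℝ)
    set w : ℝ := ∑ τ ∈ I, ((Xc τ).card : ℝ)
    set b := bnd ε L.card X.card
    have hAn : A * (((χ : ℝ) + 2) * L.card) ≤ A * (1 / 4 * b) := by gcongr
    rw [e, hk]
    have : 0 ≤ A * d := by positivity
    have : 0 ≤ A * L.card := by positivity
    have : 0 ≤ A * b := by positivity
    exact arith hz hbad hcell hAn ‹_› ‹_› ‹_›
  intro X L hK
  exact key (X.card + 1) X L (by omega) hK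
end LST

namespace LST
open Set Filter Topology

open MvPolynomial in
theorem toCo (D : ℕ) (P : MvPolynomial (Fin 4) ℝ) (hP : ∀ j, degreeOf j P ≤ D) : ∃ c : Co D, ∀ x : R4, ev c x = eval x P := by
  classical
  set e : (Fin 4 → Fin (D + 1)) → (Fin 4 →₀ ℕ) := fun m => Finsupp.equivFunOnFinite.symm (fun i => (m i).val) with he
  have hinj : Function.Injective e := by
    intro m m' h
    funext i
    have := DFunLike.congr_fun h i
    exact Fin.ext (by simpa [he] using this)
  refine ⟨fun m => coeff (e m) P, fun x => ?_⟩
  rw [eval_eq', ev]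
  calc ∑ m, coeff (e m) P * ∏ i, x i ^ (m i).val = ∑ m, (fun d : Fin 4 →₀ ℕ => coeff d P * ∏ i, x i ^ d i) (e m) := by
        simp [he]
    _ = ∑ d ∈ Finset.univ.image e, coeff d P * ∏ i, x i ^ d i := by
        rw [Finset.sum_image (fun a _ b _ h => hinj h)]
    _ = _ := by
        symm
        refine Finset.sum_subset ?_ ?_
        · intro d hd
          refine Finset.mem_image.2 ⟨fun i => ⟨d i, ?_⟩, Finset.mem_univ _, ?_⟩
          · have := (degreeOf_le_iff.1 (hP i)) d hd
            omega
          · ext i; simp [he]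
        · intro d _ hd
          rw [notMem_support_iff.1 hd, zero_mul]

open MvPolynomial in
def lq (a v : Fin 3 → ℝ) : MvPolynomial (Fin 3) ℝ :=
  ∑ i, (X i - C (a i)) ^ 2 - C (1 / ∑ i, v i ^ 2) * (∑ i, C (v i) * (X i - C (a i))) ^ 2

open MvPolynomial in
theorem lq_total (a v : Fin 3 → ℝ) : (lq a v).totalDegree ≤ 2 := by
  have h1 : ∀ i, (X i - C (a i) : MvPolynomial (Fin 3) ℝ).totalDegree ≤ 1 := fun i => by
    refine (totalDegree_sub_C_le _ _).trans ?_
    simp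
  unfold lq
  refine (totalDegree_sub _ _).trans (max_le ?_ ?_)
  · refine totalDegree_finsetSum_le fun i _ => (totalDegree_pow _ _).trans ?_
    have := h1 i; omega
  · refine (totalDegree_mul _ _).trans ?_
    rw [totalDegree_C, zero_add]
    refine (totalDegree_pow _ _).trans ?_
    have : (∑ i, C (v i) * (X i - C (a i)) : MvPolynomial (Fin 3) ℝ).totalDegree ≤ 1 :=
      totalDegree_finsetSum_le fun i _ => (totalDegree_mul _ _).trans (by rw [totalDegree_C, zero_add]; exact h1 i)
    omega

open MvPolynomial in
theorem lq_eval (a v c : Fin 3 → ℝ) : eval c (lq a v) =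
    ∑ i, (c i - a i) ^ 2 - (1 / ∑ i, v i ^ 2) * (∑ i, v i * (c i - a i)) ^ 2 := by
  simp [lq]

open MvPolynomial in
theorem lco (D : ℕ) (hD : 2 ≤ D) (a v : Fin 3 → ℝ) : ∃ c : Co D, ∀ x : R4,
    ev c x = x (Fin.last 3) - eval (fun i : Fin 3 => x i.castSucc) (lq a v) := by
  obtain ⟨c, hc⟩ := toCo D (X (Fin.last 3) - rename Fin.castSucc (lq a v)) (by
    intro j
    refine (degreeOf_le_totalDegree _ _).trans ((totalDegree_sub _ _).trans (max_le ?_ ?_))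
    · rw [totalDegree_X]; omega
    · exact (totalDegree_rename_le _ _).trans ((lq_total a v).trans hD))
  refine ⟨c, fun x => ?_⟩
  rw [hc, map_sub, eval_X, eval_rename]
  rfl

theorem fid (a v c : Fin 3 → ℝ) (hw : ∑ i, v i ^ 2 ≠ 0) (t : ℝ) :
    ∑ i, (a i + t * v i - c i) ^ 2 = (∑ i, (c i - a i) ^ 2 - (1 / ∑ i, v i ^ 2) * (∑ i, v i * (c i - a i)) ^ 2) +
      (∑ i, v i ^ 2) * (t - (∑ i, v i * (c i - a i)) / ∑ i, v i ^ 2) ^ 2 := by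
  field_simp
  simp only [Fin.sum_univ_three]
  ring
end LST

namespace LST
open Set Filter Topology

open MvPolynomial in
theorem tang_iff (a v c : Pt3) (r : ℝ) (hv : v ≠ 0) (hr : 0 < r) :
    Tangent3 (lineThrough3 a v) (Metric.sphere c r) ↔ r ^ 2 = eval (fun i => c i) (lq (fun i => a i) (fun i => v i)) := by
  rw [lq_eval]
  have hw : 0 < ∑ i, v i ^ 2 := by
    have h1 : ∑ i, v i ^ 2 = ‖v‖ ^ 2 := (EuclideanSpace.real_norm_sq_eq v).symm
    rw [h1]
    have : 0 < ‖v‖ := norm_pos_iff.2 hv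
    positivity
  have hmem : ∀ t : ℝ, a + t • v ∈ Metric.sphere c r ↔ ∑ i, (a i + t * v i - c i) ^ 2 = r ^ 2 := by
    intro t
    rw [mem_sphere_iff_norm]
    have h1 : ‖a + t • v - c‖ ^ 2 = ∑ i, (a i + t * v i - c i) ^ 2 := by
      rw [EuclideanSpace.real_norm_sq_eq]
      simp
    rw [← h1]
    exact ⟨fun h => by rw [h], fun h => (pow_left_inj₀ (norm_nonneg _) hr.le two_ne_zero).1 h⟩
  simp only [fid _ _ _ hw.ne'] at hmem
  set t0 := (∑ i, v i * (c i - a i)) / ∑ i, v i ^ 2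
  set f := ∑ i, (c i - a i) ^ 2 - (1 / ∑ i, v i ^ 2) * (∑ i, v i * (c i - a i)) ^ 2
  set w := ∑ i, v i ^ 2
  constructor
  · rintro ⟨p, hp⟩
    have hpm : p ∈ lineThrough3 a v ∩ Metric.sphere c r := by rw [hp]; rfl
    obtain ⟨⟨t, rfl⟩, hps⟩ := hpm
    have h1 := (hmem t).1 hps
    have h2 : a + (2 * t0 - t) • v ∈ lineThrough3 a v ∩ Metric.sphere c r := by
      refine ⟨⟨_, rfl⟩, (hmem _).2 ?_⟩
      rw [← h1]; ring
    rw [hp, Set.mem_singleton_iff] at h2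
    have h3 : (2 * t0 - t) = t := smul_left_injective ℝ hv (add_left_cancel h2)
    have h4 : t - t0 = 0 := by linarith
    rw [← h1, h4]; ring
  · intro h
    refine ⟨a + t0 • v, ?_⟩
    ext p
    simp only [Set.mem_inter_iff, Set.mem_singleton_iff]
    constructor
    · rintro ⟨⟨t, rfl⟩, hps⟩
      have h1 := (hmem t).1 hps
      have h2 : w * (t - t0) ^ 2 = 0 := by linarith
      have h3 : t - t0 = 0 := by
        rcases mul_eq_zero.1 h2 with h | h
        · exact absurd h hw.ne'
        · exact pow_eq_zero_iff two_ne_zero |>.1 h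
      rw [sub_eq_zero.1 h3]
    · rintro rfl
      refine ⟨⟨_, rfl⟩, (hmem _).2 ?_⟩
      rw [h]; ring

def sp (c : Pt3) (r : ℝ) : R4 := Fin.snoc (α := fun _ => ℝ) (fun i : Fin 3 => c i) (r ^ 2)

open MvPolynomial in
theorem final (M : ℕ) (ε : ℝ) (hε : 0 < ε) (hε1 : ε ≤ 1 / 5) : ∃ A : ℝ, 0 < A ∧
      ∀ (L S : Finset (Set Pt3)),
        (∀ l ∈ L, IsLine3 l) → (∀ s ∈ S, IsSphere3 s) →
        (¬ ∃ G : Finset (Set Pt3), G ⊆ S ∧ ∃ F : Finset (Set Pt3), F ⊆ L ∧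
          G.card = 4 ∧ F.card = M ∧ ∀ l ∈ F, ∀ s ∈ G, Tangent3 l s) →
        (({q : Set Pt3 × Set Pt3 | q.1 ∈ L ∧ q.2 ∈ S ∧ Tangent3 q.1 q.2}).ncard : ℝ) ≤
          A * (bnd ε L.card S.card + L.card + S.card) := by
  classical
  obtain ⟨D, hD, A, hA, H⟩ := recur M ε hε hε1
  refine ⟨A, hA, fun L S hL hS hfree => ?_⟩
  unfold IsLine3 at hL
  unfold IsSphere3 at hS
  choose! a v hv hl using hL
  choose! c r hr hs using hS
  choose h hh using fun y : Set Pt3 => lco D hD (fun i => a y i) (fun i => v y i)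
  have hE : ∀ x y, Ez h x y ↔ x (Fin.last 3) = eval (fun i : Fin 3 => x i.castSucc) (lq (fun i => a y i) (fun i => v y i)) := by
    intro x y
    unfold Ez
    rw [hh, sub_eq_zero]
  set φ : Set Pt3 → R4 := fun s => sp (c s) (r s) with hφ
  have hT : ∀ s ∈ S, ∀ l ∈ L, (Ez h (φ s) l ↔ Tangent3 l s) := by
    intro s hsS l hlL
    rw [hE]
    conv_rhs => rw [hl l hlL, hs s hsS]
    rw [tang_iff _ _ _ _ (hv l hlL) (hr s hsS)]
    simp only [hφ, sp, Fin.snoc_last, Fin.snoc_castSucc]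
  have hinj : Set.InjOn φ S := by
    intro s hsS s' hsS' he
    rw [hs s hsS, hs s' hsS']
    have h1 : c s = c s' := by
      ext i
      have := congrFun he i.castSucc
      simpa only [hφ, sp, Fin.snoc_castSucc] using this
    have h2 : r s ^ 2 = r s' ^ 2 := by
      have := congrFun he (Fin.last 3)
      simpa only [hφ, sp, Fin.snoc_last] using this
    have h3 : r s = r s' := (pow_left_inj₀ (hr s hsS).le (hr s' hsS').le two_ne_zero).1 h2
    rw [h1, h3]
  have hcard : (S.image φ).card = S.card := Finset.card_image_of_injOn hinj
  have hKF : KF (Ez h) M (S.image φ) L := by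
    intro G hG hG4
    by_contra hlt
    push Not at hlt
    obtain ⟨F, hF, hFM⟩ := Finset.exists_subset_card_eq hlt.le
    obtain ⟨G', hG', hGe⟩ := Finset.subset_image_iff.1 hG
    refine hfree ⟨G', hG', F, hF.trans (Finset.filter_subset _ _), ?_, hFM, ?_⟩
    · rw [← hG4, ← hGe, Finset.card_image_of_injOn (hinj.mono hG')]
    · intro l hlF s hsG
      have := Finset.mem_filter.1 (hF hlF)
      refine (hT s (hG' hsG) l this.1).1 (this.2 _ ?_)
      rw [← hGe]
      exact Finset.mem_image_of_mem _ hsG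
  have := H (Set Pt3) h _ (fun y j => (degreeOf_le_totalDegree _ _).trans (lq_total _ _)) (fun x y => (hE x y).1)
    (S.image φ) L hKF
  rw [hcard] at this
  refine le_trans (le_of_eq ?_) this
  congr 1
  have e1 : {q : Set Pt3 × Set Pt3 | q.1 ∈ L ∧ q.2 ∈ S ∧ Tangent3 q.1 q.2} =
      (((L ×ˢ S).filter (fun q => Tangent3 q.1 q.2) : Finset (Set Pt3 × Set Pt3)) : Set (Set Pt3 × Set Pt3)) := by
    ext q
    simp [and_assoc]
  rw [e1, Set.ncard_coe_finset, Finset.card_filter, Finset.sum_product_right]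
  unfold inc
  rw [Finset.sum_image hinj]
  refine Finset.sum_congr rfl fun s hsS => ?_
  rw [Finset.card_filter]
  refine Finset.sum_congr rfl fun l hlL => ?_
  simp only [hT s hsS l hlL]

end LST

theorem line_sphere_tangencies (M : ℕ) (ε : ℝ) (hε : 0 < ε) :
    ∃ A : ℝ, 0 < A ∧
      ∀ (n k : ℕ) (L S : Finset (Set Pt3)),
        L.card = n → S.card = k →
        (∀ l ∈ L, IsLine3 l) → (∀ s ∈ S, IsSphere3 s) →
        (¬ ∃ G : Finset (Set Pt3), G ⊆ S ∧ ∃ F : Finset (Set Pt3), F ⊆ L ∧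
          G.card = 4 ∧ F.card = M ∧ ∀ l ∈ F, ∀ s ∈ G, Tangent3 l s) →
        (({q : Set Pt3 × Set Pt3 | q.1 ∈ L ∧ q.2 ∈ S ∧ Tangent3 q.1 q.2}).ncard : ℝ) ≤
          A * ((n : ℝ) ^ ((4 : ℝ) / 5 + ε) * (k : ℝ) ^ ((4 : ℝ) / 5) + (n : ℝ) + (k : ℝ)) := by
  obtain ⟨A, hA, H⟩ := LST.final M (min ε (1 / 5)) (by positivity) (min_le_right _ _)
  refine ⟨A, hA, ?_⟩
  intro n k L S hn hk hL hS hfree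
  refine (H L S hL hS hfree).trans ?_
  rw [hn, hk]
  unfold LST.bnd
  gcongr ?_ * (?_ * _ + _ + _)
  have hm : 0 < min ε (1 / 5) := by positivity
  rcases Nat.eq_zero_or_pos n with h0 | h0
  · rw [h0, Nat.cast_zero, Real.zero_rpow (by linarith), Real.zero_rpow (by linarith)]
  · exact Real.rpow_le_rpow_of_exponent_le (by exact_mod_cast h0) (by linarith [min_le_left ε (1 / 5)])
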